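/- arXiv:2311.15910 — 3 statements merged into one kernel-verified Lean document; each statement's English description precedes it below -/
import Mathlib

section
/- Let K be a field, E a graph, v, w ∈ E^0, and e_1, …, e_n distinct edges with s(e_i) = v, r(e_i) = w, and let P ∈ GL_n(wL_K(E)w). Then φ_P is an automorphism of L_K(E) if and only if P^{-1} = φ_P(Q) for some Q ∈ GL_n(wL_K(E)w). In this case, φ_{P_m}^{-1} = φ_{Q_m}, P_m = φ_{P_m}(Q_m^{-1}) and P_m^{-1} = φ_{P_m}(Q_m) for all m ≥ 1. In particular, if φ_P(P) = P or φ_P(P^{-1}) = P^{-1}, then φ_P is an automorphism and φ_P^m = φ_{P^m} for every integer m. -/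
/-- A directed graph `E = (E⁰, E¹, s, r)`. -/
structure DirGraph : Type 1 where
  V : Type
  E : Type
  s : E → V
  r : E → V

/-- Generators of the Leavitt path algebra: vertices, edges and ghost edges. -/
inductive LGen (G : DirGraph) : Type
  | vertex : G.V → LGen G
  | edge : G.E → LGen G
  | ghost : G.E → LGen G

/-- The defining relations of the Leavitt path algebra. -/
inductive LRel (K : Type) [Field K] (G : DirGraph) :
    FreeAlgebra K (LGen G) → FreeAlgebra K (LGen G) → Prop
  | vertexIdem (u : G.V) :
      LRel K G (FreeAlgebra.ι K (LGen.vertex u) * FreeAlgebra.ι K (LGen.vertex u))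
        (FreeAlgebra.ι K (LGen.vertex u))
  | vertexOrth (u u' : G.V) (h : u ≠ u') :
      LRel K G (FreeAlgebra.ι K (LGen.vertex u) * FreeAlgebra.ι K (LGen.vertex u')) 0
  | sourceEdge (e : G.E) :
      LRel K G (FreeAlgebra.ι K (LGen.vertex (G.s e)) * FreeAlgebra.ι K (LGen.edge e))
        (FreeAlgebra.ι K (LGen.edge e))
  | edgeRange (e : G.E) :
      LRel K G (FreeAlgebra.ι K (LGen.edge e) * FreeAlgebra.ι K (LGen.vertex (G.r e)))
        (FreeAlgebra.ι K (LGen.edge e))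
  | ghostSource (e : G.E) :
      LRel K G (FreeAlgebra.ι K (LGen.ghost e) * FreeAlgebra.ι K (LGen.vertex (G.s e)))
        (FreeAlgebra.ι K (LGen.ghost e))
  | rangeGhost (e : G.E) :
      LRel K G (FreeAlgebra.ι K (LGen.vertex (G.r e)) * FreeAlgebra.ι K (LGen.ghost e))
        (FreeAlgebra.ι K (LGen.ghost e))
  | ghostEdgeSame (e : G.E) :
      LRel K G (FreeAlgebra.ι K (LGen.ghost e) * FreeAlgebra.ι K (LGen.edge e))
        (FreeAlgebra.ι K (LGen.vertex (G.r e)))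
  | ghostEdgeNe (e f : G.E) (h : e ≠ f) :
      LRel K G (FreeAlgebra.ι K (LGen.ghost e) * FreeAlgebra.ι K (LGen.edge f)) 0
  | ck2 (u : G.V) (hfin : {e : G.E | G.s e = u}.Finite) (hne : {e : G.E | G.s e = u}.Nonempty) :
      LRel K G (FreeAlgebra.ι K (LGen.vertex u))
        (hfin.toFinset.sum fun e =>
          FreeAlgebra.ι K (LGen.edge e) * FreeAlgebra.ι K (LGen.ghost e))

/-- The Leavitt path algebra `L_K(E)` of a graph. -/
abbrev LPA (K : Type) [Field K] (G : DirGraph) : Type := RingQuot (LRel K G)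

noncomputable def vertexEl (K : Type) [Field K] (G : DirGraph) (u : G.V) : LPA K G :=
  RingQuot.mkAlgHom K (LRel K G) (FreeAlgebra.ι K (LGen.vertex u))

noncomputable def edgeEl (K : Type) [Field K] (G : DirGraph) (e : G.E) : LPA K G :=
  RingQuot.mkAlgHom K (LRel K G) (FreeAlgebra.ι K (LGen.edge e))

noncomputable def ghostEl (K : Type) [Field K] (G : DirGraph) (e : G.E) : LPA K G :=
  RingQuot.mkAlgHom K (LRel K G) (FreeAlgebra.ι K (LGen.ghost e))

/-- A list of edges is a (finite) path when ranges and sources match up. -/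
def IsPath (G : DirGraph) (l : List G.E) : Prop :=
  l.Chain' fun e f => G.r e = G.s f

noncomputable def edgeProd (K : Type) [Field K] (G : DirGraph) (l : List G.E) : LPA K G :=
  (l.map (edgeEl K G)).prod

/-- For a path `q`, the element `q* = e_k* ⋯ e_1*`. -/
noncomputable def ghostProd (K : Type) [Field K] (G : DirGraph) (l : List G.E) : LPA K G :=
  (l.reverse.map (ghostEl K G)).prod

/-- The degree `d` component of the ℤ-grading of `L_K(E)`:
the `K`-span of the elements `p q*` with `r(p) = r(q)` and `|p| - |q| = d`. -/
noncomputable def lpaComponent (K : Type) [Field K] (G : DirGraph) (d : ℤ) :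
    Submodule K (LPA K G) :=
  Submodule.span K {x : LPA K G | ∃ p q : List G.E, ∃ u : G.V,
    IsPath G p ∧ IsPath G q ∧ (p.length : ℤ) - (q.length : ℤ) = d ∧
    x = edgeProd K G p * vertexEl K G u * ghostProd K G q}

/-- Membership in the corner `w L_K(E) w`. -/
def InCorner (K : Type) [Field K] (G : DirGraph) (w : G.V) (x : LPA K G) : Prop :=
  vertexEl K G w * x * vertexEl K G w = x

/-- `(P, P')` is a pair consisting of an element of `GL_n(w L_K(E) w)` and its inverse:
all entries lie in the corner `w L_K(E) w`, and `P P' = P' P = w·I_n`,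
the identity matrix of `M_n(w L_K(E) w)`. -/
def IsCornerGLPair (K : Type) [Field K] (G : DirGraph) (w : G.V) {n : ℕ}
    (P P' : Matrix (Fin n) (Fin n) (LPA K G)) : Prop :=
  (∀ i j, InCorner K G w (P i j)) ∧ (∀ i j, InCorner K G w (P' i j)) ∧
    P * P' = Matrix.diagonal (fun _ => vertexEl K G w) ∧
    P' * P = Matrix.diagonal (fun _ => vertexEl K G w)

/-- The defining property of the endomorphism `φ_P` of `L_K(E)` attached to a matrix
`P` (with inverse `P'`) over the corner `w L_K(E) w`:  it fixes all vertices, fixes all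
edges and ghost edges other than `e_1, …, e_n`, and sends
`e_i ↦ Σ_k e_k p_{k i}` and `e_i* ↦ Σ_k p'_{i k} e_k*`. -/
def PhiProps (K : Type) [Field K] (G : DirGraph) {n : ℕ} (es : Fin n → G.E)
    (P P' : Matrix (Fin n) (Fin n) (LPA K G)) (φ : LPA K G →ₐ[K] LPA K G) : Prop :=
  (∀ u : G.V, φ (vertexEl K G u) = vertexEl K G u) ∧
  (∀ e : G.E, e ∉ Set.range es → φ (edgeEl K G e) = edgeEl K G e) ∧
  (∀ e : G.E, e ∉ Set.range es → φ (ghostEl K G e) = ghostEl K G e) ∧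
  (∀ i, φ (edgeEl K G (es i)) = ∑ k, edgeEl K G (es k) * P k i) ∧
  (∀ i, φ (ghostEl K G (es i)) = ∑ k, P' i k * ghostEl K G (es k))

namespace LeavittPathAlgebra

open Finset

section Relations

variable {K : Type} [Field K] {G : DirGraph}

theorem vertexEl_mul_self (u : G.V) : vertexEl K G u * vertexEl K G u = vertexEl K G u := by
  simpa only [vertexEl, map_mul] using RingQuot.mkAlgHom_rel K (LRel.vertexIdem (K := K) u)

theorem vertexEl_mul_of_ne {u u' : G.V} (h : u ≠ u') :
    vertexEl K G u * vertexEl K G u' = 0 := by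
  simpa only [vertexEl, map_mul, map_zero] using
    RingQuot.mkAlgHom_rel K (LRel.vertexOrth (K := K) u u' h)

theorem vertexEl_mul_edgeEl (e : G.E) :
    vertexEl K G (G.s e) * edgeEl K G e = edgeEl K G e := by
  simpa only [vertexEl, edgeEl, map_mul] using
    RingQuot.mkAlgHom_rel K (LRel.sourceEdge (K := K) e)

theorem edgeEl_mul_vertexEl (e : G.E) :
    edgeEl K G e * vertexEl K G (G.r e) = edgeEl K G e := by
  simpa only [vertexEl, edgeEl, map_mul] using
    RingQuot.mkAlgHom_rel K (LRel.edgeRange (K := K) e)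

theorem ghostEl_mul_vertexEl (e : G.E) :
    ghostEl K G e * vertexEl K G (G.s e) = ghostEl K G e := by
  simpa only [vertexEl, ghostEl, map_mul] using
    RingQuot.mkAlgHom_rel K (LRel.ghostSource (K := K) e)

theorem vertexEl_mul_ghostEl (e : G.E) :
    vertexEl K G (G.r e) * ghostEl K G e = ghostEl K G e := by
  simpa only [vertexEl, ghostEl, map_mul] using
    RingQuot.mkAlgHom_rel K (LRel.rangeGhost (K := K) e)

theorem ghostEl_mul_edgeEl_self (e : G.E) :
    ghostEl K G e * edgeEl K G e = vertexEl K G (G.r e) := by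
  simpa only [vertexEl, ghostEl, edgeEl, map_mul] using
    RingQuot.mkAlgHom_rel K (LRel.ghostEdgeSame (K := K) e)

theorem ghostEl_mul_edgeEl_of_ne {e f : G.E} (h : e ≠ f) :
    ghostEl K G e * edgeEl K G f = 0 := by
  simpa only [ghostEl, edgeEl, map_mul, map_zero] using
    RingQuot.mkAlgHom_rel K (LRel.ghostEdgeNe (K := K) e f h)

theorem vertexEl_eq_sum (u : G.V) (hfin : {e : G.E | G.s e = u}.Finite)
    (hne : {e : G.E | G.s e = u}.Nonempty) :
    vertexEl K G u = ∑ e ∈ hfin.toFinset, edgeEl K G e * ghostEl K G e := by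
  simpa only [vertexEl, ghostEl, edgeEl, map_mul, map_sum] using
    RingQuot.mkAlgHom_rel K (LRel.ck2 (K := K) u hfin hne)

theorem vertexEl_mul_edgeEl_of_ne {u : G.V} {e : G.E} (h : u ≠ G.s e) :
    vertexEl K G u * edgeEl K G e = 0 := by
  rw [← vertexEl_mul_edgeEl, ← mul_assoc, vertexEl_mul_of_ne h, zero_mul]

theorem ghostEl_mul_vertexEl_of_ne {u : G.V} {e : G.E} (h : G.s e ≠ u) :
    ghostEl K G e * vertexEl K G u = 0 := by
  rw [← ghostEl_mul_vertexEl, mul_assoc, vertexEl_mul_of_ne h, mul_zero]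

/-- The vertices, edges and ghost edges generate the Leavitt path algebra. -/
theorem induction_generators {C : LPA K G → Prop} (halg : ∀ a : K, C (algebraMap K _ a))
    (hvertex : ∀ u, C (vertexEl K G u)) (hedge : ∀ e, C (edgeEl K G e))
    (hghost : ∀ e, C (ghostEl K G e)) (hmul : ∀ x y, C x → C y → C (x * y))
    (hadd : ∀ x y, C x → C y → C (x + y)) (x : LPA K G) : C x := by
  obtain ⟨y, rfl⟩ := RingQuot.mkAlgHom_surjective K (LRel K G) x
  induction y using FreeAlgebra.induction with
  | grade0 a => simpa using halg a
  | grade1 g =>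
    cases g with
    | vertex u => exact hvertex u
    | edge e => exact hedge e
    | ghost e => exact hghost e
  | mul a b ha hb => simpa using hmul _ _ ha hb
  | add a b ha hb => simpa using hadd _ _ ha hb

/-- Algebra homomorphisms out of the Leavitt path algebra are determined on generators. -/
theorem algHom_ext {A : Type*} [Semiring A] [Algebra K A] {f g : LPA K G →ₐ[K] A}
    (hvertex : ∀ u, f (vertexEl K G u) = g (vertexEl K G u))
    (hedge : ∀ e, f (edgeEl K G e) = g (edgeEl K G e))
    (hghost : ∀ e, f (ghostEl K G e) = g (ghostEl K G e)) : f = g := by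
  refine AlgHom.ext fun x => ?_
  induction x using induction_generators with
  | halg a => simp
  | hvertex u => exact hvertex u
  | hedge e => exact hedge e
  | hghost e => exact hghost e
  | hmul x y hx hy => simp [hx, hy]
  | hadd x y hx hy => simp [hx, hy]

end Relations

section Representation

/-- Labels used for the graded branching representation. -/
def BranchLabel (G : DirGraph) : Type := ℕ ⊕ G.E

instance (G : DirGraph) : Infinite (BranchLabel G) :=
  inferInstanceAs (Infinite (ℕ ⊕ G.E))

/-- A system of injections of the label set, one for each edge, such that at every vertex which
is not a sink the images of the injections partition the label set. -/
theorem exists_branching (G : DirGraph) :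
    ∃ σ : G.E → BranchLabel G → BranchLabel G,
      (∀ e f t t', G.s e = G.s f → σ e t = σ f t' → e = f ∧ t = t') ∧
      ∀ e t, ∃ f t', G.s f = G.s e ∧ σ f t' = t := by
  have hequiv : ∀ u : G.V, Nonempty {e : G.E // G.s e = u} →
      Nonempty ({e : G.E // G.s e = u} × BranchLabel G ≃ BranchLabel G) := by
    intro u _
    rw [← Cardinal.eq, Cardinal.mk_prod, Cardinal.lift_id, Cardinal.lift_id]
    refine Cardinal.mul_eq_right (Cardinal.aleph0_le_mk _) ?_ (Cardinal.mk_ne_zero _)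
    exact Cardinal.mk_le_of_injective (f := fun e => (Sum.inr e.1 : ℕ ⊕ G.E))
      fun a b h => Subtype.ext (Sum.inr_injective h)
  have hcast : ∀ (e : G.E) (t : BranchLabel G) (u : G.V) (he : G.s e = u) (h0 : Nonempty _),
      (hequiv u h0).some (⟨e, he⟩, t) = (hequiv (G.s e) ⟨⟨e, rfl⟩⟩).some (⟨e, rfl⟩, t) := by
    rintro e t _ rfl _; rfl
  refine ⟨fun e t => (hequiv (G.s e) ⟨⟨e, rfl⟩⟩).some (⟨e, rfl⟩, t), ?_, ?_⟩
  · intro e f t t' hs h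
    have := (hequiv (G.s f) ⟨⟨f, rfl⟩⟩).some.injective ((hcast e t _ hs ⟨⟨f, rfl⟩⟩).trans h)
    simpa using this
  · intro e t
    obtain ⟨⟨⟨f, hf⟩, t'⟩, h⟩ := (hequiv (G.s e) ⟨⟨e, rfl⟩⟩).some.surjective t
    exact ⟨f, t', hf, (hcast f t' _ hf ⟨⟨e, rfl⟩⟩).symm.trans h⟩

variable (K : Type) [Field K] {G : DirGraph}

/-- The underlying space of the graded branching representation. -/
abbrev BranchSpace (K : Type) (G : DirGraph) : Type := G.V → BranchLabel G → ℤ → K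

open Classical in
/-- The action of a vertex on the branching representation. -/
noncomputable def branchVertex (u : G.V) : Module.End K (BranchSpace K G) where
  toFun g := fun u' t k => if u' = u then g u' t k else 0
  map_add' g h := by funext u' t k; by_cases hu : u' = u <;> simp [hu]
  map_smul' a g := by funext u' t k; by_cases hu : u' = u <;> simp [hu]

open Classical in
/-- The action of an edge on the branching representation. -/
noncomputable def branchEdge (σ : G.E → BranchLabel G → BranchLabel G) (e : G.E) :
    Module.End K (BranchSpace K G) where
  toFun g := fun u t k => if u = G.s e ∧ t ∈ Set.range (σ e) then
    g (G.r e) (Function.invFun (σ e) t) (k - 1) else 0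
  map_add' g h := by
    funext u t k; dsimp only [Pi.add_apply, Pi.smul_apply, RingHom.id_apply]; split_ifs <;> simp
  map_smul' a g := by
    funext u t k; dsimp only [Pi.add_apply, Pi.smul_apply, RingHom.id_apply]; split_ifs <;> simp

open Classical in
/-- The action of a ghost edge on the branching representation. -/
noncomputable def branchGhost (σ : G.E → BranchLabel G → BranchLabel G) (e : G.E) :
    Module.End K (BranchSpace K G) where
  toFun g := fun u t k => if u = G.r e then g (G.s e) (σ e t) (k + 1) else 0
  map_add' g h := by funext u t k; by_cases hu : u = G.r e <;> simp [hu]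
  map_smul' a g := by funext u t k; by_cases hu : u = G.r e <;> simp [hu]

/-- The graded branching representation. -/
theorem exists_branchRep (G : DirGraph) :
    ∃ (σ : G.E → BranchLabel G → BranchLabel G)
      (ρ : LPA K G →ₐ[K] Module.End K (BranchSpace K G)),
      (∀ u, ρ (vertexEl K G u) = branchVertex K u) ∧
      (∀ e, ρ (edgeEl K G e) = branchEdge K σ e) := by
  classical
  obtain ⟨σ, hinj, hsurj⟩ := exists_branching G
  have hσ : ∀ e t, Function.invFun (σ e) (σ e t) = t := fun e t =>
    Function.leftInverse_invFun (fun a b h => (hinj e e a b rfl h).2) t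
  let gen : LGen G → Module.End K (BranchSpace K G) := fun g =>
    match g with
    | .vertex u => branchVertex K u
    | .edge e => branchEdge K σ e
    | .ghost e => branchGhost K σ e
  have hrel : ∀ ⦃x y⦄, LRel K G x y →
      FreeAlgebra.lift K gen x = FreeAlgebra.lift K gen y := by
    intro x y h
    cases h with
    | vertexIdem u =>
      ext g a t k
      by_cases ha : a = u <;> simp [gen, branchVertex, ha]
    | vertexOrth u u' h =>
      ext g a t k
      by_cases ha : a = u <;> simp_all [gen, branchVertex]
    | sourceEdge e =>
      ext g a t k
      by_cases ha : a = G.s e <;> simp_all [gen, branchVertex, branchEdge]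
    | edgeRange e =>
      ext g a t k
      simp [gen, branchVertex, branchEdge]
    | ghostSource e =>
      ext g a t k
      simp [gen, branchVertex, branchGhost]
    | rangeGhost e =>
      ext g a t k
      by_cases ha : a = G.r e <;> simp_all [gen, branchVertex, branchGhost]
    | ghostEdgeSame e =>
      ext g a t k
      by_cases ha : a = G.r e <;> simp_all [gen, branchVertex, branchGhost, branchEdge]
    | ghostEdgeNe e f h =>
      ext g a t k
      by_cases ha : a = G.r e
      · have : ¬ (G.s e = G.s f ∧ ∃ y, σ f y = σ e t) := fun ⟨h1, y, h2⟩ =>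
          h (hinj e f t y h1 h2.symm).1
        simp [gen, branchGhost, branchEdge, this]
      · simp [gen, branchGhost, branchEdge, ha]
    | ck2 u hfin hne =>
      ext g a t k
      have hterm : ∀ e, (branchEdge K σ e * branchGhost K σ e) g a t k =
          if a = G.s e ∧ t ∈ Set.range (σ e) then g a t k else 0 := by
        intro e
        by_cases ha : a = G.s e ∧ t ∈ Set.range (σ e)
        · obtain ⟨rfl, t', rfl⟩ := ha
          simp [branchGhost, branchEdge, hσ]
        · rw [if_neg ha]
          simp only [Module.End.mul_apply, branchEdge, LinearMap.coe_mk, AddHom.coe_mk]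
          rw [if_neg ha]
      have hsum : (FreeAlgebra.lift K gen) (∑ e ∈ hfin.toFinset,
          FreeAlgebra.ι K (LGen.edge e) * FreeAlgebra.ι K (LGen.ghost e)) g a t k =
          ∑ e ∈ hfin.toFinset, (branchEdge K σ e * branchGhost K σ e) g a t k := by
        simp [gen, LinearMap.sum_apply, Finset.sum_apply]
      rw [hsum]
      simp only [hterm]
      by_cases ha : a = u
      · subst ha
        obtain ⟨e₀, he₀⟩ := hne
        obtain ⟨f, t', hf, rfl⟩ := hsurj e₀ t
        have hfa : G.s f = a := hf.trans he₀
        rw [Finset.sum_eq_single f]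
        · simp [gen, branchVertex, hfa]
        · intro e he hef
          rw [if_neg]
          rintro ⟨h1, t'', h2⟩
          exact hef (hinj e f t'' t' (h1.symm.trans hfa.symm) h2).1
        · intro h
          exact absurd (by simpa using hfa) h
      · rw [Finset.sum_eq_zero]
        · simp [gen, branchVertex, ha]
        · intro e he
          rw [if_neg]
          rintro ⟨h1, -⟩
          exact ha (h1.trans (by simpa using he))
  refine ⟨σ, RingQuot.liftAlgHom K ⟨FreeAlgebra.lift K gen, hrel⟩, fun u => ?_, fun e => ?_⟩
  · simp [vertexEl, gen]
  · simp [edgeEl, gen]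

/-- The span of the real paths of positive length which end at `u`. -/
noncomputable def posPathSpan (u : G.V) : Submodule K (LPA K G) :=
  Submodule.span K {x | ∃ p : List G.E, p ≠ [] ∧ x = edgeProd K G p * vertexEl K G u}

theorem vertexEl_notMem_posPathSpan (u : G.V) : vertexEl K G u ∉ posPathSpan K u := by
  classical
  obtain ⟨σ, ρ, hvertex, hedge⟩ := exists_branchRep K G
  let δ : BranchSpace K G := fun _ _ k => if k = 0 then 1 else 0
  have hlevel : ∀ (g : BranchSpace K G), (∀ a t k, k ≠ 0 → g a t k = 0) →
      ∀ (p : List G.E) a t (k : ℤ), k ≠ p.length → ρ (edgeProd K G p) g a t k = 0 := by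
    intro g hg p
    induction p with
    | nil => intro a t k hk; simpa [edgeProd] using hg a t k (by simpa using hk)
    | cons e p ih =>
      intro a t k hk
      have hk' : k - 1 ≠ p.length := fun h => hk (by simp; omega)
      have : edgeProd K G (e :: p) = edgeEl K G e * edgeProd K G p := by simp [edgeProd]
      simp [this, hedge, branchEdge, ih _ _ _ hk']
  have hzero : ∀ x ∈ posPathSpan K u, ρ x δ u (Classical.arbitrary _) 0 = 0 := by
    intro x hx
    induction hx using Submodule.span_induction with
    | mem x hx =>
      obtain ⟨p, hp, rfl⟩ := hx
      rw [map_mul, Module.End.mul_apply]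
      refine hlevel _ ?_ p _ _ _ ?_
      · intro a t k hk
        simp [hvertex, branchVertex, δ, hk]
      · have := List.length_pos_iff.2 hp
        omega
    | zero => simp
    | add x y _ _ hx hy => simp [hx, hy]
    | smul a x _ hx => simp [hx]
  intro h
  have := hzero _ h
  simp [hvertex, branchVertex, δ] at this

end Representation

section Paths

variable {K : Type} [Field K] {G : DirGraph}

theorem edgeProd_nil : edgeProd K G [] = 1 := rfl

theorem edgeProd_cons (e : G.E) (p : List G.E) :
    edgeProd K G (e :: p) = edgeEl K G e * edgeProd K G p := by simp [edgeProd]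

theorem edgeProd_append (p q : List G.E) :
    edgeProd K G (p ++ q) = edgeProd K G p * edgeProd K G q := by simp [edgeProd]

theorem ghostProd_nil : ghostProd K G [] = 1 := rfl

theorem ghostProd_cons (e : G.E) (p : List G.E) :
    ghostProd K G (e :: p) = ghostProd K G p * ghostEl K G e := by simp [ghostProd]

theorem ghostProd_append (p q : List G.E) :
    ghostProd K G (p ++ q) = ghostProd K G q * ghostProd K G p := by simp [ghostProd]

/-- The list of edges `p` is a path from the first vertex to the second one. -/
def IsPathFromTo (G : DirGraph) : G.V → List G.E → G.V → Prop
  | u, [], u' => u = u'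
  | u, e :: p, u' => G.s e = u ∧ IsPathFromTo G (G.r e) p u'

theorem isPathFromTo_append {u u' : G.V} {p q : List G.E} :
    IsPathFromTo G u (p ++ q) u' ↔ ∃ a, IsPathFromTo G u p a ∧ IsPathFromTo G a q u' := by
  induction p generalizing u with
  | nil => simp [IsPathFromTo]
  | cons e p ih => simp [IsPathFromTo, ih, and_assoc]

theorem IsPathFromTo.range_unique {u a b : G.V} {p : List G.E} (ha : IsPathFromTo G u p a)
    (hb : IsPathFromTo G u p b) : a = b := by
  induction p generalizing u with
  | nil => exact ha.symm.trans hb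
  | cons e p ih => exact ih ha.2 hb.2

theorem vertexEl_mul_edgeProd {u : G.V} {p : List G.E} (hp : p ≠ []) :
    vertexEl K G u * edgeProd K G p = edgeProd K G p ∨
      vertexEl K G u * edgeProd K G p = 0 := by
  cases p with
  | nil => exact absurd rfl hp
  | cons e p =>
    rw [edgeProd_cons, ← mul_assoc]
    by_cases h : u = G.s e
    · left; rw [h, vertexEl_mul_edgeEl]
    · right; rw [vertexEl_mul_edgeEl_of_ne h, zero_mul]

theorem ghostProd_mul_vertexEl {u : G.V} {p : List G.E} (hp : p ≠ []) :
    ghostProd K G p * vertexEl K G u = ghostProd K G p ∨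
      ghostProd K G p * vertexEl K G u = 0 := by
  cases p with
  | nil => exact absurd rfl hp
  | cons e p =>
    rw [ghostProd_cons, mul_assoc]
    by_cases h : G.s e = u
    · left; rw [← h, ghostEl_mul_vertexEl]
    · right; rw [ghostEl_mul_vertexEl_of_ne h, mul_zero]

theorem IsPathFromTo.vertexEl_mul_edgeProd_mul {u u' : G.V} {p : List G.E}
    (h : IsPathFromTo G u p u') :
    vertexEl K G u * edgeProd K G p = edgeProd K G p * vertexEl K G u' := by
  induction p generalizing u with
  | nil => rw [edgeProd_nil, mul_one, one_mul, show u = u' from h]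
  | cons e p ih =>
    obtain ⟨rfl, h⟩ := h
    rw [edgeProd_cons, ← mul_assoc, vertexEl_mul_edgeEl, mul_assoc, ← ih h, ← mul_assoc,
      edgeEl_mul_vertexEl]

theorem isPathFromTo_of_ne_zero {u u' : G.V} {p : List G.E}
    (h : vertexEl K G u * edgeProd K G p * vertexEl K G u' ≠ 0) : IsPathFromTo G u p u' := by
  induction p generalizing u with
  | nil =>
    by_contra hne
    exact h (by rw [edgeProd_nil, mul_one, vertexEl_mul_of_ne hne])
  | cons e p ih =>
    rw [edgeProd_cons, ← mul_assoc] at h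
    have hs : G.s e = u := by
      by_contra hne
      exact h (by rw [vertexEl_mul_edgeEl_of_ne (Ne.symm hne), zero_mul, zero_mul])
    refine ⟨hs, ih fun h0 => h ?_⟩
    rw [← hs, vertexEl_mul_edgeEl, ← edgeEl_mul_vertexEl e, mul_assoc, mul_assoc,
      ← mul_assoc (vertexEl K G (G.r e)), h0, mul_zero]

theorem isPathFromTo_of_ghost_ne_zero {u u' : G.V} {p : List G.E}
    (h : vertexEl K G u' * ghostProd K G p * vertexEl K G u ≠ 0) : IsPathFromTo G u p u' := by
  induction p generalizing u with
  | nil =>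
    by_contra hne
    exact h (by rw [ghostProd_nil, mul_one, vertexEl_mul_of_ne (Ne.symm hne)])
  | cons e p ih =>
    rw [ghostProd_cons, ← mul_assoc, mul_assoc] at h
    have hs : G.s e = u := by
      by_contra hne
      exact h (by rw [ghostEl_mul_vertexEl_of_ne hne, mul_zero])
    refine ⟨hs, ih fun h0 => h ?_⟩
    rw [← hs, ghostEl_mul_vertexEl, ← vertexEl_mul_ghostEl e, ← mul_assoc, h0, zero_mul]

theorem exists_isPathFromTo_of_mul_vertexEl_ne_zero {u : G.V} {p : List G.E}
    (h : edgeProd K G p * vertexEl K G u ≠ 0) : ∃ a, IsPathFromTo G a p u := by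
  cases p with
  | nil => exact ⟨u, rfl⟩
  | cons e p =>
    refine ⟨G.s e, isPathFromTo_of_ne_zero (K := K) ?_⟩
    rwa [edgeProd_cons, ← mul_assoc, vertexEl_mul_edgeEl, ← edgeProd_cons]

theorem IsPathFromTo.ghostProd_mul_edgeProd {u u' : G.V} {p : List G.E}
    (h : IsPathFromTo G u p u') :
    ghostProd K G p * vertexEl K G u * edgeProd K G p = vertexEl K G u' := by
  induction p generalizing u with
  | nil => rw [ghostProd_nil, edgeProd_nil, mul_one, one_mul, show u = u' from h]
  | cons e p ih =>
    obtain ⟨rfl, h⟩ := h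
    rw [ghostProd_cons, mul_assoc _ (ghostEl K G e), ghostEl_mul_vertexEl, edgeProd_cons,
      mul_assoc, ← mul_assoc (ghostEl K G e), ghostEl_mul_edgeEl_self, ← mul_assoc, ih h]

/-- No edge of `p` has a competitor with the same source. -/
def HasNoExit (G : DirGraph) (p : List G.E) : Prop :=
  ∀ e ∈ p, ∀ f, G.s f = G.s e → f = e

theorem edgeEl_mul_ghostEl_of_unique {e : G.E} (h : ∀ f, G.s f = G.s e → f = e) :
    edgeEl K G e * ghostEl K G e = vertexEl K G (G.s e) := by
  have hset : {f : G.E | G.s f = G.s e} = {e} := by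
    ext f; exact ⟨fun hf => h f hf, fun hf => by rw [Set.mem_singleton_iff.1 hf]; rfl⟩
  have hfin : {f : G.E | G.s f = G.s e}.Finite := hset ▸ Set.finite_singleton e
  have htf : hfin.toFinset = {e} := by ext f; simp [← Set.mem_singleton_iff, ← hset]
  rw [vertexEl_eq_sum _ hfin ⟨e, rfl⟩, htf, Finset.sum_singleton]

theorem IsPathFromTo.edgeProd_mul_ghostProd {u u' : G.V} {p : List G.E}
    (h : IsPathFromTo G u p u') (hp : HasNoExit G p) :
    edgeProd K G p * vertexEl K G u' * ghostProd K G p = vertexEl K G u := by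
  induction p generalizing u with
  | nil => rw [ghostProd_nil, edgeProd_nil, mul_one, one_mul, show u = u' from h]
  | cons e p ih =>
    obtain ⟨rfl, h⟩ := h
    rw [ghostProd_cons, edgeProd_cons, ← mul_assoc, mul_assoc (edgeEl K G e),
      mul_assoc (edgeEl K G e), ih h fun f hf => hp f (List.mem_cons_of_mem _ hf),
      edgeEl_mul_vertexEl, edgeEl_mul_ghostEl_of_unique (hp e List.mem_cons_self)]

/-- Compressing a real path of positive length by `τ* (·) τ` gives zero or a real path of
positive length. -/
theorem IsPathFromTo.compress_edgeProd {u u' : G.V} {τ p : List G.E}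
    (hτ : IsPathFromTo G u τ u') (hp : p ≠ []) :
    ghostProd K G τ * (vertexEl K G u * edgeProd K G p * vertexEl K G u) * edgeProd K G τ = 0 ∨
    ∃ q : List G.E, q ≠ [] ∧
      ghostProd K G τ * (vertexEl K G u * edgeProd K G p * vertexEl K G u) * edgeProd K G τ =
        edgeProd K G q * vertexEl K G u' := by
  induction τ generalizing u p with
  | nil =>
    obtain rfl : u = u' := hτ
    simp only [ghostProd_nil, edgeProd_nil, one_mul, mul_one]
    rcases vertexEl_mul_edgeProd (K := K) (u := u) hp with h | h
    · exact Or.inr ⟨p, hp, by rw [h]⟩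
    · exact Or.inl (by rw [h, zero_mul])
  | cons e τ ih =>
    obtain ⟨rfl, hτ⟩ := hτ
    cases p with
    | nil => exact absurd rfl hp
    | cons f p =>
      have hkey : ghostProd K G (e :: τ) * (vertexEl K G (G.s e) * edgeProd K G (f :: p) *
          vertexEl K G (G.s e)) * edgeProd K G (e :: τ) =
          ghostProd K G τ * ((ghostEl K G e * edgeEl K G f) * edgeProd K G p *
            edgeEl K G e) * edgeProd K G τ := by
        rw [ghostProd_cons, edgeProd_cons, edgeProd_cons]
        calc _ = ghostProd K G τ * ((ghostEl K G e * vertexEl K G (G.s e)) * edgeEl K G f *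
              edgeProd K G p * (vertexEl K G (G.s e) * edgeEl K G e)) * edgeProd K G τ := by
              simp only [mul_assoc]
          _ = _ := by rw [ghostEl_mul_vertexEl, vertexEl_mul_edgeEl]
      rw [hkey]
      by_cases hef : e = f
      · subst hef
        have h := ih (p := p ++ [e]) hτ (by simp)
        rw [edgeProd_append, edgeProd_cons, edgeProd_nil, mul_one] at h
        rwa [ghostEl_mul_edgeEl_self, ← edgeEl_mul_vertexEl e, ← mul_assoc _ (edgeEl K G e),
          mul_assoc _ _ (edgeEl K G e)]
      · left
        rw [ghostEl_mul_edgeEl_of_ne hef]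
        simp

/-- Comparing a path with a different path which is not shorter. -/
theorem ghostProd_mul_edgeProd_of_ne {u : G.V} {μ p : List G.E} (hlen : μ.length ≤ p.length)
    (hne : p ≠ μ) :
    ghostProd K G μ * (edgeProd K G p * vertexEl K G u) ∈ posPathSpan K u := by
  induction μ generalizing p with
  | nil =>
    rw [ghostProd_nil, one_mul]
    exact Submodule.subset_span ⟨p, hne, rfl⟩
  | cons e μ ih =>
    cases p with
    | nil => simp at hlen
    | cons f p =>
      rw [ghostProd_cons, edgeProd_cons, mul_assoc, mul_assoc, ← mul_assoc (ghostEl K G e)]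
      by_cases hef : e = f
      · subst hef
        have hp : p ≠ μ := fun h => hne (by rw [h])
        have hlen' : μ.length ≤ p.length := by simpa using hlen
        have hp0 : p ≠ [] := by
          rintro rfl
          exact hp (List.eq_nil_of_length_eq_zero (by simpa using hlen')).symm
        rw [ghostEl_mul_edgeEl_self, ← mul_assoc (vertexEl K G _)]
        rcases vertexEl_mul_edgeProd (K := K) (u := G.r e) hp0 with h | h
        · rw [h]; exact ih hlen' hp
        · rw [h, zero_mul, mul_zero]; exact Submodule.zero_mem _
      · rw [ghostEl_mul_edgeEl_of_ne hef, zero_mul, mul_zero]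
        exact Submodule.zero_mem _

/-- The span of the real paths. -/
noncomputable def pathSpan (u : G.V) : Submodule K (LPA K G) :=
  Submodule.span K {x | ∃ p : List G.E, x = edgeProd K G p * vertexEl K G u}

/-- Every nonzero combination of real paths ending at `u` can be moved to `u` plus a combination
of paths of positive length. -/
theorem exists_ghostProd_mul_eq {u : G.V} {y : LPA K G} (hy : y ∈ pathSpan u) (hy0 : y ≠ 0) :
    ∃ (μ : List G.E) (a : K), a ≠ 0 ∧ ∃ z ∈ posPathSpan K u,
      ghostProd K G μ * y = a • (vertexEl K G u + z) := by
  classical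
  have hrange : {x : LPA K G | ∃ p : List G.E, x = edgeProd K G p * vertexEl K G u} =
      Set.range fun p : List G.E => edgeProd K G p * vertexEl K G u := by
    ext x; simp [eq_comm]
  rw [pathSpan, hrange, Finsupp.mem_span_range_iff_exists_finsupp] at hy
  obtain ⟨c, rfl⟩ := hy
  rw [Finsupp.sum] at hy0 ⊢
  set S := c.support.filter fun p => edgeProd K G p * vertexEl K G u ≠ 0 with hS
  have hsum : ∑ p ∈ c.support, c p • (edgeProd K G p * vertexEl K G u) =
      ∑ p ∈ S, c p • (edgeProd K G p * vertexEl K G u) := by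
    rw [hS, Finset.sum_filter_of_ne]
    intro p _ hp h0
    exact hp (by rw [h0, smul_zero])
  rw [hsum] at hy0 ⊢
  have hne : S.Nonempty := Finset.nonempty_of_sum_ne_zero hy0
  obtain ⟨μ, hμ, hmin⟩ := S.exists_min_image List.length hne
  have hμS := hμ
  rw [hS, Finset.mem_filter, Finsupp.mem_support_iff] at hμ
  obtain ⟨v, hpath⟩ := exists_isPathFromTo_of_mul_vertexEl_ne_zero hμ.2
  refine ⟨μ, c μ, hμ.1, (c μ)⁻¹ • ∑ p ∈ S.erase μ,
    c p • (ghostProd K G μ * (edgeProd K G p * vertexEl K G u)), ?_, ?_⟩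
  · refine Submodule.smul_mem _ _ (Submodule.sum_mem _ fun p hp => Submodule.smul_mem _ _ ?_)
    exact ghostProd_mul_edgeProd_of_ne (hmin p (Finset.mem_of_mem_erase hp))
      (Finset.ne_of_mem_erase hp)
  · rw [smul_add, smul_inv_smul₀ hμ.1, Finset.mul_sum, ← Finset.add_sum_erase _ _ hμS]
    congr 1
    · rw [mul_smul_comm, ← hpath.vertexEl_mul_edgeProd_mul, ← mul_assoc,
        hpath.ghostProd_mul_edgeProd]
    · exact Finset.sum_congr rfl fun p _ => mul_smul_comm _ _ _

/-- A linear combination of paths ending at `u`. -/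
noncomputable def pathComb (u : G.V) (l : List (K × List G.E)) : LPA K G :=
  (l.map fun t => t.1 • (edgeProd K G t.2 * vertexEl K G u)).sum

theorem exists_pathComb_of_mem {u : G.V} {z : LPA K G} (hz : z ∈ posPathSpan K u) :
    ∃ l : List (K × List G.E), (∀ t ∈ l, t.2 ≠ []) ∧ z = pathComb u l := by
  induction hz using Submodule.span_induction with
  | mem x hx =>
    obtain ⟨p, hp, rfl⟩ := hx
    exact ⟨[(1, p)], by simpa using hp, by simp [pathComb]⟩
  | zero => exact ⟨[], by simp, by simp [pathComb]⟩
  | add x y _ _ hx hy =>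
    obtain ⟨l, hl, rfl⟩ := hx
    obtain ⟨l', hl', rfl⟩ := hy
    refine ⟨l ++ l', fun t ht => ?_, by simp [pathComb]⟩
    rcases List.mem_append.1 ht with h | h
    exacts [hl t h, hl' t h]
  | smul a x _ hx =>
    obtain ⟨l, hl, rfl⟩ := hx
    refine ⟨l.map fun t => (a * t.1, t.2), fun t ht => ?_, ?_⟩
    · obtain ⟨t', ht', rfl⟩ := List.mem_map.1 ht
      exact hl t' ht'
    · simp [pathComb, List.smul_sum, Function.comp_def, mul_smul]

theorem pathComb_mem {u : G.V} {l : List (K × List G.E)} (hl : ∀ t ∈ l, t.2 ≠ []) :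
    pathComb u l ∈ posPathSpan K u := by
  refine list_sum_mem fun x hx => ?_
  obtain ⟨t, ht, rfl⟩ := List.mem_map.1 hx
  exact Submodule.smul_mem _ _ (Submodule.subset_span ⟨t.2, hl t ht, rfl⟩)

theorem IsPathFromTo.compress_pathComb {u u' : G.V} {τ : List G.E}
    (hτ : IsPathFromTo G u τ u') {l : List (K × List G.E)} (hl : ∀ t ∈ l, t.2 ≠ []) :
    ∃ l' : List (K × List G.E), (∀ t ∈ l', t.2 ≠ []) ∧ l'.length ≤ l.length ∧
      ((∃ t ∈ l, ghostProd K G τ * (vertexEl K G u * edgeProd K G t.2 * vertexEl K G u) *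
        edgeProd K G τ = 0) → l'.length < l.length) ∧
      ghostProd K G τ * (vertexEl K G u * pathComb u l) * edgeProd K G τ = pathComb u' l' := by
  induction l with
  | nil => exact ⟨[], by simp, by simp, by simp, by simp [pathComb]⟩
  | cons t l ih =>
    obtain ⟨l', h1, h2, h3, h4⟩ := ih fun t ht => hl t (List.mem_cons_of_mem _ ht)
    have hcomb : ghostProd K G τ * (vertexEl K G u * pathComb u (t :: l)) * edgeProd K G τ =
        t.1 • (ghostProd K G τ * (vertexEl K G u * edgeProd K G t.2 * vertexEl K G u) *
          edgeProd K G τ) +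
        ghostProd K G τ * (vertexEl K G u * pathComb u l) * edgeProd K G τ := by
      simp [pathComb, mul_add, add_mul, mul_assoc]
    rw [hcomb, h4]
    by_cases h0 : ghostProd K G τ * (vertexEl K G u * edgeProd K G t.2 * vertexEl K G u) *
        edgeProd K G τ = 0
    · refine ⟨l', h1, by simp; omega, fun _ => by simp; omega, by rw [h0, smul_zero, zero_add]⟩
    · obtain ⟨q, hq, hq'⟩ :=
        (hτ.compress_edgeProd (K := K) (hl t List.mem_cons_self)).resolve_left h0
      refine ⟨(t.1, q) :: l', ?_, by simpa using h2, ?_, ?_⟩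
      · simpa using ⟨hq, fun a b h => h1 (a, b) h⟩
      · rintro ⟨t', ht', h⟩
        rcases List.mem_cons.1 ht' with rfl | ht'
        · exact absurd h h0
        · simpa using h3 ⟨t', ht', h⟩
      · rw [hq']; simp [pathComb]

end Paths

section Hopfian

open Polynomial in
/-- A surjective endomorphism is injective on a corner `uAu` in which every element becomes a
polynomial in `C` after multiplication by a power of the invertible element `C`. -/
theorem eq_zero_of_map_eq_zero_of_corner {K A : Type*} [Field K] [Ring A] [Algebra K A]
    (φ : A →ₐ[K] A) (hφ : Function.Surjective φ) {u C D : A} (hu : φ u = u) (huu : u * u = u)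
    (hC : u * C = C * u) (hCD : C * D = u)
    (hpoly : ∀ x, ∃ (m : ℕ) (f : K[X]), u * x * u * C ^ m = aeval C f * u)
    {z : A} (hz : u * z * u = z) (h0 : φ z = 0) : z = 0 := by
  have hcancel : ∀ m : ℕ, u * C ^ m * D ^ m = u := by
    intro m
    induction m with
    | zero => simp
    | succ m ih =>
      have hCm : u * C ^ m = C ^ m * u := (show Commute u C from hC).pow_right m
      calc u * C ^ (m + 1) * D ^ (m + 1) = u * C ^ m * (C * D) * D ^ m := by
            rw [pow_succ, pow_succ']; simp only [mul_assoc]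
        _ = C ^ m * (u * u) * D ^ m := by rw [hCD, hCm]; simp only [mul_assoc]
        _ = u := by rw [huu, ← hCm, ih]
  let J : ℕ →o Ideal K[X] :=
    { toFun := fun k =>
        { carrier := {f | (φ ^ k) (aeval C f * u) = 0}
          add_mem' := fun {f g} hf hg => by
            change (φ ^ k) _ = 0 at hf hg ⊢
            rw [map_add, add_mul, map_add, hf, hg, add_zero]
          zero_mem' := by simp
          smul_mem' := fun g f hf => by
            change (φ ^ k) _ = 0 at hf ⊢
            rw [smul_eq_mul, map_mul (aeval C), mul_assoc, map_mul (φ ^ k), hf, mul_zero] }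
      monotone' := monotone_nat_of_le_succ fun k f hf => by
        change (φ ^ (k + 1)) (aeval C f * u) = 0
        rw [pow_succ', AlgHom.mul_apply, show (φ ^ k) (aeval C f * u) = 0 from hf, map_zero] }
  obtain ⟨k, hk⟩ := WellFoundedGT.monotone_chain_condition J
  have huk : ∀ k, (φ ^ k) u = u := by
    intro k
    induction k with
    | zero => rfl
    | succ k ih => rw [pow_succ, AlgHom.mul_apply, hu, ih]
  have hsurj : Function.Surjective (φ ^ k) := by
    rw [AlgHom.coe_pow]; exact hφ.iterate k
  obtain ⟨y, hy⟩ := hsurj z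
  have hy' : (φ ^ k) (u * y * u) = z := by rw [map_mul, map_mul, huk, hy, hz]
  obtain ⟨m, f, hf⟩ := hpoly y
  have hfJ : f ∈ J (k + 1) := by
    change (φ ^ (k + 1)) (aeval C f * u) = 0
    rw [← hf, map_mul, pow_succ' φ, AlgHom.mul_apply, hy', h0, zero_mul]
  rw [← hk (k + 1) (Nat.le_succ k)] at hfJ
  have hfk : (φ ^ k) (aeval C f * u) = 0 := hfJ
  have hfull : u * y * u = aeval C f * u * D ^ m := by
    calc u * y * u = u * y * (u * C ^ m * D ^ m) := by rw [hcancel]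
      _ = aeval C f * u * D ^ m := by rw [← hf]; simp only [mul_assoc]
  rw [← hy', hfull, map_mul, hfk, zero_mul]

end Hopfian

section Spanning

variable {K : Type} [Field K] {G : DirGraph}

/-- The span of the monomials `p q*` with `q` of length at most `d`. -/
noncomputable def mixedSpan (K : Type) [Field K] (G : DirGraph) (d : ℕ) :
    Submodule K (LPA K G) :=
  Submodule.span K {x | ∃ (p : List G.E) (a : G.V) (q : List G.E), q.length ≤ d ∧
    x = edgeProd K G p * vertexEl K G a * ghostProd K G q}

theorem monomial_mem_mixedSpan {d : ℕ} (p : List G.E) (a : G.V) {q : List G.E}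
    (hq : q.length ≤ d) :
    edgeProd K G p * vertexEl K G a * ghostProd K G q ∈ mixedSpan K G d :=
  Submodule.subset_span ⟨p, a, q, hq, rfl⟩

theorem mixedSpan_mono {d d' : ℕ} (h : d ≤ d') : mixedSpan K G d ≤ mixedSpan K G d' :=
  Submodule.span_mono fun _ ⟨p, a, q, hq, hx⟩ => ⟨p, a, q, hq.trans h, hx⟩

theorem mul_mem_mixedSpan_of_monomial {g : LPA K G} {d d' : ℕ}
    (h : ∀ (p : List G.E) (a : G.V) (q : List G.E), q.length ≤ d →
      g * (edgeProd K G p * vertexEl K G a * ghostProd K G q) ∈ mixedSpan K G d')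
    {y : LPA K G} (hy : y ∈ mixedSpan K G d) : g * y ∈ mixedSpan K G d' := by
  induction hy using Submodule.span_induction with
  | mem x hx => obtain ⟨p, a, q, hq, rfl⟩ := hx; exact h p a q hq
  | zero => rw [mul_zero]; exact Submodule.zero_mem _
  | add x y _ _ hx hy => rw [mul_add]; exact Submodule.add_mem _ hx hy
  | smul c x _ hx => rw [mul_smul_comm]; exact Submodule.smul_mem _ _ hx

theorem vertexEl_mul_mem_mixedSpan {d : ℕ} (u : G.V) {y : LPA K G}
    (hy : y ∈ mixedSpan K G d) : vertexEl K G u * y ∈ mixedSpan K G d := by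
  refine mul_mem_mixedSpan_of_monomial (fun p a q hq => ?_) hy
  rw [mul_assoc, ← mul_assoc]
  by_cases hp : p = []
  · subst hp
    rw [edgeProd_nil, mul_one, ← mul_assoc]
    by_cases hua : u = a
    · rw [hua, vertexEl_mul_self]
      simpa [edgeProd_nil] using monomial_mem_mixedSpan (K := K) [] a hq
    · rw [vertexEl_mul_of_ne hua, zero_mul]; exact Submodule.zero_mem _
  · rcases vertexEl_mul_edgeProd (K := K) (u := u) hp with h | h
    · rw [h, ← mul_assoc]; exact monomial_mem_mixedSpan p a hq
    · rw [h, zero_mul]; exact Submodule.zero_mem _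

theorem edgeEl_mul_mem_mixedSpan {d : ℕ} (e : G.E) {y : LPA K G}
    (hy : y ∈ mixedSpan K G d) : edgeEl K G e * y ∈ mixedSpan K G d := by
  refine mul_mem_mixedSpan_of_monomial (fun p a q hq => ?_) hy
  rw [← mul_assoc, ← mul_assoc, ← edgeProd_cons]
  exact monomial_mem_mixedSpan _ a hq

theorem ghostEl_mul_mem_mixedSpan {d : ℕ} (e : G.E) {y : LPA K G}
    (hy : y ∈ mixedSpan K G d) : ghostEl K G e * y ∈ mixedSpan K G (d + 1) := by
  refine mul_mem_mixedSpan_of_monomial (fun p a q hq => ?_) hy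
  cases p with
  | nil =>
    rw [edgeProd_nil, one_mul, ← mul_assoc]
    by_cases hea : G.s e = a
    · rw [← hea, ghostEl_mul_vertexEl, ← vertexEl_mul_ghostEl]
      have h := monomial_mem_mixedSpan (K := K) [] (G.r e) (q := q ++ [e]) (d := d + 1)
        (by simpa using hq)
      simpa [ghostProd_append, ghostProd_cons, ghostProd_nil, edgeProd_nil, mul_assoc] using h
    · rw [ghostEl_mul_vertexEl_of_ne hea, zero_mul]; exact Submodule.zero_mem _
  | cons f p =>
    rw [edgeProd_cons, mul_assoc, mul_assoc, ← mul_assoc]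
    by_cases hef : e = f
    · rw [← hef, ghostEl_mul_edgeEl_self]
      refine vertexEl_mul_mem_mixedSpan _ ?_
      rw [← mul_assoc]
      exact monomial_mem_mixedSpan p a (hq.trans (Nat.le_succ d))
    · rw [ghostEl_mul_edgeEl_of_ne hef, zero_mul]; exact Submodule.zero_mem _

theorem exists_mul_vertexEl_mem_mixedSpan (x : LPA K G) (u : G.V) :
    ∃ d, x * vertexEl K G u ∈ mixedSpan K G d := by
  have key : ∀ y : LPA K G, (∃ d, y ∈ mixedSpan K G d) → ∃ d, x * y ∈ mixedSpan K G d := by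
    induction x using induction_generators with
    | halg a =>
      rintro y ⟨d, hy⟩
      exact ⟨d, by rw [← Algebra.smul_def]; exact Submodule.smul_mem _ _ hy⟩
    | hvertex u => rintro y ⟨d, hy⟩; exact ⟨d, vertexEl_mul_mem_mixedSpan u hy⟩
    | hedge e => rintro y ⟨d, hy⟩; exact ⟨d, edgeEl_mul_mem_mixedSpan e hy⟩
    | hghost e => rintro y ⟨d, hy⟩; exact ⟨d + 1, ghostEl_mul_mem_mixedSpan e hy⟩
    | hmul x x' hx hx' => intro y hy; rw [mul_assoc]; exact hx _ (hx' _ hy)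
    | hadd x x' hx hx' =>
      intro y hy
      obtain ⟨d, h⟩ := hx y hy
      obtain ⟨d', h'⟩ := hx' y hy
      exact ⟨max d d', by
        rw [add_mul]
        exact Submodule.add_mem _ (mixedSpan_mono (le_max_left _ _) h)
          (mixedSpan_mono (le_max_right _ _) h')⟩
  refine key _ ⟨0, ?_⟩
  simpa [edgeProd_nil, ghostProd_nil] using monomial_mem_mixedSpan (K := K) (d := 0) [] u
    (q := []) le_rfl

theorem mul_edgeEl_mem_mixedSpan {d : ℕ} (e : G.E) {x : LPA K G}
    (hx : x ∈ mixedSpan K G (d + 1)) : x * edgeEl K G e ∈ mixedSpan K G d := by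
  induction hx using Submodule.span_induction with
  | mem x hx =>
    obtain ⟨p, a, q, hq, rfl⟩ := hx
    cases q with
    | nil =>
      rw [ghostProd_nil, mul_one, mul_assoc]
      by_cases ha : a = G.s e
      · rw [ha, vertexEl_mul_edgeEl, ← edgeEl_mul_vertexEl]
        have h := monomial_mem_mixedSpan (K := K) (d := d) (p ++ [e]) (G.r e) (q := [])
          (Nat.zero_le _)
        simpa [edgeProd_append, edgeProd_cons, edgeProd_nil, ghostProd_nil, mul_assoc] using h
      · rw [vertexEl_mul_edgeEl_of_ne ha, mul_zero]; exact Submodule.zero_mem _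
    | cons f q =>
      have hq' : q.length ≤ d := by simpa using hq
      rw [ghostProd_cons, mul_assoc, mul_assoc _ (ghostEl K G f)]
      by_cases hfe : f = e
      · rw [hfe, ghostEl_mul_edgeEl_self]
        by_cases hq0 : q = []
        · rw [hq0, ghostProd_nil, one_mul, mul_assoc]
          by_cases ha : a = G.r e
          · rw [ha, vertexEl_mul_self]
            simpa [ghostProd_nil] using monomial_mem_mixedSpan (K := K) (d := d) p (G.r e)
              (q := []) (Nat.zero_le _)
          · rw [vertexEl_mul_of_ne ha, mul_zero]; exact Submodule.zero_mem _
        · rcases ghostProd_mul_vertexEl (K := K) (u := G.r e) hq0 with h | h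
          · rw [h]; exact monomial_mem_mixedSpan p a hq'
          · rw [h, mul_zero]; exact Submodule.zero_mem _
      · rw [ghostEl_mul_edgeEl_of_ne hfe, mul_zero, mul_zero]; exact Submodule.zero_mem _
  | zero => rw [zero_mul]; exact Submodule.zero_mem _
  | add x y _ _ hx hy => rw [add_mul]; exact Submodule.add_mem _ hx hy
  | smul c x _ hx => rw [smul_mul_assoc]; exact Submodule.smul_mem _ _ hx

theorem monomial_nil_mul_vertexEl_mem_pathSpan (p : List G.E) (a u : G.V) :
    edgeProd K G p * vertexEl K G a * vertexEl K G u ∈ pathSpan (K := K) u := by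
  rw [mul_assoc]
  by_cases ha : a = u
  · rw [ha, vertexEl_mul_self]; exact Submodule.subset_span ⟨p, rfl⟩
  · rw [vertexEl_mul_of_ne ha, mul_zero]; exact Submodule.zero_mem _

theorem mul_vertexEl_mem_pathSpan {x : LPA K G} (hx : x ∈ mixedSpan K G 0) (u : G.V) :
    x * vertexEl K G u ∈ pathSpan (K := K) u := by
  induction hx using Submodule.span_induction with
  | mem x hx =>
    obtain ⟨p, a, q, hq, rfl⟩ := hx
    obtain rfl : q = [] := List.eq_nil_of_length_eq_zero (Nat.le_zero.1 hq)
    rw [ghostProd_nil, mul_one]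
    exact monomial_nil_mul_vertexEl_mem_pathSpan p a u
  | zero => rw [zero_mul]; exact Submodule.zero_mem _
  | add x y _ _ hx hy => rw [add_mul]; exact Submodule.add_mem _ hx hy
  | smul c x _ hx => rw [smul_mul_assoc]; exact Submodule.smul_mem _ _ hx

/-- The span of the elements `b e*` with `e` an edge emitted by `u`. -/
noncomputable def ghostEndSpan (u : G.V) : Submodule K (LPA K G) :=
  Submodule.span K {x | ∃ (b : LPA K G) (e : G.E), G.s e = u ∧ x = b * ghostEl K G e}

theorem mul_vertexEl_mem_sup {d : ℕ} {x : LPA K G} (hx : x ∈ mixedSpan K G d) (u : G.V) :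
    x * vertexEl K G u ∈ pathSpan (K := K) u ⊔ ghostEndSpan u := by
  induction hx using Submodule.span_induction with
  | mem x hx =>
    obtain ⟨p, a, q, hq, rfl⟩ := hx
    cases q with
    | nil =>
      rw [ghostProd_nil, mul_one]
      exact Submodule.mem_sup_left (monomial_nil_mul_vertexEl_mem_pathSpan p a u)
    | cons e q =>
      rw [ghostProd_cons, mul_assoc, mul_assoc _ (ghostEl K G e)]
      by_cases he : G.s e = u
      · refine Submodule.mem_sup_right (Submodule.subset_span
          ⟨edgeProd K G p * vertexEl K G a * ghostProd K G q, e, he, ?_⟩)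
        rw [← he, ghostEl_mul_vertexEl]
        simp only [mul_assoc]
      · rw [ghostEl_mul_vertexEl_of_ne he, mul_zero, mul_zero]; exact Submodule.zero_mem _
  | zero => rw [zero_mul]; exact Submodule.zero_mem _
  | add x y _ _ hx hy => rw [add_mul]; exact Submodule.add_mem _ hx hy
  | smul c x _ hx => rw [smul_mul_assoc]; exact Submodule.smul_mem _ _ hx

theorem exists_eq_sum_of_mem_ghostEndSpan {u : G.V} {t : LPA K G}
    (ht : t ∈ ghostEndSpan (K := K) u) :
    ∃ T : Finset G.E, (∀ e ∈ T, G.s e = u) ∧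
      t = ∑ e ∈ T, t * edgeEl K G e * ghostEl K G e := by
  classical
  have hmono : ∀ (t : LPA K G) (T T' : Finset G.E), T ⊆ T' →
      t = ∑ e ∈ T, t * edgeEl K G e * ghostEl K G e →
      t = ∑ e ∈ T', t * edgeEl K G e * ghostEl K G e := by
    intro t T T' hTT ht
    rw [← Finset.sum_subset hTT, ← ht]
    intro e _ he
    rw [ht, Finset.sum_mul, Finset.sum_eq_zero, zero_mul]
    intro f hf
    rw [mul_assoc, ghostEl_mul_edgeEl_of_ne (by rintro rfl; exact he hf), mul_zero]
  induction ht using Submodule.span_induction with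
  | mem x hx =>
    obtain ⟨b, e, he, rfl⟩ := hx
    refine ⟨{e}, by simpa using he, ?_⟩
    rw [Finset.sum_singleton, mul_assoc b, ghostEl_mul_edgeEl_self, mul_assoc,
      vertexEl_mul_ghostEl]
  | zero => exact ⟨∅, by simp, by simp⟩
  | add x y _ _ hx hy =>
    obtain ⟨T, hT, hx⟩ := hx
    obtain ⟨T', hT', hy⟩ := hy
    refine ⟨T ∪ T', fun e he => (Finset.mem_union.1 he).elim (hT e) (hT' e), ?_⟩
    simp only [add_mul, Finset.sum_add_distrib]
    rw [← hmono x T _ Finset.subset_union_left hx, ← hmono y T' _ Finset.subset_union_right hy]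
  | smul c x _ hx =>
    obtain ⟨T, hT, hx⟩ := hx
    refine ⟨T, hT, ?_⟩
    simp only [smul_mul_assoc, ← Finset.smul_sum]
    rw [← hx]

end Spanning

section ExitlessCycle

variable {K : Type} [Field K] {G : DirGraph}

theorem HasNoExit.prefix_or_prefix {u a b : G.V} {l c : List G.E} (hl : IsPathFromTo G u l a)
    (hc : IsPathFromTo G u c b) (hno : HasNoExit G c) :
    (∃ β, β ≠ [] ∧ c = l ++ β) ∨ ∃ l', l = c ++ l' := by
  induction l generalizing u c with
  | nil =>
    cases c with
    | nil => exact Or.inr ⟨[], rfl⟩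
    | cons e c => exact Or.inl ⟨e :: c, by simp, rfl⟩
  | cons f l ih =>
    cases c with
    | nil => exact Or.inr ⟨f :: l, rfl⟩
    | cons e c =>
      obtain rfl : f = e := hno e (by simp) f (hl.1.trans hc.1.symm)
      rcases ih hl.2 hc.2 fun g hg => hno g (List.mem_cons_of_mem _ hg) with ⟨β, hβ, h⟩ | ⟨l', h⟩
      · exact Or.inl ⟨β, hβ, by rw [h]; rfl⟩
      · exact Or.inr ⟨l', by rw [h]; rfl⟩

/-- A path starting on an exitless cycle winds around it and then follows an initial segment. -/
theorem HasNoExit.exists_winding {u a : G.V} {c l : List G.E} (hc : IsPathFromTo G u c u)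
    (hc0 : c ≠ []) (hno : HasNoExit G c) (hl : IsPathFromTo G u l a) :
    ∃ (k : ℕ) (α β : List G.E), β ≠ [] ∧ c = α ++ β ∧ IsPathFromTo G u α a ∧
      edgeProd K G l = edgeProd K G c ^ k * edgeProd K G α ∧
      ghostProd K G l = ghostProd K G α * ghostProd K G c ^ k := by
  induction hlen : l.length using Nat.strong_induction_on generalizing l with
  | _ N ih =>
    rcases HasNoExit.prefix_or_prefix hl hc hno with ⟨β, hβ, h⟩ | ⟨l', h⟩
    · exact ⟨0, l, β, hβ, h, hl, by simp, by simp⟩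
    · have hl' : IsPathFromTo G u l' a := by
        rw [h, isPathFromTo_append] at hl
        obtain ⟨b, hb, hl'⟩ := hl
        rwa [hb.range_unique hc] at hl'
      have hlt : l'.length < N := by
        rw [← hlen, h, List.length_append]
        exact Nat.lt_add_of_pos_left (List.length_pos_iff.2 hc0)
      obtain ⟨k, α, β, hβ, hcα, hα, hp, hg⟩ := ih _ hlt hl' rfl
      refine ⟨k + 1, α, β, hβ, hcα, hα, ?_, ?_⟩
      · rw [h, edgeProd_append, hp, pow_succ', mul_assoc]
      · rw [h, ghostProd_append, hg, pow_succ, mul_assoc]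

theorem length_le_of_minimal_cycle {u a : G.V} {c α β α' β' : List G.E}
    (hc : IsPathFromTo G u c u) (hno : HasNoExit G c)
    (hmin : ∀ c', c' ≠ [] → IsPathFromTo G u c' u → HasNoExit G c' → c.length ≤ c'.length)
    (h : c = α ++ β) (h' : c = α' ++ β') (hβ' : β' ≠ [])
    (hα : IsPathFromTo G u α a) (hα' : IsPathFromTo G u α' a) : α'.length ≤ α.length := by
  have hβa : IsPathFromTo G a β' u := by
    rw [h', isPathFromTo_append] at hc
    obtain ⟨b, hb, hβ⟩ := hc
    rwa [hb.range_unique hα'] at hβ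
  have hle := hmin (α ++ β') (by simp [hβ']) (isPathFromTo_append.2 ⟨a, hα, hβa⟩) fun e he =>
    hno e <| by
      rcases List.mem_append.1 he with he | he
      · rw [h]; exact List.mem_append_left _ he
      · rw [h']; exact List.mem_append_right _ he
  rw [h', List.length_append, List.length_append] at hle
  omega

open Polynomial in
/-- In the corner at a vertex of an exitless cycle `c` of minimal length, every element becomes a
polynomial in `c` after multiplication by a power of `c`. -/
theorem exists_aeval_eq_of_minimal_cycle {u : G.V} {c : List G.E} (hc0 : c ≠ [])
    (hc : IsPathFromTo G u c u) (hno : HasNoExit G c)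
    (hmin : ∀ c', c' ≠ [] → IsPathFromTo G u c' u → HasNoExit G c' → c.length ≤ c'.length)
    (x : LPA K G) :
    ∃ (m : ℕ) (f : K[X]), vertexEl K G u * x * vertexEl K G u * edgeProd K G c ^ m =
      aeval (edgeProd K G c) f * vertexEl K G u := by
  set U := vertexEl K G u with hU
  set C := edgeProd K G c with hC
  have hUU : U * U = U := vertexEl_mul_self u
  have hUC : Commute U C := hc.vertexEl_mul_edgeProd_mul
  have hcancel : ∀ b : ℕ, ghostProd K G c ^ b * U * C ^ b = U := by
    intro b
    induction b with
    | zero => simp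
    | succ b ih =>
      calc ghostProd K G c ^ (b + 1) * U * C ^ (b + 1)
          = ghostProd K G c ^ b * (ghostProd K G c * U * C) * C ^ b := by
            rw [pow_succ, pow_succ']; simp only [mul_assoc]
        _ = U := by rw [hc.ghostProd_mul_edgeProd, ih]
  have key : ∀ (d : ℕ), ∀ y ∈ mixedSpan K G d,
      ∃ (m : ℕ) (f : K[X]), U * y * U * C ^ m = aeval C f * U := by
    intro d y hy
    induction hy using Submodule.span_induction with
    | mem y hy =>
      obtain ⟨p, a, q, -, rfl⟩ := hy
      have hsplit : U * (edgeProd K G p * vertexEl K G a * ghostProd K G q) * U =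
          (U * edgeProd K G p * vertexEl K G a) * (vertexEl K G a * ghostProd K G q * U) := by
        rw [← vertexEl_mul_self a]; simp only [mul_assoc]
        simp only [← mul_assoc (vertexEl K G a), vertexEl_mul_self]
      by_cases hp : U * edgeProd K G p * vertexEl K G a = 0
      · exact ⟨0, 0, by rw [hsplit, hp]; simp⟩
      by_cases hq : vertexEl K G a * ghostProd K G q * U = 0
      · exact ⟨0, 0, by rw [hsplit, hq]; simp⟩
      obtain ⟨k, α, β, hβ, hcα, hα, hpk, -⟩ :=
        hno.exists_winding (K := K) hc hc0 (isPathFromTo_of_ne_zero hp)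
      obtain ⟨b, α', β', hβ', hcα', hα', -, hqb⟩ :=
        hno.exists_winding (K := K) hc hc0 (isPathFromTo_of_ghost_ne_zero hq)
      have hlen : α.length = α'.length :=
        le_antisymm (length_le_of_minimal_cycle hc hno hmin hcα' hcα hβ hα' hα)
          (length_le_of_minimal_cycle hc hno hmin hcα hcα' hβ' hα hα')
      obtain rfl : α = α' := (List.append_inj (hcα.symm.trans hcα') hlen).1
      have hαU : edgeProd K G α * vertexEl K G a * ghostProd K G α = U :=
        hα.edgeProd_mul_ghostProd fun e he =>
          hno e (by rw [hcα]; exact List.mem_append_left _ he)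
      refine ⟨b, X ^ k, ?_⟩
      calc U * (edgeProd K G p * vertexEl K G a * ghostProd K G q) * U * C ^ b
          = U * C ^ k * (edgeProd K G α * vertexEl K G a * ghostProd K G α) *
              (ghostProd K G c ^ b * U * C ^ b) := by
            rw [hpk, hqb]; simp only [mul_assoc]; rfl
        _ = aeval C (X ^ k) * U := by
            rw [hαU, hcancel, hUC.pow_right k, mul_assoc, mul_assoc, hUU, hUU, map_pow, aeval_X]
    | zero => exact ⟨0, 0, by simp⟩
    | add y y' _ _ hy hy' =>
      obtain ⟨m, f, h⟩ := hy
      obtain ⟨m', f', h'⟩ := hy'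
      refine ⟨m + m', f * X ^ m' + f' * X ^ m, ?_⟩
      calc U * (y + y') * U * C ^ (m + m')
          = U * y * U * C ^ m * C ^ m' + U * y' * U * C ^ m' * C ^ m := by
            rw [mul_add, add_mul, add_mul, mul_assoc _ (C ^ m), mul_assoc _ (C ^ m'), ← pow_add,
              ← pow_add, add_comm m' m]
        _ = aeval C (f * X ^ m' + f' * X ^ m) * U := by
            rw [h, h', mul_assoc, mul_assoc, hUC.pow_right, hUC.pow_right, map_add, map_mul,
              map_mul, map_pow, map_pow, aeval_X, add_mul, mul_assoc, mul_assoc]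
    | smul a y _ hy =>
      obtain ⟨m, f, h⟩ := hy
      refine ⟨m, a • f, ?_⟩
      rw [mul_smul_comm, smul_mul_assoc, smul_mul_assoc, h, map_smul, smul_mul_assoc]
  obtain ⟨d, hd⟩ := exists_mul_vertexEl_mem_mixedSpan x u
  obtain ⟨m, f, h⟩ := key d _ hd
  exact ⟨m, f, by rw [← h, ← hU, mul_assoc U (x * U), mul_assoc x U, hUU, mul_assoc U]⟩

end ExitlessCycle

section Injectivity

variable {K : Type} [Field K] {G : DirGraph}

theorem IsPathFromTo.compress_vertexEl_add_pathComb {u u' : G.V} {τ : List G.E}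
    (hτ : IsPathFromTo G u τ u') {l : List (K × List G.E)} (hl : ∀ t ∈ l, t.2 ≠ []) :
    ∃ l' : List (K × List G.E), (∀ t ∈ l', t.2 ≠ []) ∧ l'.length ≤ l.length ∧
      ((∃ t ∈ l, ghostProd K G τ * (vertexEl K G u * edgeProd K G t.2 * vertexEl K G u) *
        edgeProd K G τ = 0) → l'.length < l.length) ∧
      ghostProd K G τ * (vertexEl K G u * (vertexEl K G u + pathComb u l)) * edgeProd K G τ =
        vertexEl K G u' + pathComb u' l' := by
  obtain ⟨l', hl', hle, hlt, h⟩ := hτ.compress_pathComb hl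
  refine ⟨l', hl', hle, hlt, ?_⟩
  rw [mul_add, mul_add, add_mul, h, vertexEl_mul_self, hτ.ghostProd_mul_edgeProd]

theorem vertexEl_add_ne_zero {u : G.V} {z : LPA K G} (hz : z ∈ posPathSpan K u) :
    vertexEl K G u + z ≠ 0 := fun h =>
  vertexEl_notMem_posPathSpan K u (by
    rw [eq_neg_of_add_eq_zero_left h]; exact Submodule.neg_mem _ hz)

/-- If no path `τ` from `u` compresses the closed path `p` at `u` to zero, then `p` has no
exit. -/
theorem hasNoExit_of_compress_ne_zero {u : G.V} {p : List G.E} (hp : IsPathFromTo G u p u)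
    (h : ∀ (τ : List G.E) (u' : G.V), IsPathFromTo G u τ u' →
      ghostProd K G τ * (vertexEl K G u * edgeProd K G p * vertexEl K G u) *
        edgeProd K G τ ≠ 0) : HasNoExit G p := by
  intro e he f hf
  by_contra hne
  obtain ⟨α, β, rfl⟩ := List.append_of_mem he
  obtain ⟨b, hα, hβ⟩ := isPathFromTo_append.1 hp
  refine h (α ++ [f]) (G.r f) (isPathFromTo_append.2 ⟨b, hα, hf.trans hβ.1, rfl⟩) ?_
  have hzero : ghostProd K G (α ++ [f]) * (vertexEl K G u * edgeProd K G (α ++ e :: β)) = 0 := by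
    calc ghostProd K G (α ++ [f]) * (vertexEl K G u * edgeProd K G (α ++ e :: β))
        = ghostEl K G f * (ghostProd K G α * vertexEl K G u * edgeProd K G α) *
            edgeEl K G e * edgeProd K G β := by
          rw [ghostProd_append, edgeProd_append, edgeProd_cons, ghostProd_cons, ghostProd_nil,
            one_mul]
          simp only [mul_assoc]
      _ = 0 := by
          rw [hα.ghostProd_mul_edgeProd, ← hβ.1, mul_assoc (ghostEl K G f), vertexEl_mul_edgeEl,
            ghostEl_mul_edgeEl_of_ne hne, zero_mul]
  rw [← mul_assoc, hzero, zero_mul, zero_mul]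

theorem map_vertexEl_add_pathComb_ne_zero {φ : LPA K G →ₐ[K] LPA K G}
    (hφ : Function.Surjective φ) (hv : ∀ u, φ (vertexEl K G u) = vertexEl K G u)
    {u : G.V} {l : List (K × List G.E)} (hl : ∀ t ∈ l, t.2 ≠ []) :
    φ (vertexEl K G u + pathComb u l) ≠ 0 := by
  intro h0
  induction hN : l.length using Nat.strong_induction_on generalizing u l with
  | _ N ih =>
    by_cases hex : ∃ (τ : List G.E) (u' : G.V), IsPathFromTo G u τ u' ∧ ∃ t ∈ l,
        ghostProd K G τ * (vertexEl K G u * edgeProd K G t.2 * vertexEl K G u) *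
          edgeProd K G τ = 0
    · obtain ⟨τ, u', hτ, ht⟩ := hex
      obtain ⟨l', hl', -, hlt, h⟩ := hτ.compress_vertexEl_add_pathComb hl
      refine ih l'.length (hN ▸ hlt ht) (u := u') hl' ?_ rfl
      rw [← h, map_mul, map_mul, map_mul, h0, mul_zero, mul_zero, zero_mul]
    · push Not at hex
      cases l with
      | nil =>
        have : vertexEl K G u + 0 = 0 := by
          simpa [pathComb, hv] using h0
        exact vertexEl_add_ne_zero (Submodule.zero_mem _) this
      | cons t l =>
        have hne := fun τ u' hτ => hex τ u' hτ t (by simp)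
        have hp : IsPathFromTo G u t.2 u := by
          refine isPathFromTo_of_ne_zero (K := K) ?_
          simpa [ghostProd_nil, edgeProd_nil] using hne [] u rfl
        have hex' : ∃ k c, c ≠ [] ∧ IsPathFromTo G u c u ∧ HasNoExit G c ∧ c.length = k :=
          ⟨_, t.2, hl t (by simp), hp, hasNoExit_of_compress_ne_zero (K := K) hp hne, rfl⟩
        classical
        obtain ⟨c, hc0, hc, hno, hclen⟩ := Nat.find_spec hex'
        have hmin : ∀ c', c' ≠ [] → IsPathFromTo G u c' u → HasNoExit G c' →
            c.length ≤ c'.length := fun c' h h' h'' => by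
          rw [hclen]; exact Nat.find_min' hex' ⟨c', h, h', h'', rfl⟩
        obtain ⟨l', hl', -, -, h⟩ :=
          IsPathFromTo.compress_vertexEl_add_pathComb (K := K) (τ := []) (u := u) (u' := u) rfl hl
        rw [ghostProd_nil, edgeProd_nil, one_mul, mul_one] at h
        have hright : ∀ l'' : List (K × List G.E),
            (vertexEl K G u + pathComb u l'') * vertexEl K G u =
              vertexEl K G u + pathComb u l'' := by
          intro l''
          rw [add_mul, vertexEl_mul_self]
          congr 1
          induction l'' with
          | nil => simp [pathComb]
          | cons s l'' ih =>
            simp only [pathComb, List.map_cons, List.sum_cons, add_mul] at ih ⊢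
            rw [ih, smul_mul_assoc, mul_assoc, vertexEl_mul_self]
        have hcc : edgeProd K G c * ghostProd K G c = vertexEl K G u := by
          rw [← hc.edgeProd_mul_ghostProd (K := K) hno, ← hc.vertexEl_mul_edgeProd_mul]
          cases c with
          | nil => exact absurd rfl hc0
          | cons e c => rw [← hc.1, edgeProd_cons, ← mul_assoc (vertexEl K G _),
              vertexEl_mul_edgeEl]
        refine vertexEl_add_ne_zero (u := u) (pathComb_mem hl') ?_
        refine eq_zero_of_map_eq_zero_of_corner φ hφ (hv u) (vertexEl_mul_self u)
          hc.vertexEl_mul_edgeProd_mul hcc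
          (exists_aeval_eq_of_minimal_cycle hc0 hc hno hmin) ?_ ?_
        · rw [mul_assoc, hright, ← h, ← mul_assoc, vertexEl_mul_self]
        · rw [← h, map_mul, h0, mul_zero]

theorem eq_zero_of_mem_pathSpan_of_map_eq_zero {φ : LPA K G →ₐ[K] LPA K G}
    (hφ : Function.Surjective φ) (hv : ∀ u, φ (vertexEl K G u) = vertexEl K G u)
    {u : G.V} {y : LPA K G} (hy : y ∈ pathSpan (K := K) u) (h0 : φ y = 0) : y = 0 := by
  by_contra hy0
  obtain ⟨μ, a, ha, z, hz, h⟩ := exists_ghostProd_mul_eq hy hy0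
  obtain ⟨l, hl, rfl⟩ := exists_pathComb_of_mem hz
  refine map_vertexEl_add_pathComb_ne_zero (u := u) hφ hv hl ((smul_eq_zero_iff_right ha).1 ?_)
  rw [← map_smul, ← h, map_mul, h0, mul_zero]

theorem eq_zero_of_mem_pathSpan_of_mul_edgeEl_eq_zero {y : LPA K G} {e : G.E}
    (hy : y ∈ pathSpan (K := K) (G.s e)) (h0 : y * edgeEl K G e = 0) : y = 0 := by
  by_contra hy0
  obtain ⟨μ, a, ha, z, hz, h⟩ := exists_ghostProd_mul_eq hy hy0
  obtain ⟨l, hl, rfl⟩ := exists_pathComb_of_mem hz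
  have hτ : IsPathFromTo G (G.s e) [e] (G.r e) := ⟨rfl, rfl⟩
  obtain ⟨l', hl', -, -, h'⟩ := hτ.compress_vertexEl_add_pathComb hl
  refine vertexEl_add_ne_zero (u := G.r e) (pathComb_mem hl') ?_
  have hmul : (vertexEl K G (G.s e) + pathComb (G.s e) l) * edgeEl K G e = 0 := by
    refine (smul_eq_zero_iff_right ha).1 ?_
    rw [← smul_mul_assoc, ← h, mul_assoc, h0, mul_zero]
  rw [← h', edgeProd_cons, edgeProd_nil, mul_one, mul_assoc, mul_assoc, hmul, mul_zero, mul_zero]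

theorem exists_mul_one_sub_eq (x : LPA K G) :
    ∃ (a : K) (T : Finset G.V), ∀ T', T ⊆ T' →
      x * (1 - ∑ u ∈ T', vertexEl K G u) = a • (1 - ∑ u ∈ T', vertexEl K G u) := by
  classical
  have hkill : ∀ (x : LPA K G) (u : G.V), x * vertexEl K G u = x →
      ∃ (a : K) (T : Finset G.V), ∀ T', T ⊆ T' →
        x * (1 - ∑ u ∈ T', vertexEl K G u) = a • (1 - ∑ u ∈ T', vertexEl K G u) := by
    intro x u hx
    refine ⟨0, {u}, fun T' hT' => ?_⟩
    rw [zero_smul, mul_sub, mul_one, Finset.mul_sum, Finset.sum_eq_single u, hx, sub_self]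
    · intro b _ hb
      rw [← hx, mul_assoc, vertexEl_mul_of_ne hb.symm, mul_zero]
    · intro hu; exact absurd (hT' (Finset.mem_singleton_self u)) hu
  induction x using induction_generators with
  | halg a => exact ⟨a, ∅, fun T' _ => by rw [Algebra.smul_def]⟩
  | hvertex u => exact hkill _ u (vertexEl_mul_self u)
  | hedge e => exact hkill _ _ (edgeEl_mul_vertexEl e)
  | hghost e => exact hkill _ _ (ghostEl_mul_vertexEl e)
  | hmul x y hx hy =>
    obtain ⟨a, T, h⟩ := hx
    obtain ⟨a', T', h'⟩ := hy
    refine ⟨a' * a, T ∪ T', fun S hS => ?_⟩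
    rw [mul_assoc, h' S (Finset.union_subset_right hS), mul_smul_comm,
      h S (Finset.union_subset_left hS), smul_smul]
  | hadd x y hx hy =>
    obtain ⟨a, T, h⟩ := hx
    obtain ⟨a', T', h'⟩ := hy
    refine ⟨a + a', T ∪ T', fun S hS => ?_⟩
    rw [add_mul, h' S (Finset.union_subset_right hS), h S (Finset.union_subset_left hS), add_smul]

theorem eq_zero_of_mul_vertexEl_eq_zero {φ : LPA K G →ₐ[K] LPA K G}
    (hv : ∀ u, φ (vertexEl K G u) = vertexEl K G u) {x : LPA K G}
    (hx : ∀ u, x * vertexEl K G u = 0) (h0 : φ x = 0) : x = 0 := by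
  obtain ⟨a, T, h⟩ := exists_mul_one_sub_eq x
  have hxa := h T subset_rfl
  rw [mul_sub, mul_one, Finset.mul_sum, Finset.sum_eq_zero fun u _ => hx u, sub_zero] at hxa
  have hfix : φ x = x := by
    rw [hxa, map_smul, map_sub, map_one, map_sum, Finset.sum_congr rfl fun u _ => hv u]
  rw [← hfix, h0]

theorem eq_zero_of_mem_mixedSpan_of_map_eq_zero {φ : LPA K G →ₐ[K] LPA K G}
    (hφ : Function.Surjective φ) (hv : ∀ u, φ (vertexEl K G u) = vertexEl K G u) {d : ℕ}
    {x : LPA K G} (hx : x ∈ mixedSpan K G d) (h0 : φ x = 0) : x = 0 := by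
  have hmap : ∀ y, φ (x * y) = 0 := fun y => by rw [map_mul, h0, zero_mul]
  induction d generalizing x with
  | zero =>
    exact eq_zero_of_mul_vertexEl_eq_zero hv (fun u => eq_zero_of_mem_pathSpan_of_map_eq_zero hφ hv
      (mul_vertexEl_mem_pathSpan hx u) (hmap _)) h0
  | succ d ih =>
    have hedge : ∀ e, x * edgeEl K G e = 0 := fun e =>
      ih (mul_edgeEl_mem_mixedSpan e hx) (hmap _) fun y => by rw [mul_assoc]; exact hmap _
    refine eq_zero_of_mul_vertexEl_eq_zero hv (fun u => ?_) h0
    obtain ⟨y, hy, t, ht, hyt⟩ := Submodule.mem_sup.1 (mul_vertexEl_mem_sup hx u)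
    obtain ⟨T, hT, htT⟩ := exists_eq_sum_of_mem_ghostEndSpan ht
    rcases Set.eq_empty_or_nonempty {e : G.E | G.s e = u} with hempty | hne
    · have hT0 : T = ∅ := Finset.eq_empty_of_forall_notMem fun e he =>
        Set.eq_empty_iff_forall_notMem.1 hempty e (hT e he)
      rw [hT0, Finset.sum_empty] at htT
      rw [htT, add_zero] at hyt
      rw [← hyt]
      exact eq_zero_of_mem_pathSpan_of_map_eq_zero hφ hv hy (by rw [hyt]; exact hmap _)
    by_cases hfin : {e : G.E | G.s e = u}.Finite
    · rw [vertexEl_eq_sum u hfin hne, Finset.mul_sum]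
      exact Finset.sum_eq_zero fun e _ => by rw [← mul_assoc, hedge, zero_mul]
    · obtain ⟨e, he, heT⟩ := (Set.Infinite.exists_notMem_finset hfin T)
      have hxe : ∀ f, G.s f = u → x * vertexEl K G u * edgeEl K G f = 0 := by
        rintro f rfl
        rw [mul_assoc, vertexEl_mul_edgeEl, hedge]
      have hte : t * edgeEl K G e = 0 := by
        rw [htT, Finset.sum_mul]
        refine Finset.sum_eq_zero fun f hf => ?_
        rw [mul_assoc, ghostEl_mul_edgeEl_of_ne (by rintro rfl; exact heT hf), mul_zero]
      have hy0 : y = 0 := by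
        obtain rfl : G.s e = u := he
        refine eq_zero_of_mem_pathSpan_of_mul_edgeEl_eq_zero hy ?_
        have h := hxe e rfl
        rwa [← hyt, add_mul, hte, add_zero] at h
      rw [hy0, zero_add] at hyt
      rw [← hyt, htT]
      exact Finset.sum_eq_zero fun f hf => by rw [hyt, hxe f (hT f hf), zero_mul]

/-- A surjective endomorphism of a Leavitt path algebra that fixes the vertices is injective. -/
theorem injective_of_surjective {φ : LPA K G →ₐ[K] LPA K G} (hφ : Function.Surjective φ)
    (hv : ∀ u, φ (vertexEl K G u) = vertexEl K G u) : Function.Injective φ := by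
  rw [injective_iff_map_eq_zero]
  intro x h0
  refine eq_zero_of_mul_vertexEl_eq_zero hv (fun u => ?_) h0
  obtain ⟨d, hd⟩ := exists_mul_vertexEl_mem_mixedSpan x u
  exact eq_zero_of_mem_mixedSpan_of_map_eq_zero hφ hv hd (by rw [map_mul, h0, zero_mul])

end Injectivity

section CornerMatrices

variable {K : Type} [Field K] {G : DirGraph} {w : G.V} {n : ℕ}
  {P P' Q Q' M N M' N' : Matrix (Fin n) (Fin n) (LPA K G)} {φ ψ : LPA K G →ₐ[K] LPA K G}
  {es : Fin n → G.E}

theorem inCorner_iff {x : LPA K G} :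
    InCorner K G w x ↔ vertexEl K G w * x = x ∧ x * vertexEl K G w = x := by
  refine ⟨fun h => ?_, fun h => by rw [InCorner, h.1, h.2]⟩
  rw [InCorner] at h
  constructor
  · rw [← h, ← mul_assoc, ← mul_assoc, vertexEl_mul_self]
  · rw [← h, mul_assoc, vertexEl_mul_self]

theorem diagonal_vertexEl_mul (hM : ∀ i j, InCorner K G w (M i j)) :
    Matrix.diagonal (fun _ => vertexEl K G w) * M = M := by
  ext i j; rw [Matrix.diagonal_mul, (inCorner_iff.1 (hM i j)).1]

theorem mul_diagonal_vertexEl (hM : ∀ i j, InCorner K G w (M i j)) :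
    M * Matrix.diagonal (fun _ => vertexEl K G w) = M := by
  ext i j; rw [Matrix.mul_diagonal, (inCorner_iff.1 (hM i j)).2]

theorem inCorner_diagonal (i j : Fin n) :
    InCorner K G w (Matrix.diagonal (fun _ => vertexEl K G w) i j) := by
  by_cases h : i = j
  · rw [h, Matrix.diagonal_apply_eq, InCorner, vertexEl_mul_self, vertexEl_mul_self]
  · rw [Matrix.diagonal_apply_ne _ h, InCorner, mul_zero, zero_mul]

theorem inCorner_mul (hM : ∀ i j, InCorner K G w (M i j)) (hN : ∀ i j, InCorner K G w (N i j))
    (i j : Fin n) : InCorner K G w ((M * N) i j) := by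
  rw [inCorner_iff, Matrix.mul_apply, Finset.mul_sum, Finset.sum_mul]
  constructor
  · exact Finset.sum_congr rfl fun k _ => by rw [← mul_assoc, (inCorner_iff.1 (hM i k)).1]
  · exact Finset.sum_congr rfl fun k _ => by rw [mul_assoc, (inCorner_iff.1 (hN k j)).2]

theorem inCorner_map (hw : φ (vertexEl K G w) = vertexEl K G w)
    (hM : ∀ i j, InCorner K G w (M i j)) (i j : Fin n) : InCorner K G w (M.map φ i j) := by
  have h := congrArg φ (hM i j)
  rwa [map_mul, map_mul, hw] at h

theorem map_diagonal_vertexEl (hw : φ (vertexEl K G w) = vertexEl K G w) :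
    (Matrix.diagonal (fun _ : Fin n => vertexEl K G w)).map φ =
      Matrix.diagonal (fun _ => vertexEl K G w) := by
  rw [Matrix.diagonal_map (map_zero φ), hw]

theorem _root_.IsCornerGLPair.symm (h : IsCornerGLPair K G w P P') :
    IsCornerGLPair K G w P' P :=
  ⟨h.2.1, h.1, h.2.2.2, h.2.2.1⟩

theorem _root_.IsCornerGLPair.map (hw : φ (vertexEl K G w) = vertexEl K G w)
    (h : IsCornerGLPair K G w P P') : IsCornerGLPair K G w (P.map φ) (P'.map φ) :=
  ⟨inCorner_map hw h.1, inCorner_map hw h.2.1,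
    by rw [← Matrix.map_mul, h.2.2.1, map_diagonal_vertexEl hw],
    by rw [← Matrix.map_mul, h.2.2.2, map_diagonal_vertexEl hw]⟩

theorem _root_.IsCornerGLPair.mul (hP : IsCornerGLPair K G w P P')
    (hQ : IsCornerGLPair K G w Q Q') : IsCornerGLPair K G w (P * Q) (Q' * P') := by
  refine ⟨inCorner_mul hP.1 hQ.1, inCorner_mul hQ.2.1 hP.2.1, ?_, ?_⟩
  · rw [Matrix.mul_assoc, ← Matrix.mul_assoc Q, hQ.2.2.1, diagonal_vertexEl_mul hP.2.1, hP.2.2.1]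
  · rw [Matrix.mul_assoc, ← Matrix.mul_assoc P', hP.2.2.2, diagonal_vertexEl_mul hQ.1, hQ.2.2.2]

theorem _root_.IsCornerGLPair.eq_of_mul_eq (hP : IsCornerGLPair K G w P P')
    (hM : ∀ i j, InCorner K G w (M i j))
    (h : P * M = Matrix.diagonal (fun _ => vertexEl K G w)) : M = P' := by
  rw [← diagonal_vertexEl_mul hM, ← hP.2.2.2, Matrix.mul_assoc, h, mul_diagonal_vertexEl hP.2.1]

theorem _root_.IsCornerGLPair.eq_of_mul_eq' (hP : IsCornerGLPair K G w P P')
    (hM : ∀ i j, InCorner K G w (M i j))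
    (h : M * P = Matrix.diagonal (fun _ => vertexEl K G w)) : M = P' := by
  rw [← mul_diagonal_vertexEl hM, ← hP.2.2.1, ← Matrix.mul_assoc, h,
    diagonal_vertexEl_mul hP.2.1]

theorem _root_.IsCornerGLPair.inv_unique (hP : IsCornerGLPair K G w P P')
    (hM : IsCornerGLPair K G w P M) : M = P' :=
  hP.eq_of_mul_eq hM.2.1 hM.2.2.1

theorem _root_.PhiProps.comp (hφ : PhiProps K G es P P' φ) (hψ : PhiProps K G es Q Q' ψ) :
    PhiProps K G es (P * Q.map φ) (Q'.map φ * P') (φ.comp ψ) := by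
  obtain ⟨hv, he, hg, hE, hG⟩ := hφ
  obtain ⟨hv', he', hg', hE', hG'⟩ := hψ
  refine ⟨fun u => ?_, fun e h => ?_, fun e h => ?_, fun i => ?_, fun i => ?_⟩
  · rw [AlgHom.comp_apply, hv', hv]
  · rw [AlgHom.comp_apply, he' e h, he e h]
  · rw [AlgHom.comp_apply, hg' e h, hg e h]
  · simp only [AlgHom.comp_apply, hE', map_sum, map_mul, hE, Matrix.mul_apply, Matrix.map_apply,
      Finset.sum_mul, Finset.mul_sum, mul_assoc]
    exact Finset.sum_comm
  · simp only [AlgHom.comp_apply, hG', map_sum, map_mul, hG, Matrix.mul_apply, Matrix.map_apply,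
      Finset.sum_mul, Finset.mul_sum, mul_assoc]
    exact Finset.sum_comm

theorem _root_.PhiProps.unique (hφ : PhiProps K G es P P' φ) (hψ : PhiProps K G es P P' ψ) :
    φ = ψ := by
  obtain ⟨hv, he, hg, hE, hG⟩ := hφ
  obtain ⟨hv', he', hg', hE', hG'⟩ := hψ
  refine algHom_ext (fun u => by rw [hv, hv']) (fun e => ?_) (fun e => ?_)
  · by_cases h : e ∈ Set.range es
    · obtain ⟨i, rfl⟩ := h; rw [hE, hE']
    · rw [he e h, he' e h]
  · by_cases h : e ∈ Set.range es
    · obtain ⟨i, rfl⟩ := h; rw [hG, hG']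
    · rw [hg e h, hg' e h]

theorem sum_edgeEl_mul_diagonal (hr : ∀ i, G.r (es i) = w) (i : Fin n) :
    ∑ k, edgeEl K G (es k) * Matrix.diagonal (fun _ => vertexEl K G w) k i =
      edgeEl K G (es i) := by
  rw [Finset.sum_eq_single i, Matrix.diagonal_apply_eq, ← hr i, edgeEl_mul_vertexEl]
  · intro k _ hk; rw [Matrix.diagonal_apply_ne _ hk, mul_zero]
  · simp

theorem sum_diagonal_mul_ghostEl (hr : ∀ i, G.r (es i) = w) (i : Fin n) :
    ∑ k, Matrix.diagonal (fun _ => vertexEl K G w) i k * ghostEl K G (es k) =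
      ghostEl K G (es i) := by
  rw [Finset.sum_eq_single i, Matrix.diagonal_apply_eq, ← hr i, vertexEl_mul_ghostEl]
  · intro k _ hk; rw [Matrix.diagonal_apply_ne _ hk.symm, zero_mul]
  · simp

theorem phiProps_id (hr : ∀ i, G.r (es i) = w) :
    PhiProps K G es (Matrix.diagonal fun _ => vertexEl K G w)
      (Matrix.diagonal fun _ => vertexEl K G w) (AlgHom.id K (LPA K G)) :=
  ⟨fun _ => rfl, fun _ _ => rfl, fun _ _ => rfl, fun i => (sum_edgeEl_mul_diagonal hr i).symm,
    fun i => (sum_diagonal_mul_ghostEl hr i).symm⟩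

theorem _root_.PhiProps.eq_ghostEl_mul (hes : Function.Injective es) (hr : ∀ i, G.r (es i) = w)
    (hM : ∀ i j, InCorner K G w (M i j)) (hφ : PhiProps K G es M M' φ) (i j : Fin n) :
    M i j = ghostEl K G (es i) * φ (edgeEl K G (es j)) := by
  rw [hφ.2.2.2.1, Finset.mul_sum, Finset.sum_eq_single i, ← mul_assoc, ghostEl_mul_edgeEl_self, hr,
    (inCorner_iff.1 (hM i j)).1]
  · intro k _ hk
    rw [← mul_assoc, ghostEl_mul_edgeEl_of_ne (hes.ne hk.symm), zero_mul]
  · simp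

theorem _root_.PhiProps.eq_mul_edgeEl (hes : Function.Injective es) (hr : ∀ i, G.r (es i) = w)
    (hM : ∀ i j, InCorner K G w (M' i j)) (hφ : PhiProps K G es M M' φ) (i j : Fin n) :
    M' i j = φ (ghostEl K G (es i)) * edgeEl K G (es j) := by
  rw [hφ.2.2.2.2, Finset.sum_mul, Finset.sum_eq_single j, mul_assoc, ghostEl_mul_edgeEl_self, hr,
    (inCorner_iff.1 (hM i j)).2]
  · intro k _ hk
    rw [mul_assoc, ghostEl_mul_edgeEl_of_ne (hes.ne hk), mul_zero]
  · simp

theorem _root_.PhiProps.matrix_unique (hes : Function.Injective es) (hr : ∀ i, G.r (es i) = w)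
    (hM : ∀ i j, InCorner K G w (M i j)) (hM' : ∀ i j, InCorner K G w (M' i j))
    (hN : ∀ i j, InCorner K G w (N i j)) (hN' : ∀ i j, InCorner K G w (N' i j))
    (hφ : PhiProps K G es M M' φ) (hφ' : PhiProps K G es N N' φ) : M = N ∧ M' = N' := by
  constructor
  · ext i j; rw [hφ.eq_ghostEl_mul hes hr hM, hφ'.eq_ghostEl_mul hes hr hN]
  · ext i j; rw [hφ.eq_mul_edgeEl hes hr hM', hφ'.eq_mul_edgeEl hes hr hN']

theorem _root_.PhiProps.comp_eq_id (hr : ∀ i, G.r (es i) = w) (hP : IsCornerGLPair K G w P P')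
    (hφ : PhiProps K G es P P' φ) (hψ : PhiProps K G es Q Q' ψ) (h : Q.map φ = P')
    (h' : Q'.map φ = P) : φ.comp ψ = AlgHom.id K (LPA K G) := by
  have hc := hφ.comp hψ
  rw [h, h', hP.2.2.1] at hc
  exact hc.unique (phiProps_id hr)

theorem _root_.PhiProps.surjective (hr : ∀ i, G.r (es i) = w) (hP : IsCornerGLPair K G w P P')
    (hφ : PhiProps K G es P P' φ) (h : Q.map φ = P') (h' : Q'.map φ = P) :
    Function.Surjective φ := by
  have hQ : ∀ i j, φ (Q i j) = P' i j := fun i j => by rw [← h, Matrix.map_apply]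
  have hQ' : ∀ i j, φ (Q' i j) = P i j := fun i j => by rw [← h', Matrix.map_apply]
  intro x
  induction x using induction_generators with
  | halg a => exact ⟨algebraMap K _ a, φ.commutes a⟩
  | hvertex u => exact ⟨_, hφ.1 u⟩
  | hedge e =>
    by_cases he : e ∈ Set.range es
    · obtain ⟨i, rfl⟩ := he
      refine ⟨∑ k, edgeEl K G (es k) * Q k i, ?_⟩
      rw [← sum_edgeEl_mul_diagonal hr i, ← hP.2.2.1]
      simp only [map_sum, map_mul, hφ.2.2.2.1, hQ, Matrix.mul_apply, Finset.sum_mul,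
        Finset.mul_sum, mul_assoc]
      exact Finset.sum_comm
    · exact ⟨_, hφ.2.1 e he⟩
  | hghost e =>
    by_cases he : e ∈ Set.range es
    · obtain ⟨i, rfl⟩ := he
      refine ⟨∑ k, Q' i k * ghostEl K G (es k), ?_⟩
      rw [← sum_diagonal_mul_ghostEl hr i, ← hP.2.2.1]
      simp only [map_sum, map_mul, hφ.2.2.2.2, hQ', Matrix.mul_apply, Finset.sum_mul,
        Finset.mul_sum, mul_assoc]
      exact Finset.sum_comm
    · exact ⟨_, hφ.2.2.1 e he⟩
  | hmul x y hx hy =>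
    obtain ⟨a, rfl⟩ := hx
    obtain ⟨b, rfl⟩ := hy
    exact ⟨a * b, map_mul φ a b⟩
  | hadd x y hx hy =>
    obtain ⟨a, rfl⟩ := hx
    obtain ⟨b, rfl⟩ := hy
    exact ⟨a + b, map_add φ a b⟩

theorem _root_.PhiProps.map_inv_eq (hP : IsCornerGLPair K G w P P')
    (hφ : PhiProps K G es P P' φ) (hQ : IsCornerGLPair K G w Q Q') (h : Q.map φ = P') :
    Q'.map φ = P := by
  have hm := hQ.map (hφ.1 w)
  rw [h] at hm
  exact hP.symm.inv_unique hm

theorem _root_.PhiProps.bijective (hr : ∀ i, G.r (es i) = w) (hP : IsCornerGLPair K G w P P')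
    (hφ : PhiProps K G es P P' φ) (hQ : IsCornerGLPair K G w Q Q') (h : Q.map φ = P') :
    Function.Bijective φ := by
  have hsurj := hφ.surjective hr hP h (hφ.map_inv_eq hP hQ h)
  exact ⟨injective_of_surjective hsurj hφ.1, hsurj⟩

theorem _root_.PhiProps.exists_pair_of_bijective (hP : IsCornerGLPair K G w P P')
    (hφ : PhiProps K G es P P' φ) (hbij : Function.Bijective φ) :
    ∃ Q Q' : Matrix (Fin n) (Fin n) (LPA K G), IsCornerGLPair K G w Q Q' ∧ P' = Q.map φ := by
  let θ := AlgEquiv.ofBijective φ hbij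
  have hθ : ∀ x, φ (θ.symm x) = x := θ.apply_symm_apply
  have hw : (θ.symm : LPA K G →ₐ[K] LPA K G) (vertexEl K G w) = vertexEl K G w :=
    hbij.1 (by rw [hφ.1]; exact hθ _)
  refine ⟨_, _, hP.symm.map hw, ?_⟩
  ext i j
  exact (hθ _).symm

theorem _root_.PhiProps.pow {Pm Pm' : ℕ → Matrix (Fin n) (Fin n) (LPA K G)}
    (hP : IsCornerGLPair K G w P P') (hφ : PhiProps K G es P P' φ)
    (h1 : Pm 1 = P) (hsucc : ∀ m, 1 ≤ m → Pm (m + 1) = Pm m * P.map (φ^[m]))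
    (h1' : Pm' 1 = P') (hsucc' : ∀ m, 1 ≤ m → Pm' (m + 1) = P'.map (φ^[m]) * Pm' m)
    {m : ℕ} (hm : 1 ≤ m) :
    IsCornerGLPair K G w (Pm m) (Pm' m) ∧ PhiProps K G es (Pm m) (Pm' m) (φ ^ m) := by
  induction m, hm using Nat.le_induction with
  | base => rw [h1, h1', pow_one]; exact ⟨hP, hφ⟩
  | succ m hm ih =>
    rw [hsucc m hm, hsucc' m hm, ← AlgHom.coe_pow, pow_succ]
    exact ⟨ih.1.mul (hP.map (ih.2.1 w)), ih.2.comp hφ⟩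

end CornerMatrices

theorem mul_eq_one_of_injective {K A : Type*} [CommSemiring K] [Semiring A] [Algebra K A]
    {φ ψ : A →ₐ[K] A} (hφ : Function.Injective φ) (h : φ * ψ = 1) : ψ * φ = 1 := by
  refine AlgHom.ext fun x => hφ ?_
  exact DFunLike.congr_fun h (φ x)

end LeavittPathAlgebra

open LeavittPathAlgebra

/-- `φ_P` is an automorphism iff `P^{-1} = φ_P(Q)` for some
`Q ∈ GL_n(w L_K(E) w)`.  In this case `φ_{P_m}^{-1} = φ_{Q_m}`,
`P_m = φ_{P_m}(Q_m^{-1})` and `P_m^{-1} = φ_{P_m}(Q_m)` for all `m ≥ 1`.  In particular,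
if `φ_P(P) = P` or `φ_P(P^{-1}) = P^{-1}` then `φ_P` is an automorphism and
`φ_P^m = φ_{P^m}` for every integer `m` (negative powers being expressed by the fact that
the endomorphism attached to `(P')^m` is a two-sided inverse of `φ_P^m`). -/
theorem stmt3 (K : Type) [Field K] (G : DirGraph) (n : ℕ) (hn : 0 < n)
    (v w : G.V) (es : Fin n → G.E) (hes : Function.Injective es)
    (hs : ∀ i, G.s (es i) = v) (hr : ∀ i, G.r (es i) = w)
    (P P' : Matrix (Fin n) (Fin n) (LPA K G)) (hP : IsCornerGLPair K G w P P')
    (φP : LPA K G →ₐ[K] LPA K G) (hφP : PhiProps K G es P P' φP) :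
    (Function.Bijective ⇑φP ↔
      ∃ Q Q' : Matrix (Fin n) (Fin n) (LPA K G),
        IsCornerGLPair K G w Q Q' ∧ P' = Q.map ⇑φP) ∧
    (∀ Q Q' : Matrix (Fin n) (Fin n) (LPA K G),
      IsCornerGLPair K G w Q Q' → P' = Q.map ⇑φP →
      ∀ φQ : LPA K G →ₐ[K] LPA K G, PhiProps K G es Q Q' φQ →
      ∀ Pm Pm' Qm Qm' : ℕ → Matrix (Fin n) (Fin n) (LPA K G),
        Pm 1 = P → (∀ m, 1 ≤ m → Pm (m + 1) = Pm m * P.map ((⇑φP)^[m])) →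
        Pm' 1 = P' → (∀ m, 1 ≤ m → Pm' (m + 1) = P'.map ((⇑φP)^[m]) * Pm' m) →
        Qm 1 = Q → (∀ m, 1 ≤ m → Qm (m + 1) = Qm m * Q.map ((⇑φQ)^[m])) →
        Qm' 1 = Q' → (∀ m, 1 ≤ m → Qm' (m + 1) = Q'.map ((⇑φQ)^[m]) * Qm' m) →
        ∀ m, 1 ≤ m →
        ∀ ψP ψQ : LPA K G →ₐ[K] LPA K G,
          PhiProps K G es (Pm m) (Pm' m) ψP → PhiProps K G es (Qm m) (Qm' m) ψQ →
          (∀ x, ψP (ψQ x) = x ∧ ψQ (ψP x) = x) ∧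
          Pm m = (Qm' m).map ⇑ψP ∧ Pm' m = (Qm m).map ⇑ψP) ∧
    ((P.map ⇑φP = P ∨ P'.map ⇑φP = P') →
      Function.Bijective ⇑φP ∧
      (∀ m : ℕ, 1 ≤ m → PhiProps K G es (P ^ m) (P' ^ m) (φP ^ m)) ∧
      (∀ m : ℕ, 1 ≤ m → ∀ ψ : LPA K G →ₐ[K] LPA K G,
        PhiProps K G es (P' ^ m) (P ^ m) ψ →
          ∀ x, ψ ((⇑φP)^[m] x) = x ∧ (⇑φP)^[m] (ψ x) = x)) := by
  have hinv : ∀ {Q Q' : Matrix (Fin n) (Fin n) (LPA K G)} {φQ : LPA K G →ₐ[K] LPA K G},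
      IsCornerGLPair K G w Q Q' → Q.map φP = P' → PhiProps K G es Q Q' φQ →
      φP * φQ = 1 ∧ φQ * φP = 1 := fun hQ h hφQ =>
    have h1 := hφP.comp_eq_id hr hP hφQ h (hφP.map_inv_eq hP hQ h)
    ⟨h1, mul_eq_one_of_injective (hφP.bijective hr hP hQ h).1 h1⟩
  refine ⟨⟨hφP.exists_pair_of_bijective hP, fun ⟨Q, Q', hQ, h⟩ => hφP.bijective hr hP hQ h.symm⟩,
    ?_, ?_⟩
  · intro Q Q' hQ hPQ φQ hφQ Pm Pm' Qm Qm' hP1 hPs hP1' hPs' hQ1 hQs hQ1' hQs' m hm ψP ψQ hψP hψQ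
    obtain ⟨hPm, hφPm⟩ := hφP.pow hP hP1 hPs hP1' hPs' hm
    obtain ⟨hQm, hφQm⟩ := hφQ.pow hQ hQ1 hQs hQ1' hQs' hm
    obtain rfl := hψP.unique hφPm
    obtain rfl := hψQ.unique hφQm
    obtain ⟨h, h'⟩ := hinv hQ hPQ.symm hφQ
    have hcomm : Commute φP φQ := h.trans h'.symm
    have hPQm : φP ^ m * φQ ^ m = 1 := by rw [← hcomm.mul_pow, h, one_pow]
    have hQPm : φQ ^ m * φP ^ m = 1 := by rw [← hcomm.symm.mul_pow, h', one_pow]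
    have hid := hψP.comp hψQ
    rw [show (φP ^ m).comp (φQ ^ m) = AlgHom.id K (LPA K G) from hPQm] at hid
    have hmap := hQm.map (hψP.1 w)
    obtain ⟨hleft, hright⟩ := PhiProps.matrix_unique hes hr (inCorner_mul hPm.1 hmap.1)
      (inCorner_mul hmap.2.1 hPm.2.1) inCorner_diagonal inCorner_diagonal hid (phiProps_id hr)
    exact ⟨fun x => ⟨DFunLike.congr_fun hPQm x, DFunLike.congr_fun hQPm x⟩,
      (hPm.symm.eq_of_mul_eq' hmap.2.1 hright).symm, (hPm.eq_of_mul_eq hmap.1 hleft).symm⟩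
  · intro hfix
    have hfixP' : P'.map φP = P' := by
      rcases hfix with h | h
      · have hm := hP.map (hφP.1 w)
        rw [h] at hm
        exact hP.inv_unique hm
      · exact h
    have hfixP : P.map φP = P := hφP.map_inv_eq hP hP.symm hfixP'
    have hiter : ∀ {M : Matrix (Fin n) (Fin n) (LPA K G)}, M.map φP = M →
        ∀ m, M.map (φP^[m]) = M := by
      intro M hM m
      induction m with
      | zero => exact M.map_id
      | succ m ih => rw [Function.iterate_succ, ← Matrix.map_map, hM, ih]
    have hpow : ∀ m : ℕ, 1 ≤ m → IsCornerGLPair K G w (P ^ m) (P' ^ m) ∧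
        PhiProps K G es (P ^ m) (P' ^ m) (φP ^ m) := fun m hm =>
      hφP.pow (Pm := fun m => P ^ m) (Pm' := fun m => P' ^ m) hP (pow_one P)
        (fun m _ => by rw [hiter hfixP, pow_succ]) (pow_one P')
        (fun m _ => by rw [hiter hfixP', pow_succ']) hm
    refine ⟨hφP.bijective hr hP hP.symm hfixP', fun m hm => (hpow m hm).2, ?_⟩
    intro m hm ψ hψ x
    obtain ⟨hPm, hφPm⟩ := hpow m hm
    have hmapPow : (P' ^ m).map (φP ^ m) = P' ^ m := by
      have h : (φP ^ m).mapMatrix P' = P' := by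
        rw [AlgHom.mapMatrix_apply, AlgHom.coe_pow, hiter hfixP']
      rw [← AlgHom.mapMatrix_apply, map_pow, h]
    have h := hφPm.comp_eq_id hr hPm hψ hmapPow (hφPm.map_inv_eq hPm hPm.symm hmapPow)
    have h' := mul_eq_one_of_injective (hφPm.bijective hr hPm hPm.symm hmapPow).1 h
    rw [← AlgHom.coe_pow]
    exact ⟨DFunLike.congr_fun h' x, DFunLike.congr_fun h x⟩
end

section
/- Let K be a field, E a graph, v, w ∈ E^0, and e_1, …, e_n distinct edges with s(e_i) = v, r(e_i) = w, and assume |s^{-1}(v)| = n. Let End^{gr}_{v,w}(L_K(E)) denote the monoid (under composition) of all graded K-algebra endomorphisms λ of L_K(E) with λ(u) = u, λ(e) = e and λ(e*) = e* for all u ∈ E^0 and all e ∈ E^1 \ {e_1, …, e_n}. Then the map Φ : (GL_n(wL_K(E)_0 w), ⋆) → End^{gr}_{v,w}(L_K(E)), P ↦ φ_P, is a monoid isomorphism, where P ⋆ Q := P φ_P(Q). -/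
namespace LPA

variable {K : Type} [Field K] {G : DirGraph}

theorem vertex_mul_self (u : G.V) : vertexEl K G u * vertexEl K G u = vertexEl K G u := by
  simpa [vertexEl] using RingQuot.mkAlgHom_rel K (LRel.vertexIdem (K := K) u)

theorem vertex_mul_vertex_of_ne {u u' : G.V} (h : u ≠ u') :
    vertexEl K G u * vertexEl K G u' = 0 := by
  simpa [vertexEl] using RingQuot.mkAlgHom_rel K (LRel.vertexOrth (K := K) u u' h)

theorem source_mul_edge (e : G.E) : vertexEl K G (G.s e) * edgeEl K G e = edgeEl K G e := by
  simpa [vertexEl, edgeEl] using RingQuot.mkAlgHom_rel K (LRel.sourceEdge (K := K) e)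

theorem edge_mul_range (e : G.E) : edgeEl K G e * vertexEl K G (G.r e) = edgeEl K G e := by
  simpa [vertexEl, edgeEl] using RingQuot.mkAlgHom_rel K (LRel.edgeRange (K := K) e)

theorem ghost_mul_source (e : G.E) : ghostEl K G e * vertexEl K G (G.s e) = ghostEl K G e := by
  simpa [vertexEl, ghostEl] using RingQuot.mkAlgHom_rel K (LRel.ghostSource (K := K) e)

theorem range_mul_ghost (e : G.E) : vertexEl K G (G.r e) * ghostEl K G e = ghostEl K G e := by
  simpa [vertexEl, ghostEl] using RingQuot.mkAlgHom_rel K (LRel.rangeGhost (K := K) e)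

theorem ghost_mul_edge_self (e : G.E) :
    ghostEl K G e * edgeEl K G e = vertexEl K G (G.r e) := by
  simpa [vertexEl, ghostEl, edgeEl] using RingQuot.mkAlgHom_rel K (LRel.ghostEdgeSame (K := K) e)

theorem ghost_mul_edge_of_ne {e f : G.E} (h : e ≠ f) : ghostEl K G e * edgeEl K G f = 0 := by
  simpa [ghostEl, edgeEl] using RingQuot.mkAlgHom_rel K (LRel.ghostEdgeNe (K := K) e f h)

theorem vertex_mul_edge_of_ne {u : G.V} {e : G.E} (h : u ≠ G.s e) :
    vertexEl K G u * edgeEl K G e = 0 := by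
  rw [← source_mul_edge, ← mul_assoc, vertex_mul_vertex_of_ne h, zero_mul]

theorem edge_mul_vertex_of_ne {u : G.V} {e : G.E} (h : G.r e ≠ u) :
    edgeEl K G e * vertexEl K G u = 0 := by
  rw [← edge_mul_range, mul_assoc, vertex_mul_vertex_of_ne h, mul_zero]

theorem ghost_mul_vertex_of_ne {u : G.V} {e : G.E} (h : G.s e ≠ u) :
    ghostEl K G e * vertexEl K G u = 0 := by
  rw [← ghost_mul_source, mul_assoc, vertex_mul_vertex_of_ne h, mul_zero]

theorem ghost_mul_ghost_of_ne {e f : G.E} (h : G.s e ≠ G.r f) :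
    ghostEl K G e * ghostEl K G f = 0 := by
  rw [← range_mul_ghost f, ← mul_assoc, ghost_mul_vertex_of_ne h, zero_mul]

theorem edgeProd_append_singleton (p : List G.E) (e : G.E) :
    edgeProd K G (p ++ [e]) = edgeProd K G p * edgeEl K G e := by
  simp [edgeProd]

theorem ghostProd_cons (e : G.E) (q : List G.E) :
    ghostProd K G (e :: q) = ghostProd K G q * ghostEl K G e := by
  simp [ghostProd]

@[simp]
theorem edgeProd_nil : edgeProd K G [] = 1 := rfl

@[simp]
theorem ghostProd_nil : ghostProd K G [] = 1 := rfl

theorem isPath_iff_isChain {l : List G.E} :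
    IsPath G l ↔ l.IsChain fun e f => G.r e = G.s f := Iff.rfl

theorem isPath_nil : IsPath G [] := List.IsChain.nil

theorem isPath_singleton (e : G.E) : IsPath G [e] := List.IsChain.singleton e

theorem monomial_mem_component {p q : List G.E} (u : G.V) {d : ℤ} (hp : IsPath G p)
    (hq : IsPath G q) (hd : (p.length : ℤ) - (q.length : ℤ) = d) :
    edgeProd K G p * vertexEl K G u * ghostProd K G q ∈ lpaComponent K G d :=
  Submodule.subset_span ⟨p, q, u, hp, hq, hd, rfl⟩

/-- To check that right multiplication by `y` maps one component into another, it suffices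
to check it on monomials. -/
theorem mul_right_mem_of_monomial {d d' : ℤ} {y : LPA K G}
    (H : ∀ p q : List G.E, ∀ u : G.V, IsPath G p → IsPath G q →
      (p.length : ℤ) - (q.length : ℤ) = d →
      edgeProd K G p * vertexEl K G u * ghostProd K G q * y ∈ lpaComponent K G d')
    {x : LPA K G} (hx : x ∈ lpaComponent K G d) : x * y ∈ lpaComponent K G d' := by
  induction hx using Submodule.span_induction with
  | mem x hx =>
    obtain ⟨p, q, u, hp, hq, hd, rfl⟩ := hx
    exact H p q u hp hq hd
  | zero => simp
  | add a b _ _ ha hb => rw [add_mul]; exact add_mem ha hb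
  | smul c a _ ha => rw [smul_mul_assoc]; exact Submodule.smul_mem _ c ha

theorem mul_vertex_mem {d : ℤ} {x : LPA K G} (hx : x ∈ lpaComponent K G d) (u' : G.V) :
    x * vertexEl K G u' ∈ lpaComponent K G d := by
  refine mul_right_mem_of_monomial (fun p q u hp hq hd => ?_) hx
  cases q with
  | nil =>
    by_cases h : u = u'
    · subst h
      rw [ghostProd_nil, mul_one, mul_assoc, vertex_mul_self]
      simpa using monomial_mem_component u hp hq hd
    · simp [mul_assoc, vertex_mul_vertex_of_ne h]
  | cons f q =>
    by_cases h : G.s f = u'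
    · subst h
      rw [ghostProd_cons, mul_assoc, mul_assoc (ghostProd K G q), ghost_mul_source,
        ← ghostProd_cons]
      exact monomial_mem_component u hp hq hd
    · simp [ghostProd_cons, mul_assoc, ghost_mul_vertex_of_ne h]

theorem isPath_append_singleton {p : List G.E} {e : G.E} (hp : IsPath G p)
    (h : edgeProd K G p * vertexEl K G (G.s e) ≠ 0) : IsPath G (p ++ [e]) := by
  rcases List.eq_nil_or_concat p with rfl | ⟨p', f, rfl⟩
  · exact isPath_singleton e
  · have hf : G.r f = G.s e := by
      by_contra hne
      apply h
      rw [List.concat_eq_append, edgeProd_append_singleton, mul_assoc, edge_mul_vertex_of_ne hne,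
        mul_zero]
    simp only [isPath_iff_isChain, List.concat_eq_append] at hp ⊢
    rw [List.isChain_append]
    refine ⟨hp, by simp, ?_⟩
    simp [hf]

theorem mul_edge_mem {d : ℤ} {x : LPA K G} (hx : x ∈ lpaComponent K G d) (e : G.E) :
    x * edgeEl K G e ∈ lpaComponent K G (d + 1) := by
  refine mul_right_mem_of_monomial (fun p q u hp hq hd => ?_) hx
  cases q with
  | nil =>
    by_cases h : u = G.s e
    · subst h
      rw [ghostProd_nil, mul_one]
      by_cases h0 : edgeProd K G p * vertexEl K G (G.s e) = 0
      · simp [h0]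
      · rw [mul_assoc, source_mul_edge, ← edge_mul_range, ← mul_assoc,
          ← edgeProd_append_singleton]
        have := monomial_mem_component (K := K) (q := []) (d := d + 1) (G.r e)
          (isPath_append_singleton hp h0) hq (by simp at hd ⊢; omega)
        simpa using this
    · simp [mul_assoc, vertex_mul_edge_of_ne h]
  | cons f q =>
    have hq' : IsPath G q := List.IsChain.tail hq
    have hd' : (p.length : ℤ) - (q.length : ℤ) = d + 1 := by
      simp only [List.length_cons] at hd
      push_cast at hd
      omega
    by_cases h : f = e
    · subst h
      rw [ghostProd_cons, mul_assoc, mul_assoc (ghostProd K G q), ghost_mul_edge_self, ← mul_assoc]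
      exact mul_vertex_mem (monomial_mem_component u hp hq' hd') _
    · simp [ghostProd_cons, mul_assoc, ghost_mul_edge_of_ne h]

theorem mul_ghost_mem {d : ℤ} {x : LPA K G} (hx : x ∈ lpaComponent K G d) (e : G.E) :
    x * ghostEl K G e ∈ lpaComponent K G (d - 1) := by
  refine mul_right_mem_of_monomial (fun p q u hp hq hd => ?_) hx
  rw [mul_assoc, ← ghostProd_cons]
  have hd' : (p.length : ℤ) - ((e :: q).length : ℤ) = d - 1 := by
    simp only [List.length_cons]
    push_cast
    omega
  cases q with
  | nil => exact monomial_mem_component u hp (isPath_singleton e) hd'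
  | cons f q =>
    by_cases h : G.s f = G.r e
    · exact monomial_mem_component u hp (List.isChain_cons_cons.2 ⟨h.symm, hq⟩) hd'
    · rw [ghostProd_cons, ghostProd_cons, mul_assoc (ghostProd K G q), ghost_mul_ghost_of_ne h]
      simp

theorem mul_edgeProd_mem (p : List G.E) {d : ℤ} {x : LPA K G} (hx : x ∈ lpaComponent K G d) :
    x * edgeProd K G p ∈ lpaComponent K G (d + p.length) := by
  induction p using List.reverseRecOn with
  | nil => simpa using hx
  | append_singleton p e ih =>
    rw [edgeProd_append_singleton, ← mul_assoc]
    have := mul_edge_mem ih e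
    simpa [add_assoc] using this

theorem mul_ghostProd_mem (q : List G.E) {d : ℤ} {x : LPA K G} (hx : x ∈ lpaComponent K G d) :
    x * ghostProd K G q ∈ lpaComponent K G (d - q.length) := by
  induction q with
  | nil => simpa using hx
  | cons e q ih =>
    rw [ghostProd_cons, ← mul_assoc]
    have := mul_ghost_mem ih e
    simpa [sub_sub] using this

/-- The components form a graded family: degrees add under multiplication. -/
theorem mul_mem_component {a b : ℤ} {x y : LPA K G} (hx : x ∈ lpaComponent K G a)
    (hy : y ∈ lpaComponent K G b) : x * y ∈ lpaComponent K G (a + b) := by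
  induction hy using Submodule.span_induction with
  | mem y hy =>
    obtain ⟨p, q, u, -, -, hd, rfl⟩ := hy
    have := mul_ghostProd_mem q (mul_vertex_mem (mul_edgeProd_mem p hx) u)
    rw [← hd]
    simpa [mul_assoc, add_sub_assoc] using this
  | zero => simp
  | add s t _ _ hs ht => rw [mul_add]; exact add_mem hs ht
  | smul c s _ hs => rw [mul_smul_comm]; exact Submodule.smul_mem _ c hs

theorem edge_mem_component (e : G.E) : edgeEl K G e ∈ lpaComponent K G 1 := by
  have := monomial_mem_component (K := K) (p := [e]) (q := []) (d := 1) (G.r e)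
    (isPath_singleton e) isPath_nil (by simp)
  simpa [edgeProd, edge_mul_range] using this

theorem ghost_mem_component (e : G.E) : ghostEl K G e ∈ lpaComponent K G (-1) := by
  have := monomial_mem_component (K := K) (p := []) (q := [e]) (d := -1) (G.r e)
    isPath_nil (isPath_singleton e) (by simp)
  simpa [ghostProd, range_mul_ghost] using this

theorem inCorner_iff {w : G.V} {x : LPA K G} :
    InCorner K G w x ↔ vertexEl K G w * x = x ∧ x * vertexEl K G w = x := by
  constructor
  · intro h
    rw [InCorner] at h
    constructor
    · rw [← h]; simp only [← mul_assoc, vertex_mul_self]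
    · rw [← h]; simp only [mul_assoc, vertex_mul_self]
  · rintro ⟨h₁, h₂⟩
    rw [InCorner, h₁, h₂]

theorem inCorner_mul_entry {n : ℕ} {w : G.V} {A B : Matrix (Fin n) (Fin n) (LPA K G)}
    (hA : ∀ i j, InCorner K G w (A i j)) (hB : ∀ i j, InCorner K G w (B i j)) (i j : Fin n) :
    InCorner K G w ((A * B) i j) := by
  simp only [inCorner_iff] at hA hB ⊢
  constructor
  · simp only [Matrix.mul_apply, Finset.mul_sum, ← mul_assoc, (hA _ _).1]
  · simp only [Matrix.mul_apply, Finset.sum_mul, mul_assoc, (hB _ _).2]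

theorem mul_diagonal_vertex {n : ℕ} {w : G.V} {A : Matrix (Fin n) (Fin n) (LPA K G)}
    (hA : ∀ i j, InCorner K G w (A i j)) :
    A * Matrix.diagonal (fun _ => vertexEl K G w) = A := by
  ext i j
  rw [Matrix.mul_diagonal, (inCorner_iff.1 (hA i j)).2]

theorem inCorner_map {w : G.V} {φ : LPA K G →ₐ[K] LPA K G}
    (hφ : φ (vertexEl K G w) = vertexEl K G w) {x : LPA K G} (hx : InCorner K G w x) :
    InCorner K G w (φ x) := by
  have := congrArg φ hx
  rwa [map_mul, map_mul, hφ] at this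

theorem map_mul_map_eq_diagonal {n : ℕ} {w : G.V} {φ : LPA K G →ₐ[K] LPA K G}
    (hφ : φ (vertexEl K G w) = vertexEl K G w) {A B : Matrix (Fin n) (Fin n) (LPA K G)}
    (h : A * B = Matrix.diagonal (fun _ => vertexEl K G w)) :
    A.map φ * B.map φ = Matrix.diagonal (fun _ => vertexEl K G w) := by
  rw [← Matrix.map_mul, h, Matrix.diagonal_map (map_zero φ), hφ]

theorem mul_entry_mem_component_zero {n : ℕ} {A B : Matrix (Fin n) (Fin n) (LPA K G)}
    (hA : ∀ i j, A i j ∈ lpaComponent K G 0) (hB : ∀ i j, B i j ∈ lpaComponent K G 0)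
    (i j : Fin n) : (A * B) i j ∈ lpaComponent K G 0 := by
  rw [Matrix.mul_apply]
  exact Submodule.sum_mem _ fun k _ => by simpa using mul_mem_component (hA i k) (hB k j)

/-- The products `P φ(Q)` and `φ(Q') P'` are mutually inverse over the corner. -/
theorem isCornerGLPair_star {n : ℕ} {w : G.V} {P P' Q Q' : Matrix (Fin n) (Fin n) (LPA K G)}
    (hP : IsCornerGLPair K G w P P') (hQ : IsCornerGLPair K G w Q Q')
    {φ : LPA K G →ₐ[K] LPA K G} (hφ : φ (vertexEl K G w) = vertexEl K G w) :
    IsCornerGLPair K G w (P * Q.map φ) (Q'.map φ * P') := by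
  obtain ⟨hPc, hPc', hPP', hP'P⟩ := hP
  obtain ⟨hQc, hQc', hQQ', hQ'Q⟩ := hQ
  have hφQ' : ∀ i j, InCorner K G w (Q'.map φ i j) := fun i j => inCorner_map hφ (hQc' i j)
  refine ⟨inCorner_mul_entry hPc fun i j => inCorner_map hφ (hQc i j),
    inCorner_mul_entry hφQ' hPc', ?_, ?_⟩
  · rw [← Matrix.mul_assoc, Matrix.mul_assoc P, map_mul_map_eq_diagonal hφ hQQ',
      mul_diagonal_vertex hPc, hPP']
  · rw [← Matrix.mul_assoc, Matrix.mul_assoc (Q'.map φ), hP'P, mul_diagonal_vertex hφQ',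
      map_mul_map_eq_diagonal hφ hQ'Q]

theorem phiProps_comp {n : ℕ} {es : Fin n → G.E} {P P' Q Q' : Matrix (Fin n) (Fin n) (LPA K G)}
    {φ ψ : LPA K G →ₐ[K] LPA K G} (hφ : PhiProps K G es P P' φ) (hψ : PhiProps K G es Q Q' ψ) :
    PhiProps K G es (P * Q.map φ) (Q'.map φ * P') (φ.comp ψ) := by
  obtain ⟨hφv, hφe, hφg, hφE, hφG⟩ := hφ
  obtain ⟨hψv, hψe, hψg, hψE, hψG⟩ := hψ
  refine ⟨fun u => by simp [hψv, hφv], fun e he => by simp [hψe e he, hφe e he],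
    fun e he => by simp [hψg e he, hφg e he], fun i => ?_, fun i => ?_⟩
  · simp only [AlgHom.comp_apply, hψE, map_sum, map_mul, hφE, Matrix.mul_apply, Matrix.map_apply,
      Finset.sum_mul, Finset.mul_sum, mul_assoc]
    exact Finset.sum_comm
  · simp only [AlgHom.comp_apply, hψG, map_sum, map_mul, hφG, Matrix.mul_apply, Matrix.map_apply,
      Finset.sum_mul, Finset.mul_sum, mul_assoc]
    exact Finset.sum_comm

section Parallel

variable {n : ℕ} {v w : G.V} {es : Fin n → G.E}

theorem ghost_mul_edge_eq_diagonal (hes : Function.Injective es) (hr : ∀ i, G.r (es i) = w)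
    (i j : Fin n) : ghostEl K G (es i) * edgeEl K G (es j) =
      Matrix.diagonal (fun _ => vertexEl K G w) i j := by
  by_cases h : i = j
  · subst h
    rw [Matrix.diagonal_apply_eq, ghost_mul_edge_self, hr]
  · rw [Matrix.diagonal_apply_ne _ h, ghost_mul_edge_of_ne (hes.ne h)]

theorem sum_edge_mul_ghost (hn : 0 < n) (hes : Function.Injective es)
    (hs : ∀ i, G.s (es i) = v) (hfull : ∀ e : G.E, G.s e = v → e ∈ Set.range es) :
    ∑ k, edgeEl K G (es k) * ghostEl K G (es k) = vertexEl K G v := by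
  classical
  have hset : {e : G.E | G.s e = v} = Set.range es := by
    ext e
    exact ⟨hfull e, by rintro ⟨i, rfl⟩; exact hs i⟩
  have hfin : {e : G.E | G.s e = v}.Finite := hset ▸ Set.finite_range es
  have hrel := RingQuot.mkAlgHom_rel K (LRel.ck2 (K := K) v hfin ⟨es ⟨0, hn⟩, hs _⟩)
  have himage : hfin.toFinset = Finset.univ.image es := by
    ext e
    simpa using Set.ext_iff.1 hset e
  rw [himage, Finset.sum_image hes.injOn] at hrel
  simpa [vertexEl, edgeEl, ghostEl] using hrel.symm

theorem ghost_mul_phi_edge (hes : Function.Injective es) (hr : ∀ i, G.r (es i) = w)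
    {P P' : Matrix (Fin n) (Fin n) (LPA K G)} (hP : ∀ i j, InCorner K G w (P i j))
    {φ : LPA K G →ₐ[K] LPA K G} (hφ : PhiProps K G es P P' φ) (i j : Fin n) :
    ghostEl K G (es i) * φ (edgeEl K G (es j)) = P i j := by
  rw [hφ.2.2.2.1, Finset.mul_sum]
  simp only [← mul_assoc, ghost_mul_edge_eq_diagonal hes hr]
  rw [← Matrix.mul_apply, Matrix.diagonal_mul, (inCorner_iff.1 (hP i j)).1]

/-- An endomorphism fixing the vertices is determined on the parallel edges `es` by the
invertible matrix `(eᵢ* λ(eⱼ))`, whose inverse is `(λ(eᵢ*) eⱼ)`. -/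
theorem isCornerGLPair_of_fixes_vertices (hn : 0 < n) (hes : Function.Injective es)
    (hs : ∀ i, G.s (es i) = v) (hr : ∀ i, G.r (es i) = w)
    (hfull : ∀ e : G.E, G.s e = v → e ∈ Set.range es) {lam : LPA K G →ₐ[K] LPA K G}
    (hv : ∀ u : G.V, lam (vertexEl K G u) = vertexEl K G u) :
    IsCornerGLPair K G w
      (Matrix.of fun i j => ghostEl K G (es i) * lam (edgeEl K G (es j)))
      (Matrix.of fun i j => lam (ghostEl K G (es i)) * edgeEl K G (es j)) := by
  have hck := sum_edge_mul_ghost (K := K) hn hes hs hfull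
  have hew : ∀ i, edgeEl K G (es i) * vertexEl K G w = edgeEl K G (es i) := fun i => by
    rw [← hr i, edge_mul_range]
  have hwg : ∀ i, vertexEl K G w * ghostEl K G (es i) = ghostEl K G (es i) := fun i => by
    rw [← hr i, range_mul_ghost]
  have hve : ∀ i, vertexEl K G v * edgeEl K G (es i) = edgeEl K G (es i) := fun i => by
    rw [← hs i, source_mul_edge]
  refine ⟨fun i j => inCorner_iff.2 ⟨?_, ?_⟩, fun i j => inCorner_iff.2 ⟨?_, ?_⟩, ?_, ?_⟩
  · rw [Matrix.of_apply, ← mul_assoc, hwg]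
  · rw [Matrix.of_apply, mul_assoc]
    nth_rw 1 [← hv w]
    rw [← map_mul, hew]
  · rw [Matrix.of_apply, ← mul_assoc]
    nth_rw 1 [← hv w]
    rw [← map_mul, hwg]
  · rw [Matrix.of_apply, mul_assoc, hew]
  · ext i j
    rw [← ghost_mul_edge_eq_diagonal hes hr, ← hve j, ← hv v, ← hck, map_sum, Finset.sum_mul,
      Finset.mul_sum, Matrix.mul_apply]
    simp only [Matrix.of_apply, map_mul, mul_assoc]
  · ext i j
    have hdiag : Matrix.diagonal (fun _ => vertexEl K G w) i j =
        lam (Matrix.diagonal (fun _ => vertexEl K G w) i j) := by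
      rw [Matrix.diagonal_apply]
      split_ifs
      · rw [hv]
      · rw [map_zero]
    rw [hdiag, ← ghost_mul_edge_eq_diagonal hes hr, ← hve j, map_mul, map_mul, hv, ← hck,
      Finset.sum_mul, Finset.mul_sum, Matrix.mul_apply]
    simp only [Matrix.of_apply, mul_assoc]

theorem phiProps_of_fixes (hn : 0 < n) (hes : Function.Injective es)
    (hs : ∀ i, G.s (es i) = v) (hfull : ∀ e : G.E, G.s e = v → e ∈ Set.range es)
    {lam : LPA K G →ₐ[K] LPA K G} (hv : ∀ u : G.V, lam (vertexEl K G u) = vertexEl K G u)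
    (he : ∀ e : G.E, e ∉ Set.range es → lam (edgeEl K G e) = edgeEl K G e)
    (hg : ∀ e : G.E, e ∉ Set.range es → lam (ghostEl K G e) = ghostEl K G e) :
    PhiProps K G es
      (Matrix.of fun i j => ghostEl K G (es i) * lam (edgeEl K G (es j)))
      (Matrix.of fun i j => lam (ghostEl K G (es i)) * edgeEl K G (es j)) lam := by
  have hck := sum_edge_mul_ghost (K := K) hn hes hs hfull
  refine ⟨hv, he, hg, fun i => ?_, fun i => ?_⟩
  · simp only [Matrix.of_apply, ← mul_assoc]
    rw [← Finset.sum_mul, hck, ← hv v, ← map_mul, ← hs i, source_mul_edge]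
  · simp only [Matrix.of_apply, mul_assoc]
    rw [← Finset.mul_sum, hck, ← hv v, ← map_mul, ← hs i, ghost_mul_source]

end Parallel

end LPA

/-- Assume `|s^{-1}(v)| = n`.  Then `P ↦ φ_P` is a monoid isomorphism
from `(GL_n(w L_K(E)_0 w), ⋆)`, `P ⋆ Q = P φ_P(Q)`, onto the monoid
`End^{gr}_{v,w}(L_K(E))` of graded endomorphisms fixing all vertices and all edges and
ghost edges other than `e_1, …, e_n`. -/
theorem stmt6 (K : Type) [Field K] (G : DirGraph) (n : ℕ) (hn : 0 < n)
    (v w : G.V) (es : Fin n → G.E) (hes : Function.Injective es)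
    (hs : ∀ i, G.s (es i) = v) (hr : ∀ i, G.r (es i) = w)
    (hfull : ∀ e : G.E, G.s e = v → e ∈ Set.range es) :
    (∀ lam : LPA K G →ₐ[K] LPA K G,
      (∀ d : ℤ, ∀ x ∈ lpaComponent K G d, lam x ∈ lpaComponent K G d) →
      (∀ u : G.V, lam (vertexEl K G u) = vertexEl K G u) →
      (∀ e : G.E, e ∉ Set.range es → lam (edgeEl K G e) = edgeEl K G e) →
      (∀ e : G.E, e ∉ Set.range es → lam (ghostEl K G e) = ghostEl K G e) →
      ∃ P' : Matrix (Fin n) (Fin n) (LPA K G),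
        IsCornerGLPair K G w
          (Matrix.of fun i j => ghostEl K G (es i) * lam (edgeEl K G (es j))) P' ∧
        (∀ i j, (Matrix.of fun i j => ghostEl K G (es i) * lam (edgeEl K G (es j))) i j
            ∈ lpaComponent K G 0 ∧ P' i j ∈ lpaComponent K G 0) ∧
        PhiProps K G es
          (Matrix.of fun i j => ghostEl K G (es i) * lam (edgeEl K G (es j))) P' lam) ∧
    (∀ P P' Q Q' : Matrix (Fin n) (Fin n) (LPA K G),
      IsCornerGLPair K G w P P' → IsCornerGLPair K G w Q Q' →
      ∀ φ ψ : LPA K G →ₐ[K] LPA K G,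
        PhiProps K G es P P' φ → PhiProps K G es Q Q' ψ → φ = ψ → P = Q) ∧
    (∀ P P' Q Q' : Matrix (Fin n) (Fin n) (LPA K G),
      IsCornerGLPair K G w P P' → IsCornerGLPair K G w Q Q' →
      (∀ i j, P i j ∈ lpaComponent K G 0 ∧ P' i j ∈ lpaComponent K G 0) →
      (∀ i j, Q i j ∈ lpaComponent K G 0 ∧ Q' i j ∈ lpaComponent K G 0) →
      ∀ φ ψ : LPA K G →ₐ[K] LPA K G,
        PhiProps K G es P P' φ → PhiProps K G es Q Q' ψ →
        (∀ d : ℤ, ∀ x ∈ lpaComponent K G d, φ x ∈ lpaComponent K G d) →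
        (∀ d : ℤ, ∀ x ∈ lpaComponent K G d, ψ x ∈ lpaComponent K G d) →
        IsCornerGLPair K G w (P * Q.map ⇑φ) (Q'.map ⇑φ * P') ∧
        (∀ i j, (P * Q.map ⇑φ) i j ∈ lpaComponent K G 0 ∧
          (Q'.map ⇑φ * P') i j ∈ lpaComponent K G 0) ∧
        PhiProps K G es (P * Q.map ⇑φ) (Q'.map ⇑φ * P') (φ.comp ψ) ∧
        (∀ d : ℤ, ∀ x ∈ lpaComponent K G d, (φ.comp ψ) x ∈ lpaComponent K G d)) := by
  refine ⟨fun lam hgr hv he hg => ⟨_, LPA.isCornerGLPair_of_fixes_vertices hn hes hs hr hfull hv,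
    fun i j => ⟨?_, ?_⟩, LPA.phiProps_of_fixes hn hes hs hfull hv he hg⟩, ?_, ?_⟩
  · simpa using LPA.mul_mem_component (LPA.ghost_mem_component (es i))
      (hgr 1 _ (LPA.edge_mem_component (es j)))
  · simpa using LPA.mul_mem_component (hgr (-1) _ (LPA.ghost_mem_component (es i)))
      (LPA.edge_mem_component (es j))
  · rintro P P' Q Q' hP hQ φ _ hφ hψ rfl
    ext i j
    rw [← LPA.ghost_mul_phi_edge hes hr hP.1 hφ, LPA.ghost_mul_phi_edge hes hr hQ.1 hψ]
  · intro P P' Q Q' hP hQ hP₀ hQ₀ φ ψ hφ hψ hφgr hψgr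
    refine ⟨LPA.isCornerGLPair_star hP hQ (hφ.1 w), fun i j => ⟨?_, ?_⟩,
      LPA.phiProps_comp hφ hψ, fun d x hx => hφgr d _ (hψgr d x hx)⟩
    · exact LPA.mul_entry_mem_component_zero (fun i j => (hP₀ i j).1)
        (fun i j => hφgr 0 _ (hQ₀ i j).1) i j
    · exact LPA.mul_entry_mem_component_zero (fun i j => hφgr 0 _ (hQ₀ i j).2)
        (fun i j => (hP₀ i j).2) i j
end

section
/- Let K be a field, E a graph, v, w ∈ E^0, and e_1, …, e_n distinct edges with s(e_i) = v, r(e_i) = w. Let P = (p_{ij}) and Q = (q_{ij}) be elements of GL_n(wL_K(E)_0 w) with P φ_P(Q) = I_n (so φ_P is a graded automorphism with inverse φ_Q), and write Q^{-1} = (q^{(-1)}_{ij}). Then there exists a graded injective K-algebra homomorphism θ_P : L_K(E) → L_K(E)^{φ_P} into the Zhang twist satisfying θ_P(u) = u for all u ∈ E^0, θ_P(e) = e for all e ∈ E^1, θ_P(f*) = f* for all f ∈ E^1 \ {e_1, …, e_n}, and θ_P(e_i*) = Σ_{k=1}^n q^{(-1)}_{ik} e_k* for all 1 ≤ i ≤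 n. -/
section LeavittPathAlgebra

variable {K : Type} [Field K] {G : DirGraph}

/-- The universal property of the Leavitt path algebra. -/
noncomputable def lpaLift {B : Type*} [Ring B] [Algebra K B] (g : LGen G → B)
    (hg : ∀ x y, LRel K G x y → FreeAlgebra.lift K g x = FreeAlgebra.lift K g y) :
    LPA K G →ₐ[K] B :=
  RingQuot.liftAlgHom K ⟨FreeAlgebra.lift K g, fun {x y} h => hg x y h⟩

section lift

variable {B : Type*} [Ring B] [Algebra K B] (g : LGen G → B)
  (hg : ∀ x y, LRel K G x y → FreeAlgebra.lift K g x = FreeAlgebra.lift K g y)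

lemma lpaLift_vertexEl (u : G.V) : lpaLift g hg (vertexEl K G u) = g (.vertex u) := by
  simp [lpaLift, vertexEl]

lemma lpaLift_edgeEl (e : G.E) : lpaLift g hg (edgeEl K G e) = g (.edge e) := by
  simp [lpaLift, edgeEl]

lemma lpaLift_ghostEl (e : G.E) : lpaLift g hg (ghostEl K G e) = g (.ghost e) := by
  simp [lpaLift, ghostEl]

end lift

lemma vertexEl_mul_self (u : G.V) : vertexEl K G u * vertexEl K G u = vertexEl K G u := by
  simpa [vertexEl] using RingQuot.mkAlgHom_rel K (LRel.vertexIdem (K := K) u)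

lemma vertexEl_mul_of_ne {u u' : G.V} (h : u ≠ u') :
    vertexEl K G u * vertexEl K G u' = 0 := by
  simpa [vertexEl] using RingQuot.mkAlgHom_rel K (LRel.vertexOrth (K := K) u u' h)

lemma vertexEl_source_mul_edgeEl (e : G.E) :
    vertexEl K G (G.s e) * edgeEl K G e = edgeEl K G e := by
  simpa [vertexEl, edgeEl] using RingQuot.mkAlgHom_rel K (LRel.sourceEdge (K := K) e)

lemma edgeEl_mul_vertexEl_range (e : G.E) :
    edgeEl K G e * vertexEl K G (G.r e) = edgeEl K G e := by
  simpa [vertexEl, edgeEl] using RingQuot.mkAlgHom_rel K (LRel.edgeRange (K := K) e)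

lemma ghostEl_mul_vertexEl_source (e : G.E) :
    ghostEl K G e * vertexEl K G (G.s e) = ghostEl K G e := by
  simpa [vertexEl, ghostEl] using RingQuot.mkAlgHom_rel K (LRel.ghostSource (K := K) e)

lemma vertexEl_range_mul_ghostEl (e : G.E) :
    vertexEl K G (G.r e) * ghostEl K G e = ghostEl K G e := by
  simpa [vertexEl, ghostEl] using RingQuot.mkAlgHom_rel K (LRel.rangeGhost (K := K) e)

lemma ghostEl_mul_edgeEl_self (e : G.E) :
    ghostEl K G e * edgeEl K G e = vertexEl K G (G.r e) := by
  simpa [vertexEl, ghostEl, edgeEl] using RingQuot.mkAlgHom_rel K (LRel.ghostEdgeSame (K := K) e)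

lemma ghostEl_mul_edgeEl_of_ne {e f : G.E} (h : e ≠ f) :
    ghostEl K G e * edgeEl K G f = 0 := by
  simpa [ghostEl, edgeEl] using RingQuot.mkAlgHom_rel K (LRel.ghostEdgeNe (K := K) e f h)

lemma vertexEl_eq_sum {u : G.V} (hfin : {e : G.E | G.s e = u}.Finite)
    (hne : {e : G.E | G.s e = u}.Nonempty) :
    vertexEl K G u = ∑ e ∈ hfin.toFinset, edgeEl K G e * ghostEl K G e := by
  simpa [vertexEl, ghostEl, edgeEl] using RingQuot.mkAlgHom_rel K (LRel.ck2 (K := K) u hfin hne)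

lemma vertexEl_mul_edgeEl_of_ne {u : G.V} {e : G.E} (h : u ≠ G.s e) :
    vertexEl K G u * edgeEl K G e = 0 := by
  rw [← vertexEl_source_mul_edgeEl, ← mul_assoc, vertexEl_mul_of_ne h, zero_mul]

lemma ghostEl_mul_vertexEl_of_ne {u : G.V} {e : G.E} (h : G.s e ≠ u) :
    ghostEl K G e * vertexEl K G u = 0 := by
  rw [← ghostEl_mul_vertexEl_source, mul_assoc, vertexEl_mul_of_ne h, mul_zero]

lemma edgeEl_mul_edgeEl_of_ne {e f : G.E} (h : G.r e ≠ G.s f) :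
    edgeEl K G e * edgeEl K G f = 0 := by
  rw [← edgeEl_mul_vertexEl_range, mul_assoc, vertexEl_mul_edgeEl_of_ne h, mul_zero]

lemma ghostEl_mul_ghostEl_of_ne {e f : G.E} (h : G.r f ≠ G.s e) :
    ghostEl K G e * ghostEl K G f = 0 := by
  rw [← vertexEl_range_mul_ghostEl f, ← mul_assoc, ghostEl_mul_vertexEl_of_ne h.symm, zero_mul]

@[simp] lemma edgeProd_nil : edgeProd K G [] = 1 := rfl

@[simp] lemma ghostProd_nil : ghostProd K G [] = 1 := rfl

lemma edgeProd_cons (e : G.E) (p : List G.E) :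
    edgeProd K G (e :: p) = edgeEl K G e * edgeProd K G p := by
  simp [edgeProd]

lemma ghostProd_cons (e : G.E) (q : List G.E) :
    ghostProd K G (e :: q) = ghostProd K G q * ghostEl K G e := by
  simp [ghostProd]

lemma ghostProd_concat (q : List G.E) (e : G.E) :
    ghostProd K G (q ++ [e]) = ghostEl K G e * ghostProd K G q := by
  simp [ghostProd]

lemma mem_lpaComponent {p q : List G.E} (u : G.V) (hp : IsPath G p) (hq : IsPath G q) {d : ℤ}
    (hd : (p.length : ℤ) - q.length = d) :
    edgeProd K G p * vertexEl K G u * ghostProd K G q ∈ lpaComponent K G d :=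
  Submodule.subset_span ⟨p, q, u, hp, hq, hd, rfl⟩

lemma vertexEl_mem_lpaComponent (u : G.V) : vertexEl K G u ∈ lpaComponent K G 0 := by
  simpa using mem_lpaComponent (K := K) (p := []) (q := []) u List.isChain_nil List.isChain_nil rfl

lemma edgeEl_mem_lpaComponent (e : G.E) : edgeEl K G e ∈ lpaComponent K G 1 := by
  simpa [edgeProd_cons, edgeEl_mul_vertexEl_range] using
    mem_lpaComponent (K := K) (p := [e]) (q := []) (G.r e) (List.isChain_singleton e)
      List.isChain_nil rfl

lemma ghostEl_mem_lpaComponent (e : G.E) : ghostEl K G e ∈ lpaComponent K G (-1) := by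
  simpa [ghostProd_cons, vertexEl_range_mul_ghostEl] using
    mem_lpaComponent (K := K) (p := []) (q := [e]) (G.r e) List.isChain_nil
      (List.isChain_singleton e) rfl

/-- An algebra homomorphism that sends the generators to elements of the expected degrees of a
multiplicative family of submodules is graded. -/
lemma map_mem_of_mem_lpaComponent {B : Type*} [Ring B] [Algebra K B] (f : LPA K G →ₐ[K] B)
    (M : ℤ → Submodule K B)
    (hmul : ∀ {d d' : ℤ} {a b : B}, a ∈ M d → b ∈ M d' → a * b ∈ M (d + d'))
    (hvertex : ∀ u, f (vertexEl K G u) ∈ M 0) (hedge : ∀ e, f (edgeEl K G e) ∈ M 1)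
    (hghost : ∀ e, f (ghostEl K G e) ∈ M (-1)) {d : ℤ} {x : LPA K G}
    (hx : x ∈ lpaComponent K G d) : f x ∈ M d := by
  have left : ∀ (p : List G.E) (k : ℤ) (b : B), b ∈ M k →
      f (edgeProd K G p) * b ∈ M (p.length + k) := by
    intro p
    induction p with
    | nil => intro k b hb; simpa using hb
    | cons e p ih =>
      intro k b hb
      rw [edgeProd_cons, map_mul, mul_assoc]
      convert hmul (hedge e) (ih k b hb) using 1
      push_cast [List.length_cons]
      ring_nf
  have right : ∀ (q : List G.E) (k : ℤ) (b : B), b ∈ M k →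
      b * f (ghostProd K G q) ∈ M (k - q.length) := by
    intro q
    induction q with
    | nil => intro k b hb; simpa using hb
    | cons e q ih =>
      intro k b hb
      rw [ghostProd_cons, map_mul, ← mul_assoc]
      convert hmul (ih k b hb) (hghost e) using 1
      push_cast [List.length_cons]
      ring_nf
  have hle : lpaComponent K G d ≤ (M d).comap f.toLinearMap := by
    refine Submodule.span_le.mpr ?_
    rintro _ ⟨p, q, u, -, -, rfl, rfl⟩
    simpa using right q _ _ (left p 0 _ (hvertex u))
  exact hle hx

lemma vertexEl_mul_mul_ghostProd (u' u : G.V) (p q : List G.E) :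
    vertexEl K G u' * (edgeProd K G p * vertexEl K G u * ghostProd K G q) =
        edgeProd K G p * vertexEl K G u * ghostProd K G q ∨
      vertexEl K G u' * (edgeProd K G p * vertexEl K G u * ghostProd K G q) = 0 := by
  cases p with
  | nil =>
    by_cases h : u' = u
    · left; simp [h, ← mul_assoc, vertexEl_mul_self]
    · right; simp [← mul_assoc, vertexEl_mul_of_ne h]
  | cons e p =>
    by_cases h : u' = G.s e
    · left; simp [h, edgeProd_cons, ← mul_assoc, vertexEl_source_mul_edgeEl]
    · right; simp [edgeProd_cons, ← mul_assoc, vertexEl_mul_edgeEl_of_ne h]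

lemma mul_vertexEl_mul_ghostProd (u' u : G.V) (p q : List G.E) :
    edgeProd K G p * vertexEl K G u * ghostProd K G q * vertexEl K G u' =
        edgeProd K G p * vertexEl K G u * ghostProd K G q ∨
      edgeProd K G p * vertexEl K G u * ghostProd K G q * vertexEl K G u' = 0 := by
  cases q with
  | nil =>
    by_cases h : u = u'
    · left; simp [h, mul_assoc, vertexEl_mul_self]
    · right; simp [mul_assoc, vertexEl_mul_of_ne h]
  | cons e q =>
    by_cases h : G.s e = u'
    · left; simp [← h, ghostProd_cons, mul_assoc, ghostEl_mul_vertexEl_source]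
    · right; simp [ghostProd_cons, mul_assoc, ghostEl_mul_vertexEl_of_ne h]

lemma vertexEl_mul_mem_lpaComponent (u : G.V) {d : ℤ} {x : LPA K G}
    (hx : x ∈ lpaComponent K G d) : vertexEl K G u * x ∈ lpaComponent K G d := by
  have hle : lpaComponent K G d ≤
      (lpaComponent K G d).comap (LinearMap.mulLeft K (vertexEl K G u)) := by
    refine Submodule.span_le.mpr ?_
    rintro _ ⟨p, q, u', hp, hq, hd, rfl⟩
    rcases vertexEl_mul_mul_ghostProd (K := K) u u' p q with h | h
    · simpa [h] using mem_lpaComponent u' hp hq hd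
    · simp [h]
  exact hle hx

lemma edgeEl_mul_mem_lpaComponent (e : G.E) {d : ℤ} {x : LPA K G}
    (hx : x ∈ lpaComponent K G d) : edgeEl K G e * x ∈ lpaComponent K G (1 + d) := by
  have hle : lpaComponent K G d ≤
      (lpaComponent K G (1 + d)).comap (LinearMap.mulLeft K (edgeEl K G e)) := by
    refine Submodule.span_le.mpr ?_
    rintro _ ⟨p, q, u, hp, hq, rfl, rfl⟩
    have key : IsPath G (e :: p) → edgeEl K G e *
        (edgeProd K G p * vertexEl K G u * ghostProd K G q) ∈
          lpaComponent K G (1 + ((p.length : ℤ) - q.length)) := by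
      intro h
      simpa [edgeProd_cons, mul_assoc] using mem_lpaComponent (K := K) u h hq
        (d := 1 + ((p.length : ℤ) - q.length)) (by push_cast [List.length_cons]; ring)
    cases p with
    | nil => exact key (List.isChain_singleton e)
    | cons f p =>
      by_cases h : G.r e = G.s f
      · exact key (List.isChain_cons_cons.mpr ⟨h, hp⟩)
      · simp [edgeProd_cons, ← mul_assoc, edgeEl_mul_edgeEl_of_ne h]
  exact hle hx

lemma ghostEl_mul_mem_lpaComponent (e : G.E) {d : ℤ} {x : LPA K G}
    (hx : x ∈ lpaComponent K G d) : ghostEl K G e * x ∈ lpaComponent K G (-1 + d) := by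
  have hle : lpaComponent K G d ≤
      (lpaComponent K G (-1 + d)).comap (LinearMap.mulLeft K (ghostEl K G e)) := by
    refine Submodule.span_le.mpr ?_
    rintro _ ⟨p, q, u, hp, hq, rfl, rfl⟩
    simp only [Submodule.comap_coe, Set.mem_preimage, LinearMap.mulLeft_apply, SetLike.mem_coe]
    cases p with
    | nil =>
      by_cases h : G.s e = u
      · have heq : ghostEl K G e * (edgeProd K G [] * vertexEl K G u * ghostProd K G q) =
            edgeProd K G [] * vertexEl K G (G.r e) * ghostProd K G (q ++ [e]) := by
          simp [ghostProd_concat, ← h, ← mul_assoc, ghostEl_mul_vertexEl_source,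
            vertexEl_range_mul_ghostEl]
        rw [heq]
        rcases q.eq_nil_or_concat with rfl | ⟨q, f, rfl⟩
        · exact mem_lpaComponent _ List.isChain_nil (List.isChain_singleton e) (by simp)
        · by_cases hf : G.r f = G.s e
          · refine mem_lpaComponent _ List.isChain_nil ?_ (by simp; ring)
            refine List.isChain_append.mpr ⟨hq, List.isChain_singleton e, ?_⟩
            simp [hf]
          · rw [ghostProd_concat, List.concat_eq_append, ghostProd_concat, ← mul_assoc (ghostEl K G e),
              ghostEl_mul_ghostEl_of_ne hf]
            simp
      · simp [← mul_assoc, ghostEl_mul_vertexEl_of_ne h]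
    | cons f p =>
      by_cases h : e = f
      · subst h
        have := vertexEl_mul_mem_lpaComponent (K := K) (G.r e)
          (mem_lpaComponent (p := p) u (List.IsChain.tail hp) hq rfl)
        simp only [edgeProd_cons, ← mul_assoc, ghostEl_mul_edgeEl_self] at this ⊢
        convert this using 2
        simp; ring
      · simp [edgeProd_cons, ← mul_assoc, ghostEl_mul_edgeEl_of_ne h]
  exact hle hx

/-- The operators on the Leavitt path algebra that raise the degree by `d`. -/
def degreeShift (K : Type) [Field K] (G : DirGraph) (d : ℤ) :
    Submodule K (Module.End K (LPA K G)) where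
  carrier := {T | ∀ k, ∀ x ∈ lpaComponent K G k, T x ∈ lpaComponent K G (d + k)}
  add_mem' hS hT k x hx := add_mem (hS k x hx) (hT k x hx)
  zero_mem' _ _ _ := zero_mem _
  smul_mem' c _ hT k x hx := Submodule.smul_mem _ c (hT k x hx)

lemma mul_mem_lpaComponent {d d' : ℤ} {x y : LPA K G} (hx : x ∈ lpaComponent K G d)
    (hy : y ∈ lpaComponent K G d') : x * y ∈ lpaComponent K G (d + d') := by
  suffices h : Algebra.lmul K (LPA K G) x ∈ degreeShift K G d from h d' y hy
  refine map_mem_of_mem_lpaComponent (B := Module.End K (LPA K G)) (Algebra.lmul K (LPA K G))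
    (degreeShift K G) ?_ ?_ ?_ ?_ hx
  · intro d d' S T hS hT k z hz
    simpa [add_assoc] using hS _ _ (hT k z hz)
  · intro u k z hz
    simpa using vertexEl_mul_mem_lpaComponent u hz
  · intro e k z hz
    exact edgeEl_mul_mem_lpaComponent e hz
  · intro e k z hz
    exact ghostEl_mul_mem_lpaComponent e hz

/-- The scalars together with the homogeneous components span the Leavitt path algebra. -/
lemma span_one_sup_iSup_lpaComponent :
    Submodule.span K {(1 : LPA K G)} ⊔ ⨆ d, lpaComponent K G d = ⊤ := by
  set S := Submodule.span K {(1 : LPA K G)} ⊔ ⨆ d, lpaComponent K G d with hS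
  have hcomp : ∀ {d x}, x ∈ lpaComponent K G d → x ∈ S := fun {d x} hx =>
    Submodule.mem_sup_right (Submodule.mem_iSup_of_mem d hx)
  have hgen : ∀ (d : ℤ) (a : LPA K G), a ∈ lpaComponent K G d → ∀ x ∈ S, a * x ∈ S := by
    intro d a ha
    have : S ≤ S.comap (LinearMap.mulLeft K a) := by
      refine sup_le ?_ (iSup_le fun k x hx => hcomp (mul_mem_lpaComponent ha hx))
      rw [Submodule.span_singleton_le_iff_mem]
      simpa using hcomp ha
    exact this
  have key : ∀ a : FreeAlgebra K (LGen G), ∀ x ∈ S, RingQuot.mkAlgHom K (LRel K G) a * x ∈ S := by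
    intro a
    induction a using FreeAlgebra.induction with
    | grade0 c =>
      intro x hx
      rw [AlgHom.commutes, ← Algebra.smul_def]
      exact S.smul_mem c hx
    | grade1 g =>
      cases g with
      | vertex u => exact hgen 0 _ (vertexEl_mem_lpaComponent u)
      | edge e => exact hgen 1 _ (edgeEl_mem_lpaComponent e)
      | ghost e => exact hgen (-1) _ (ghostEl_mem_lpaComponent e)
    | mul a b ha hb =>
      intro x hx
      rw [map_mul, mul_assoc]
      exact ha _ (hb _ hx)
    | add a b ha hb =>
      intro x hx
      rw [map_add, add_mul]
      exact add_mem (ha _ hx) (hb _ hx)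
  refine eq_top_iff.mpr fun x _ => ?_
  obtain ⟨a, rfl⟩ := RingQuot.mkAlgHom_surjective K (LRel K G) x
  simpa using key a 1 (Submodule.mem_sup_left (Submodule.mem_span_singleton_self 1))

/-- There are a nonempty set `κ` and injections `ι e : κ → κ` indexed by the edges such that the
images of the `ι e`, for `e` running over the edges starting at a vertex that is not a sink,
partition `κ`. -/
lemma exists_branching (G : DirGraph) : ∃ (κ : Type) (_ : Nonempty κ) (ι : G.E → κ → κ),
    (∀ e f k l, G.s e = G.s f → ι e k = ι f l → e = f ∧ k = l) ∧
    ∀ e k, ∃ f l, G.s f = G.s e ∧ ι f l = k := by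
  have hequiv : ∀ u : G.V, Nonempty {e // G.s e = u} →
      Nonempty ({e // G.s e = u} × (ℕ × Option G.E) ≃ ℕ × Option G.E) := by
    intro u hu
    rw [← Cardinal.eq, Cardinal.mk_prod, Cardinal.lift_id, Cardinal.lift_id]
    refine Cardinal.mul_eq_right (Cardinal.aleph0_le_mk _) ?_ (Cardinal.mk_ne_zero _)
    exact Cardinal.mk_le_of_injective (f := fun e => ((0 : ℕ), some e.1)) fun e f h => by
      simpa [Subtype.ext_iff] using h
  let β := fun u hu => (hequiv u hu).some
  let ι : G.E → ℕ × Option G.E → ℕ × Option G.E := fun e k => β (G.s e) ⟨e, rfl⟩ (⟨e, rfl⟩, k)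
  have hι : ∀ e u (h : G.s e = u) k, ι e k = β u ⟨e, h⟩ (⟨e, h⟩, k) := by
    rintro e _ rfl k
    rfl
  refine ⟨ℕ × Option G.E, inferInstance, ι, ?_, ?_⟩
  · intro e f k l hef h
    rw [hι f (G.s e) hef.symm] at h
    simpa using (β (G.s e) ⟨e, rfl⟩).injective h
  · intro e k
    obtain ⟨⟨⟨f, hf⟩, l⟩, h⟩ := (β (G.s e) ⟨e, rfl⟩).surjective k
    exact ⟨f, l, hf, (hι f (G.s e) hf l).trans h⟩

section branching

open Classical

variable {κ : Type} (ι : G.E → κ → κ)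

/-- The operator by which a vertex acts on the functions on `G.V × κ`. -/
noncomputable def vertexOp (u : G.V) : Module.End K (G.V × κ → K) where
  toFun g x := if x.1 = u then g x else 0
  map_add' g h := by ext x; dsimp; split_ifs <;> simp
  map_smul' c g := by ext x; dsimp; split_ifs <;> simp

/-- The operator by which an edge acts on the functions on `G.V × κ`. -/
noncomputable def edgeOp (e : G.E) : Module.End K (G.V × κ → K) where
  toFun g x := if h : ∃ k, x = (G.s e, ι e k) then g (G.r e, h.choose) else 0
  map_add' g h := by ext x; dsimp; split_ifs <;> simp
  map_smul' c g := by ext x; dsimp; split_ifs <;> simp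

/-- The operator by which a ghost edge acts on the functions on `G.V × κ`. -/
noncomputable def ghostOp (e : G.E) : Module.End K (G.V × κ → K) where
  toFun g x := if x.1 = G.r e then g (G.s e, ι e x.2) else 0
  map_add' g h := by ext x; dsimp; split_ifs <;> simp
  map_smul' c g := by ext x; dsimp; split_ifs <;> simp

lemma vertexOp_apply (u : G.V) (g : G.V × κ → K) (x : G.V × κ) :
    vertexOp u g x = if x.1 = u then g x else 0 := rfl

lemma ghostOp_apply (e : G.E) (g : G.V × κ → K) (x : G.V × κ) :
    ghostOp ι e g x = if x.1 = G.r e then g (G.s e, ι e x.2) else 0 := rfl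

variable {ι}

lemma edgeOp_apply_of_forall_ne {e : G.E} {x : G.V × κ} (h : ∀ k, x ≠ (G.s e, ι e k))
    (g : G.V × κ → K) : edgeOp ι e g x = 0 :=
  dif_neg fun ⟨k, hk⟩ => h k hk

lemma edgeOp_apply (hι : ∀ e f k l, G.s e = G.s f → ι e k = ι f l → e = f ∧ k = l)
    (e : G.E) (g : G.V × κ → K) (k : κ) :
    edgeOp ι e g (G.s e, ι e k) = g (G.r e, k) := by
  have h : ∃ l, (G.s e, ι e k) = (G.s e, ι e l) := ⟨k, rfl⟩
  have hk : h.choose = k := ((hι e e _ _ rfl (Prod.ext_iff.mp h.choose_spec).2).2).symm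
  change dite _ _ _ = _
  rw [dif_pos h, hk]

end branching

lemma vertexEl_ne_zero (u : G.V) : vertexEl K G u ≠ 0 := by
  classical
  obtain ⟨κ, ⟨k₀⟩, ι, hι, hsurj⟩ := exists_branching G
  let gen : LGen G → Module.End K (G.V × κ → K)
    | .vertex u => vertexOp u
    | .edge e => edgeOp ι e
    | .ghost e => ghostOp ι e
  have hcases : ∀ (e : G.E) (x : G.V × κ), (∃ k, x = (G.s e, ι e k)) ∨
      ∀ k, x ≠ (G.s e, ι e k) := fun e x => by
    by_cases h : ∃ k, x = (G.s e, ι e k)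
    · exact .inl h
    · exact .inr (not_exists.mp h)
  have hrel : ∀ x y, LRel K G x y → FreeAlgebra.lift K gen x = FreeAlgebra.lift K gen y := by
    intro x y h
    cases h with
    | vertexIdem u =>
      ext1 g; ext1 x
      simp +contextual [gen, vertexOp_apply]
    | vertexOrth u u' h =>
      ext1 g; ext1 x
      simp only [gen, map_mul, FreeAlgebra.lift_ι_apply, Module.End.mul_apply, vertexOp_apply,
        map_zero]
      split_ifs with h₁ h₂
      · exact absurd (h₁.symm.trans h₂) h
      · rfl
      · rfl
    | sourceEdge e =>
      ext1 g; ext1 x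
      simp only [gen, map_mul, FreeAlgebra.lift_ι_apply, Module.End.mul_apply, vertexOp_apply]
      split_ifs with h
      · rfl
      · refine (edgeOp_apply_of_forall_ne (fun k hk => h ?_) g).symm
        rw [hk]
    | edgeRange e =>
      ext1 g; ext1 x
      simp only [gen, map_mul, FreeAlgebra.lift_ι_apply, Module.End.mul_apply]
      rcases hcases e x with ⟨k, rfl⟩ | h
      · simp [edgeOp_apply hι, vertexOp_apply]
      · simp [edgeOp_apply_of_forall_ne h]
    | ghostSource e =>
      ext1 g; ext1 x
      simp [gen, ghostOp_apply, vertexOp_apply]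
    | rangeGhost e =>
      ext1 g; ext1 x
      simp +contextual [gen, ghostOp_apply, vertexOp_apply]
    | ghostEdgeSame e =>
      ext1 g; ext1 x
      simp only [gen, map_mul, FreeAlgebra.lift_ι_apply, Module.End.mul_apply, ghostOp_apply,
        edgeOp_apply hι, vertexOp_apply]
      split_ifs with h
      · rw [← h]
      · rfl
    | ghostEdgeNe e f h =>
      ext1 g; ext1 x
      simp only [gen, map_mul, FreeAlgebra.lift_ι_apply, Module.End.mul_apply, ghostOp_apply]
      rw [edgeOp_apply_of_forall_ne]
      · simp
      · intro k hk
        exact h (hι _ _ _ _ (Prod.ext_iff.mp hk).1 (Prod.ext_iff.mp hk).2).1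
    | ck2 u hfin hne =>
      ext1 g; ext1 x
      simp only [gen, map_sum, map_mul, FreeAlgebra.lift_ι_apply, LinearMap.sum_apply,
        Finset.sum_apply, Module.End.mul_apply, vertexOp_apply]
      split_ifs with h
      · obtain ⟨e, he⟩ := hne
        obtain ⟨f, l, hf, hl⟩ := hsurj e x.2
        have hx : x = (G.s f, ι f l) := Prod.ext (h.trans (he.symm.trans hf.symm)) hl.symm
        rw [Finset.sum_eq_single f]
        · rw [hx, edgeOp_apply hι]
          simp [ghostOp_apply]
        · intro e' _ hne'
          refine edgeOp_apply_of_forall_ne (fun k hk => hne' ?_) _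
          rw [hx] at hk
          exact (hι _ _ _ _ (Prod.ext_iff.mp hk).1 (Prod.ext_iff.mp hk).2).1.symm
        · intro hf'
          exact absurd (hfin.mem_toFinset.mpr (hf.trans he)) hf'
      · refine (Finset.sum_eq_zero fun e he => edgeOp_apply_of_forall_ne (fun k hk => h ?_) _).symm
        rw [hk]
        exact hfin.mem_toFinset.mp he
  intro h0
  have := lpaLift_vertexEl gen hrel u
  rw [h0, map_zero] at this
  simpa [gen, vertexOp_apply] using congrFun (LinearMap.congr_fun this fun _ => 1) (u, k₀)

/-- The homomorphism from the Leavitt path algebra to the scalars that kills all generators. -/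
noncomputable def augmentation (K : Type) [Field K] (G : DirGraph) : LPA K G →ₐ[K] K :=
  lpaLift (fun _ => 0) fun x y h => by cases h <;> simp

lemma augmentation_apply_of_mem {d : ℤ} {x : LPA K G} (hx : x ∈ lpaComponent K G d) :
    augmentation K G x = 0 := by
  have := map_mem_of_mem_lpaComponent (augmentation K G) (fun _ => ⊥) (by simp_all)
    (by simp [augmentation, lpaLift_vertexEl]) (by simp [augmentation, lpaLift_edgeEl])
    (by simp [augmentation, lpaLift_ghostEl]) hx
  simpa using this

/-- The generators of the Leavitt path algebra, placed in their degrees inside the Laurent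
polynomials with coefficients in the Leavitt path algebra. -/
noncomputable def degreeGen (K : Type) [Field K] (G : DirGraph) :
    LGen G → AddMonoidAlgebra (LPA K G) ℤ
  | .vertex u => .single 0 (vertexEl K G u)
  | .edge e => .single 1 (edgeEl K G e)
  | .ghost e => .single (-1) (ghostEl K G e)

/-- The homomorphism to the Laurent polynomials with coefficients in the Leavitt path algebra that
sends a homogeneous element `x` of degree `d` to `x T^d`. -/
noncomputable def degreeHom (K : Type) [Field K] (G : DirGraph) :
    LPA K G →ₐ[K] AddMonoidAlgebra (LPA K G) ℤ :=
  lpaLift (degreeGen K G) fun x y h => by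
    cases h with
    | ck2 u hfin hne =>
      have := map_sum (AddMonoidAlgebra.singleAddHom (R := LPA K G) (0 : ℤ))
        (fun e => edgeEl K G e * ghostEl K G e) hfin.toFinset
      rw [← vertexEl_eq_sum hfin hne] at this
      simpa [-LaurentPolynomial.single_eq_C_mul_T, degreeGen, AddMonoidAlgebra.single_mul_single] using this
    | _ =>
      simp [-LaurentPolynomial.single_eq_C_mul_T, degreeGen, AddMonoidAlgebra.single_mul_single,
        vertexEl_mul_self, vertexEl_mul_of_ne,
        vertexEl_source_mul_edgeEl, edgeEl_mul_vertexEl_range, ghostEl_mul_vertexEl_source,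
        vertexEl_range_mul_ghostEl, ghostEl_mul_edgeEl_self, ghostEl_mul_edgeEl_of_ne, *]

/-- The graph of `x ↦ x T^d` inside the product of the Laurent polynomials with the algebra. -/
def singleGraph (K : Type) [Field K] (G : DirGraph) (d : ℤ) :
    Submodule K (AddMonoidAlgebra (LPA K G) ℤ × LPA K G) where
  carrier := {z | z.1 = .single d z.2}
  add_mem' {y z} hy hz := by
    simp_all [-LaurentPolynomial.single_eq_C_mul_T, AddMonoidAlgebra.single_add]
  zero_mem' := by simp
  smul_mem' c z hz := by
    simp_all [-LaurentPolynomial.single_eq_C_mul_T]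

lemma degreeHom_apply_of_mem {d : ℤ} {x : LPA K G} (hx : x ∈ lpaComponent K G d) :
    degreeHom K G x = .single d x := by
  refine map_mem_of_mem_lpaComponent (B := AddMonoidAlgebra (LPA K G) ℤ × LPA K G)
    ((degreeHom K G).prod (AlgHom.id K _)) (singleGraph K G) ?_ ?_ ?_ ?_ hx
  · intro d d' y z (hy : y.1 = _) (hz : z.1 = _)
    change y.1 * z.1 = .single (d + d') (y.2 * z.2)
    rw [hy, hz, AddMonoidAlgebra.single_mul_single]
  · exact fun u => lpaLift_vertexEl _ _ u
  · exact fun e => lpaLift_edgeEl _ _ e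
  · exact fun e => lpaLift_ghostEl _ _ e

/-- Induction over the decomposition into scalars and homogeneous elements. -/
lemma lpa_induction {motive : LPA K G → Prop} (scalar : ∀ c : K, motive (c • 1))
    (homogeneous : ∀ d, ∀ x ∈ lpaComponent K G d, motive x)
    (sum : ∀ x y, motive x → motive y → motive (x + y)) (x : LPA K G) : motive x := by
  have hx : x ∈ Submodule.span K {(1 : LPA K G)} ⊔ ⨆ d, lpaComponent K G d := by
    simp [span_one_sup_iSup_lpaComponent]
  obtain ⟨y, hy, z, hz, rfl⟩ := Submodule.mem_sup.mp hx
  obtain ⟨c, rfl⟩ := Submodule.mem_span_singleton.mp hy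
  refine sum _ _ (scalar c) ?_
  clear hx hy
  induction hz using Submodule.iSup_induction' with
  | mem d x hx => exact homogeneous d x hx
  | zero => simpa using scalar 0
  | add x y _ _ hx hy => exact sum x y hx hy

lemma sum_coeff_degreeHom (x : LPA K G) : (degreeHom K G x).coeff.sum (fun _ a => a) = x := by
  induction x using lpa_induction with
  | scalar c => simp [-LaurentPolynomial.single_eq_C_mul_T, AddMonoidAlgebra.one_def,
      Finsupp.sum_single_index]
  | homogeneous d x hx => simp [-LaurentPolynomial.single_eq_C_mul_T, degreeHom_apply_of_mem hx,
      Finsupp.sum_single_index]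
  | sum x y hx hy =>
    rw [map_add, AddMonoidAlgebra.coeff_add, Finsupp.sum_add_index' (by simp) (by simp), hx, hy]

/-- A graded linear endomorphism that fixes `1` is injective when it is injective on every
homogeneous component. -/
lemma injective_of_injOn_lpaComponent (θ : LPA K G →ₗ[K] LPA K G) (h1 : θ 1 = 1)
    (hθ : ∀ d, ∀ x ∈ lpaComponent K G d, θ x ∈ lpaComponent K G d)
    (hinj : ∀ d, ∀ x ∈ lpaComponent K G d, θ x = 0 → x = 0) : Function.Injective θ := by
  have hcomm : ∀ x d, θ ((degreeHom K G x).coeff d) = (degreeHom K G (θ x)).coeff d := by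
    intro x k
    induction x using lpa_induction with
    | scalar c =>
      simp only [map_smul, h1, map_one, AddMonoidAlgebra.coeff_smul, Finsupp.smul_apply,
        AddMonoidAlgebra.one_def, AddMonoidAlgebra.coeff_single, Finsupp.single_apply]
      split_ifs <;> simp [h1]
    | homogeneous d x hx =>
      rw [degreeHom_apply_of_mem hx, degreeHom_apply_of_mem (hθ d x hx)]
      simp only [AddMonoidAlgebra.coeff_single, Finsupp.single_apply]
      split_ifs <;> simp
    | sum x y hx hy => simp [hx, hy]
  have hmem : ∀ x d, ∃ c : K, ∃ y ∈ lpaComponent K G d, (degreeHom K G x).coeff d = c • 1 + y := by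
    intro x k
    induction x using lpa_induction with
    | scalar c =>
      by_cases h : k = 0
      · exact ⟨c, 0, zero_mem _, by
        simp [-LaurentPolynomial.single_eq_C_mul_T, AddMonoidAlgebra.one_def, h]⟩
      · exact ⟨0, 0, zero_mem _, by
        simp [-LaurentPolynomial.single_eq_C_mul_T, AddMonoidAlgebra.one_def, Ne.symm h]⟩
    | homogeneous d x hx =>
      rw [degreeHom_apply_of_mem hx]
      by_cases h : d = k
      · exact ⟨0, x, h ▸ hx, by simp [-LaurentPolynomial.single_eq_C_mul_T, h]⟩
      · exact ⟨0, 0, zero_mem _, by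
        simp [-LaurentPolynomial.single_eq_C_mul_T, h]⟩
    | sum x y hx hy =>
      obtain ⟨c, a, ha, hx⟩ := hx
      obtain ⟨c', a', ha', hy⟩ := hy
      exact ⟨c + c', a + a', add_mem ha ha', by simp [hx, hy, add_smul]; abel⟩
  refine (injective_iff_map_eq_zero θ).mpr fun x hx => ?_
  have hzero : (degreeHom K G x).coeff = 0 := by
    ext d
    obtain ⟨c, y, hy, hc⟩ := hmem x d
    have h := hcomm x d
    rw [hx, hc, map_add, map_smul, h1, map_zero] at h
    have hε := congrArg (augmentation K G) h
    simp [augmentation_apply_of_mem (hθ d y hy)] at hε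
    subst hε
    simp at h
    simp [hc, hinj d y hy h]
  rw [← sum_coeff_degreeHom x, hzero, Finsupp.sum_zero_index]

lemma exists_finset_sum_edgeEl_mul {x : LPA K G}
    (hx : x ∈ Submodule.span K {x : LPA K G | ∃ e z, x = edgeEl K G e * z}) :
    ∃ F : Finset G.E, ∀ F', F ⊆ F' → ∑ e ∈ F', edgeEl K G e * (ghostEl K G e * x) = x := by
  classical
  induction hx using Submodule.span_induction with
  | mem x h =>
    obtain ⟨e, z, rfl⟩ := h
    refine ⟨{e}, fun F' hF' => ?_⟩
    rw [Finset.sum_eq_single e]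
    · rw [← mul_assoc (ghostEl K G e), ghostEl_mul_edgeEl_self, ← mul_assoc,
        edgeEl_mul_vertexEl_range]
    · intro f _ hf
      rw [← mul_assoc (ghostEl K G f), ghostEl_mul_edgeEl_of_ne hf, zero_mul, mul_zero]
    · exact fun h => absurd (hF' (Finset.mem_singleton_self e)) h
  | zero => exact ⟨∅, by simp⟩
  | add x y _ _ hx hy =>
    obtain ⟨F₁, h₁⟩ := hx
    obtain ⟨F₂, h₂⟩ := hy
    refine ⟨F₁ ∪ F₂, fun F' hF' => ?_⟩
    simp only [mul_add, Finset.sum_add_distrib]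
    rw [h₁ F' (Finset.union_subset_left hF'), h₂ F' (Finset.union_subset_right hF')]
  | smul c x _ hx =>
    obtain ⟨F, h⟩ := hx
    refine ⟨F, fun F' hF' => ?_⟩
    simp only [mul_smul_comm, ← Finset.smul_sum, h F' hF']

lemma exists_finset_sum_mul_ghostEl {x : LPA K G}
    (hx : x ∈ Submodule.span K {x : LPA K G | ∃ e z, x = z * ghostEl K G e}) :
    ∃ F : Finset G.E, ∀ F', F ⊆ F' → ∑ e ∈ F', x * edgeEl K G e * ghostEl K G e = x := by
  classical
  induction hx using Submodule.span_induction with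
  | mem x h =>
    obtain ⟨e, z, rfl⟩ := h
    refine ⟨{e}, fun F' hF' => ?_⟩
    rw [Finset.sum_eq_single e]
    · rw [mul_assoc z, ghostEl_mul_edgeEl_self, mul_assoc, vertexEl_range_mul_ghostEl]
    · intro f _ hf
      rw [mul_assoc z, ghostEl_mul_edgeEl_of_ne hf.symm, mul_zero, zero_mul]
    · exact fun h => absurd (hF' (Finset.mem_singleton_self e)) h
  | zero => exact ⟨∅, by simp⟩
  | add x y _ _ hx hy =>
    obtain ⟨F₁, h₁⟩ := hx
    obtain ⟨F₂, h₂⟩ := hy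
    refine ⟨F₁ ∪ F₂, fun F' hF' => ?_⟩
    simp only [add_mul, Finset.sum_add_distrib]
    rw [h₁ F' (Finset.union_subset_left hF'), h₂ F' (Finset.union_subset_right hF')]
  | smul c x _ hx =>
    obtain ⟨F, h⟩ := hx
    refine ⟨F, fun F' hF' => ?_⟩
    simp only [smul_mul_assoc, ← Finset.smul_sum, h F' hF']

lemma eq_zero_of_ghostEl_mul_eq_zero {x : LPA K G}
    (hx : x ∈ Submodule.span K {x : LPA K G | ∃ e z, x = edgeEl K G e * z})
    (h : ∀ e, ghostEl K G e * x = 0) : x = 0 := by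
  obtain ⟨F, hF⟩ := exists_finset_sum_edgeEl_mul hx
  rw [← hF F subset_rfl]
  simp [h]

lemma eq_zero_of_mul_edgeEl_eq_zero {x : LPA K G}
    (hx : x ∈ Submodule.span K {x : LPA K G | ∃ e z, x = z * ghostEl K G e})
    (h : ∀ e, x * edgeEl K G e = 0) : x = 0 := by
  obtain ⟨F, hF⟩ := exists_finset_sum_mul_ghostEl hx
  rw [← hF F subset_rfl]
  simp [h]

/-- An element of the right ideal generated by the edges is killed by almost all ghost edges. -/
lemma exists_finset_ghostEl_mul_eq_zero {x : LPA K G}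
    (hx : x ∈ Submodule.span K {x : LPA K G | ∃ e z, x = edgeEl K G e * z}) :
    ∃ F : Finset G.E, ∀ e ∉ F, ghostEl K G e * x = 0 := by
  classical
  obtain ⟨F, hF⟩ := exists_finset_sum_edgeEl_mul hx
  refine ⟨F, fun e he => ?_⟩
  rw [← hF F subset_rfl, Finset.mul_sum]
  refine Finset.sum_eq_zero fun f hf => ?_
  rw [← mul_assoc, ghostEl_mul_edgeEl_of_ne (ne_of_mem_of_not_mem hf he).symm, zero_mul]

lemma vertexEl_mul_sum (u : G.V) (c : G.V →₀ K) :
    vertexEl K G u * c.sum (fun u k => k • vertexEl K G u) = c u • vertexEl K G u := by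
  rw [Finsupp.sum, Finset.mul_sum, Finset.sum_eq_single u]
  · rw [mul_smul_comm, vertexEl_mul_self]
  · intro u' _ h
    rw [mul_smul_comm, vertexEl_mul_of_ne h.symm, smul_zero]
  · intro h
    simp [Finsupp.notMem_support_iff.mp h]

/-- The span of the elements `p q*` of degree `0` with `|p| = |q| ≤ n`. -/
noncomputable def lpaLevel (K : Type) [Field K] (G : DirGraph) (n : ℕ) : Submodule K (LPA K G) :=
  Submodule.span K {x : LPA K G | ∃ p q : List G.E, ∃ u : G.V, p.length = q.length ∧
    p.length ≤ n ∧ x = edgeProd K G p * vertexEl K G u * ghostProd K G q}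

lemma lpaLevel_mono {m n : ℕ} (h : m ≤ n) : lpaLevel K G m ≤ lpaLevel K G n :=
  Submodule.span_mono fun _ ⟨p, q, u, hpq, hp, hx⟩ => ⟨p, q, u, hpq, hp.trans h, hx⟩

lemma exists_mem_lpaLevel {x : LPA K G} (hx : x ∈ lpaComponent K G 0) :
    ∃ n, x ∈ lpaLevel K G n := by
  induction hx using Submodule.span_induction with
  | mem x h =>
    obtain ⟨p, q, u, -, -, hd, rfl⟩ := h
    exact ⟨p.length, Submodule.subset_span ⟨p, q, u, by omega, le_rfl, rfl⟩⟩
  | zero => exact ⟨0, zero_mem _⟩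
  | add x y _ _ hx hy =>
    obtain ⟨m, hm⟩ := hx
    obtain ⟨n, hn⟩ := hy
    exact ⟨max m n, add_mem (lpaLevel_mono (le_max_left m n) hm)
      (lpaLevel_mono (le_max_right m n) hn)⟩
  | smul c x _ hx =>
    obtain ⟨n, hn⟩ := hx
    exact ⟨n, Submodule.smul_mem _ c hn⟩

lemma ghostEl_mul_mul_edgeEl_mem_lpaLevel {n : ℕ} {x : LPA K G} (hx : x ∈ lpaLevel K G (n + 1))
    (e f : G.E) : ghostEl K G e * x * edgeEl K G f ∈ lpaLevel K G n := by
  induction hx using Submodule.span_induction with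
  | mem x h =>
    obtain ⟨p, q, u, hpq, hp, rfl⟩ := h
    match p, q with
    | [], [] =>
      simp only [edgeProd_nil, ghostProd_nil, one_mul, mul_one]
      by_cases hu : G.s e = u
      · rw [← hu, ghostEl_mul_vertexEl_source]
        by_cases hef : e = f
        · rw [← hef, ghostEl_mul_edgeEl_self]
          exact Submodule.subset_span ⟨[], [], G.r e, rfl, by simp, by simp⟩
        · simp [ghostEl_mul_edgeEl_of_ne hef]
      · simp [ghostEl_mul_vertexEl_of_ne hu]
    | [], _ :: _ => simp at hpq
    | _ :: _, [] => simp at hpq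
    | e' :: p, f' :: q =>
      by_cases he : e = e'
      · by_cases hf : f' = f
        · subst he hf
          have heq : ghostEl K G e * (edgeProd K G (e :: p) * vertexEl K G u *
              ghostProd K G (f' :: q)) * edgeEl K G f' =
              vertexEl K G (G.r e) * (edgeProd K G p * vertexEl K G u * ghostProd K G q) *
                vertexEl K G (G.r f') := by
            rw [← ghostEl_mul_edgeEl_self, ← ghostEl_mul_edgeEl_self, edgeProd_cons,
              ghostProd_cons]
            simp only [mul_assoc]
          rw [heq]
          rcases vertexEl_mul_mul_ghostProd (K := K) (G.r e) u p q with h | h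
          · rw [h]
            rcases mul_vertexEl_mul_ghostProd (K := K) (G.r f') u p q with h' | h'
            · rw [h']
              exact Submodule.subset_span ⟨p, q, u, by simpa using hpq, by simpa using hp, rfl⟩
            · simp [h']
          · simp [h]
        · rw [ghostProd_cons]
          simp only [mul_assoc]
          simp [ghostEl_mul_edgeEl_of_ne hf]
      · simp [edgeProd_cons, ← mul_assoc, ghostEl_mul_edgeEl_of_ne he]
  | zero => simp
  | add x y _ _ hx hy =>
    rw [mul_add, add_mul]
    exact add_mem hx hy
  | smul c x _ hx =>
    rw [mul_smul_comm, smul_mul_assoc]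
    exact Submodule.smul_mem _ c hx

lemma lpaLevel_le (n : ℕ) : lpaLevel K G n ≤ Submodule.span K (Set.range (vertexEl K G)) ⊔
    (Submodule.span K {x : LPA K G | ∃ e z, x = edgeEl K G e * z} ⊓
      Submodule.span K {x : LPA K G | ∃ e z, x = z * ghostEl K G e}) := by
  refine Submodule.span_le.mpr ?_
  rintro _ ⟨p, q, u, hpq, -, rfl⟩
  match p, q with
  | [], [] => exact Submodule.mem_sup_left (Submodule.subset_span ⟨u, by simp⟩)
  | [], _ :: _ => simp at hpq
  | _ :: _, [] => simp at hpq
  | e :: p, f :: q =>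
    refine Submodule.mem_sup_right
      ⟨Submodule.subset_span ⟨e, edgeProd K G p * vertexEl K G u * ghostProd K G (f :: q), ?_⟩,
        Submodule.subset_span ⟨f, edgeProd K G (e :: p) * vertexEl K G u * ghostProd K G q, ?_⟩⟩
    · simp only [edgeProd_cons, mul_assoc]
    · rw [ghostProd_cons, ← mul_assoc]

lemma lpaComponent_le_span_edgeEl_mul {d : ℤ} (hd : 0 < d) : lpaComponent K G d ≤
    Submodule.span K {x : LPA K G | ∃ e z, x = edgeEl K G e * z} := by
  refine Submodule.span_mono ?_
  rintro _ ⟨p, q, u, -, -, h, rfl⟩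
  cases p with
  | nil => simp at h; omega
  | cons e p => exact ⟨e, _, by rw [edgeProd_cons, mul_assoc, mul_assoc]⟩

lemma lpaComponent_le_span_mul_ghostEl {d : ℤ} (hd : d < 0) : lpaComponent K G d ≤
    Submodule.span K {x : LPA K G | ∃ e z, x = z * ghostEl K G e} := by
  refine Submodule.span_mono ?_
  rintro _ ⟨p, q, u, -, -, h, rfl⟩
  cases q with
  | nil => simp at h; omega
  | cons e q => exact ⟨e, _, by rw [ghostProd_cons, ← mul_assoc]⟩

lemma mul_mem_span_mul_ghostEl (a : LPA K G) {x : LPA K G}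
    (hx : x ∈ Submodule.span K {x : LPA K G | ∃ e z, x = z * ghostEl K G e}) :
    a * x ∈ Submodule.span K {x : LPA K G | ∃ e z, x = z * ghostEl K G e} := by
  have hle : Submodule.span K {x : LPA K G | ∃ e z, x = z * ghostEl K G e} ≤
      (Submodule.span K {x : LPA K G | ∃ e z, x = z * ghostEl K G e}).comap
        (LinearMap.mulLeft K a) := by
    refine Submodule.span_le.mpr ?_
    rintro _ ⟨e, z, rfl⟩
    exact Submodule.subset_span ⟨e, a * z, (mul_assoc a z _).symm⟩
  exact hle hx

lemma vertexEl_mul_eq_zero_of_sink {u : G.V} (hu : ∀ e, G.s e ≠ u) {x : LPA K G}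
    (hx : x ∈ Submodule.span K {x : LPA K G | ∃ e z, x = edgeEl K G e * z}) :
    vertexEl K G u * x = 0 := by
  obtain ⟨F, hF⟩ := exists_finset_sum_edgeEl_mul hx
  rw [← hF F subset_rfl, Finset.mul_sum]
  refine Finset.sum_eq_zero fun e _ => ?_
  rw [← mul_assoc, vertexEl_mul_edgeEl_of_ne (hu e).symm, zero_mul]

section uniqueness

variable {B : Type*} [Ring B] [Algebra K B] {f : LPA K G →ₐ[K] B}

lemma eq_zero_of_mem_lpaLevel (hf : ∀ u, f (vertexEl K G u) ≠ 0) {n : ℕ} {x : LPA K G}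
    (hx : x ∈ lpaLevel K G n) (hfx : f x = 0) : x = 0 := by
  have hvertex : ∀ (u : G.V) (k : K), f (k • vertexEl K G u) = 0 → k = 0 := by
    intro u k h
    rw [map_smul] at h
    exact (smul_eq_zero.mp h).resolve_right (hf u)
  induction n generalizing x with
  | zero =>
    have hle : lpaLevel K G 0 ≤ Submodule.span K (Set.range (vertexEl K G)) := by
      refine Submodule.span_mono ?_
      rintro _ ⟨p, q, u, hpq, hp, rfl⟩
      obtain rfl : p = [] := List.length_eq_zero_iff.mp (Nat.le_zero.mp hp)
      obtain rfl : q = [] := List.length_eq_zero_iff.mp hpq.symm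
      exact ⟨u, by simp⟩
    obtain ⟨c, rfl⟩ := Finsupp.mem_span_range_iff_exists_finsupp.mp (hle hx)
    have hc : c = 0 := by
      ext u
      refine hvertex u _ ?_
      rw [← vertexEl_mul_sum, map_mul, hfx, mul_zero]
    simp [hc]
  | succ n ih =>
    have hcorner : ∀ e e', ghostEl K G e * x * edgeEl K G e' = 0 := fun e e' =>
      ih (ghostEl_mul_mul_edgeEl_mem_lpaLevel hx e e') (by rw [map_mul, map_mul, hfx]; simp)
    obtain ⟨a, ha, y, ⟨hyl, hyr⟩, rfl⟩ := Submodule.mem_sup.mp (lpaLevel_le _ hx)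
    obtain ⟨c, rfl⟩ := Finsupp.mem_span_range_iff_exists_finsupp.mp ha
    have hne : ∀ u, c u ≠ 0 → {e | G.s e = u}.Nonempty := by
      intro u hcu
      by_contra h
      refine hcu (hvertex u _ ?_)
      have hy : vertexEl K G u * y = 0 := vertexEl_mul_eq_zero_of_sink
        (fun e he => h ⟨e, he⟩) hyl
      rw [← vertexEl_mul_sum, ← add_zero (vertexEl K G u * _), ← hy, ← mul_add, map_mul, hfx,
        mul_zero]
    have hfin : ∀ u, c u ≠ 0 → {e | G.s e = u}.Finite := by
      intro u hcu
      by_contra h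
      obtain ⟨F, hF⟩ := exists_finset_ghostEl_mul_eq_zero hyl
      obtain ⟨e, rfl, heF⟩ := Set.Infinite.exists_notMem_finset h F
      refine hcu ((smul_eq_zero.mp ?_).resolve_right (vertexEl_ne_zero (K := K) (G.r e)))
      have := hcorner e e
      rwa [mul_add, hF e heF, add_zero, ← ghostEl_mul_vertexEl_source, mul_assoc (ghostEl K G e),
        vertexEl_mul_sum, mul_smul_comm, smul_mul_assoc, ghostEl_mul_vertexEl_source,
        ghostEl_mul_edgeEl_self] at this
    have hal : c.sum (fun u k => k • vertexEl K G u) ∈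
        Submodule.span K {x : LPA K G | ∃ e z, x = edgeEl K G e * z} := by
      refine sum_mem fun u hu => Submodule.smul_mem _ _ ?_
      have hcu := Finsupp.mem_support_iff.mp hu
      rw [vertexEl_eq_sum (hfin u hcu) (hne u hcu)]
      exact sum_mem fun e _ => Submodule.subset_span ⟨e, _, rfl⟩
    have har : c.sum (fun u k => k • vertexEl K G u) ∈
        Submodule.span K {x : LPA K G | ∃ e z, x = z * ghostEl K G e} := by
      refine sum_mem fun u hu => Submodule.smul_mem _ _ ?_
      have hcu := Finsupp.mem_support_iff.mp hu
      rw [vertexEl_eq_sum (hfin u hcu) (hne u hcu)]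
      exact sum_mem fun e _ => Submodule.subset_span ⟨e, _, rfl⟩
    exact eq_zero_of_ghostEl_mul_eq_zero (add_mem hal hyl) fun e =>
      eq_zero_of_mul_edgeEl_eq_zero (mul_mem_span_mul_ghostEl _ (add_mem har hyr)) (hcorner e)

/-- The graded uniqueness theorem: a homomorphism that does not kill any vertex does not kill any
nonzero homogeneous element. -/
lemma eq_zero_of_mem_lpaComponent (hf : ∀ u, f (vertexEl K G u) ≠ 0) {d : ℤ} {x : LPA K G}
    (hx : x ∈ lpaComponent K G d) (hfx : f x = 0) : x = 0 := by
  induction d generalizing x with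
  | zero =>
    obtain ⟨n, hn⟩ := exists_mem_lpaLevel hx
    exact eq_zero_of_mem_lpaLevel hf hn hfx
  | succ d ih =>
    refine eq_zero_of_ghostEl_mul_eq_zero (lpaComponent_le_span_edgeEl_mul (by omega) hx)
      fun e => ih ?_ (by rw [map_mul, hfx, mul_zero])
    simpa using ghostEl_mul_mem_lpaComponent e hx
  | pred d ih =>
    refine eq_zero_of_mul_edgeEl_eq_zero (lpaComponent_le_span_mul_ghostEl (by omega) hx)
      fun e => ih ?_ (by rw [map_mul, hfx, zero_mul])
    simpa using mul_mem_lpaComponent hx (edgeEl_mem_lpaComponent e)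

end uniqueness

section twist

variable {σ : LPA K G ≃ₐ[K] LPA K G}

/-- The operators on the Leavitt path algebra representing the generators inside the skew Laurent
extension by `σ`. -/
noncomputable def twistGen (σ : LPA K G ≃ₐ[K] LPA K G) : LGen G → Module.End K (LPA K G)
  | .vertex u => Algebra.lmul K _ (vertexEl K G u)
  | .edge e => Algebra.lmul K _ (edgeEl K G e) * σ.toLinearMap
  | .ghost e => σ.symm.toLinearMap * Algebra.lmul K _ (ghostEl K G e)

/-- The action of the Leavitt path algebra on itself obtained from its homomorphism to the Zhang
twist by `σ`, where a homogeneous element `a` of degree `d` of the twist acts as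
`x ↦ a * σ ^ d x`. -/
noncomputable def twistHom (σ : LPA K G ≃ₐ[K] LPA K G)
    (hσ : ∀ u, σ (vertexEl K G u) = vertexEl K G u) :
    LPA K G →ₐ[K] Module.End K (LPA K G) :=
  lpaLift (twistGen σ) fun x y h => by
    have hσ' : ∀ u, σ.symm (vertexEl K G u) = vertexEl K G u := fun u => by
      rw [AlgEquiv.symm_apply_eq, hσ]
    cases h with
    | ck2 u hfin hne =>
      ext z
      simp [twistGen, vertexEl_eq_sum hfin hne, LinearMap.sum_apply, mul_assoc]
    | vertexIdem u => ext z; simp [twistGen, ← mul_assoc, vertexEl_mul_self]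
    | vertexOrth u u' h => ext z; simp [twistGen, ← mul_assoc, vertexEl_mul_of_ne h]
    | sourceEdge e => ext z; simp [twistGen, ← mul_assoc, vertexEl_source_mul_edgeEl]
    | edgeRange e => ext z; simp [twistGen, hσ, ← mul_assoc, edgeEl_mul_vertexEl_range]
    | ghostSource e =>
      ext z
      have h := congrArg σ.symm (ghostEl_mul_vertexEl_source (K := K) e)
      rw [map_mul, hσ'] at h
      simp [twistGen, hσ', ← mul_assoc, h]
    | rangeGhost e =>
      ext z
      have h := congrArg σ.symm (vertexEl_range_mul_ghostEl (K := K) e)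
      rw [map_mul, hσ'] at h
      simp [twistGen, ← mul_assoc, h]
    | ghostEdgeSame e =>
      ext z
      have h := congrArg σ.symm (ghostEl_mul_edgeEl_self (K := K) e)
      rw [map_mul, hσ'] at h
      simp [twistGen, ← mul_assoc, h]
    | ghostEdgeNe e f hef =>
      ext z
      have h := congrArg σ.symm (ghostEl_mul_edgeEl_of_ne (K := K) hef)
      rw [map_mul, map_zero] at h
      simp [twistGen, ← mul_assoc, h]

/-- The operators `x ↦ a * σ ^ d x` with `a` homogeneous of degree `d`. -/
def twistDegree (σ : LPA K G ≃ₐ[K] LPA K G) (d : ℤ) : Submodule K (Module.End K (LPA K G)) where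
  carrier := {T | ∃ a ∈ lpaComponent K G d, ∀ x, T x = a * (σ ^ d) x}
  add_mem' := by
    rintro S T ⟨a, ha, hS⟩ ⟨b, hb, hT⟩
    exact ⟨a + b, add_mem ha hb, fun x => by simp [hS, hT, add_mul]⟩
  zero_mem' := ⟨0, zero_mem _, by simp⟩
  smul_mem' := by
    rintro c T ⟨a, ha, hT⟩
    exact ⟨c • a, Submodule.smul_mem _ c ha, fun x => by simp [hT]⟩

lemma twistHom_mem_twistDegree (hσ : ∀ u, σ (vertexEl K G u) = vertexEl K G u)
    (hmem : ∀ d, ∀ x ∈ lpaComponent K G d, σ x ∈ lpaComponent K G d)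
    (hmem' : ∀ d, ∀ x ∈ lpaComponent K G d, σ.symm x ∈ lpaComponent K G d) {d : ℤ}
    {x : LPA K G} (hx : x ∈ lpaComponent K G d) : twistHom σ hσ x ∈ twistDegree σ d := by
  have hpow : ∀ (k d : ℤ), ∀ x ∈ lpaComponent K G d, (σ ^ k) x ∈ lpaComponent K G d := by
    intro k d
    induction k with
    | zero => simp
    | succ k ih =>
      intro x hx
      rw [zpow_add_one]
      exact ih _ (hmem d x hx)
    | pred k ih =>
      intro x hx
      rw [zpow_sub_one]
      exact ih _ (hmem' d x hx)
  refine map_mem_of_mem_lpaComponent (B := Module.End K (LPA K G)) (twistHom σ hσ) (twistDegree σ)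
    ?_ ?_ ?_ ?_ hx
  · rintro d d' S T ⟨a, ha, hS⟩ ⟨b, hb, hT⟩
    refine ⟨a * (σ ^ d) b, mul_mem_lpaComponent ha (hpow d d' b hb), fun x => ?_⟩
    rw [Module.End.mul_apply, hS, hT, map_mul, zpow_add, mul_assoc]
    rfl
  · intro u
    refine ⟨_, vertexEl_mem_lpaComponent u, fun x => ?_⟩
    simp [twistHom, lpaLift_vertexEl, twistGen]
  · intro e
    refine ⟨_, edgeEl_mem_lpaComponent e, fun x => ?_⟩
    simp [twistHom, lpaLift_edgeEl, twistGen]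
  · intro e
    refine ⟨_, hmem' _ _ (ghostEl_mem_lpaComponent e), fun x => ?_⟩
    rw [zpow_neg_one]
    simp [twistHom, lpaLift_ghostEl, twistGen]

/-- A graded automorphism `σ` fixing the vertices yields an injective graded homomorphism to the
Zhang twist by `σ`. -/
lemma exists_hom_zhangTwist (hσ : ∀ u, σ (vertexEl K G u) = vertexEl K G u)
    (hmem : ∀ d, ∀ x ∈ lpaComponent K G d, σ x ∈ lpaComponent K G d)
    (hmem' : ∀ d, ∀ x ∈ lpaComponent K G d, σ.symm x ∈ lpaComponent K G d) :
    ∃ θ : LPA K G →ₗ[K] LPA K G, Function.Injective θ ∧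
      (∀ d, ∀ x ∈ lpaComponent K G d, θ x ∈ lpaComponent K G d) ∧ θ 1 = 1 ∧
      (∀ d : ℤ, ∀ a ∈ lpaComponent K G d, ∀ b, θ (a * b) = θ a * (σ ^ d) (θ b)) ∧
      (∀ u, θ (vertexEl K G u) = vertexEl K G u) ∧
      (∀ e, θ (edgeEl K G e) = edgeEl K G e) ∧
      ∀ e, θ (ghostEl K G e) = σ.symm (ghostEl K G e) := by
  let θ : LPA K G →ₗ[K] LPA K G := (LinearMap.applyₗ 1).comp (twistHom σ hσ).toLinearMap
  have hθ : ∀ x, θ x = twistHom σ hσ x 1 := fun _ => rfl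
  have h1 : θ 1 = 1 := by simp [hθ]
  have happly : ∀ d, ∀ a ∈ lpaComponent K G d,
      θ a ∈ lpaComponent K G d ∧ ∀ x, twistHom σ hσ a x = θ a * (σ ^ d) x := by
    intro d a ha
    obtain ⟨b, hb, h⟩ := twistHom_mem_twistDegree hσ hmem hmem' ha
    have hab : θ a = b := by simp [hθ, h]
    exact hab ▸ ⟨hb, h⟩
  have hvertex : ∀ u, θ (vertexEl K G u) = vertexEl K G u := fun u => by
    simp [hθ, twistHom, lpaLift_vertexEl, twistGen]
  refine ⟨θ, ?_, fun d x hx => (happly d x hx).1, h1, ?_, hvertex, ?_, ?_⟩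
  · refine injective_of_injOn_lpaComponent θ h1 (fun d x hx => (happly d x hx).1) ?_
    intro d x hx h
    refine eq_zero_of_mem_lpaComponent (B := Module.End K (LPA K G))
      (f := twistHom σ hσ) (fun u hu => ?_) hx ?_
    · apply vertexEl_ne_zero (K := K) u
      rw [← hvertex, hθ, hu, LinearMap.zero_apply]
    · ext y
      rw [(happly d x hx).2, h, zero_mul, LinearMap.zero_apply]
  · intro d a ha b
    rw [hθ, map_mul, Module.End.mul_apply, (happly d a ha).2, hθ b]
  · intro e
    simp [hθ, twistHom, lpaLift_edgeEl, twistGen]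
  · intro e
    simp [hθ, twistHom, lpaLift_ghostEl, twistGen]

end twist

lemma PhiProps.map_mem_lpaComponent {n : ℕ} {es : Fin n → G.E}
    {P P' : Matrix (Fin n) (Fin n) (LPA K G)} {φ : LPA K G →ₐ[K] LPA K G}
    (hφ : PhiProps K G es P P' φ)
    (hP : ∀ i j, P i j ∈ lpaComponent K G 0 ∧ P' i j ∈ lpaComponent K G 0) {d : ℤ}
    {x : LPA K G} (hx : x ∈ lpaComponent K G d) : φ x ∈ lpaComponent K G d := by
  obtain ⟨hv, he, hg, hei, hgi⟩ := hφ
  refine map_mem_of_mem_lpaComponent φ (lpaComponent K G) mul_mem_lpaComponent ?_ ?_ ?_ hx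
  · intro u
    rw [hv]
    exact vertexEl_mem_lpaComponent u
  · intro e
    by_cases h : e ∈ Set.range es
    · obtain ⟨i, rfl⟩ := h
      rw [hei]
      exact sum_mem fun k _ => by
        simpa using mul_mem_lpaComponent (edgeEl_mem_lpaComponent (es k)) (hP k i).1
    · rw [he e h]
      exact edgeEl_mem_lpaComponent e
  · intro e
    by_cases h : e ∈ Set.range es
    · obtain ⟨i, rfl⟩ := h
      rw [hgi]
      exact sum_mem fun k _ => by
        simpa using mul_mem_lpaComponent (hP i k).2 (ghostEl_mem_lpaComponent (es k))
    · rw [hg e h]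
      exact ghostEl_mem_lpaComponent e

end LeavittPathAlgebra

/-- Let `P, Q ∈ GL_n(w L_K(E)_0 w)` with `P φ_P(Q) = I_n` (so that
`φ_P` is a graded automorphism with inverse `φ_Q`).  Then there is a graded injective
`K`-algebra homomorphism `θ_P : L_K(E) → L_K(E)^{φ_P}` into the Zhang twist, fixing all
vertices, all edges, and all ghost edges other than `e_1*, …, e_n*`, and sending
`e_i* ↦ Σ_k q^{(-1)}_{ik} e_k*`.  (Multiplicativity into the Zhang twist is expressed by
`θ(ab) = θ(a) ⋆ θ(b) = θ(a)·φ_P^d(θ(b))` for `a` homogeneous of degree `d`, using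
`φ_Q = φ_P^{-1}` for negative `d`.) -/
theorem stmt12 (K : Type) [Field K] (G : DirGraph) (n : ℕ) (hn : 0 < n)
    (v w : G.V) (es : Fin n → G.E) (hes : Function.Injective es)
    (hs : ∀ i, G.s (es i) = v) (hr : ∀ i, G.r (es i) = w)
    (P P' Q Q' : Matrix (Fin n) (Fin n) (LPA K G))
    (hP : IsCornerGLPair K G w P P') (hQ : IsCornerGLPair K G w Q Q')
    (hP0 : ∀ i j, P i j ∈ lpaComponent K G 0 ∧ P' i j ∈ lpaComponent K G 0)
    (hQ0 : ∀ i j, Q i j ∈ lpaComponent K G 0 ∧ Q' i j ∈ lpaComponent K G 0)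
    (φP φQ : LPA K G →ₐ[K] LPA K G)
    (hφP : PhiProps K G es P P' φP) (hφQ : PhiProps K G es Q Q' φQ)
    (hPQ : P * Q.map ⇑φP = Matrix.diagonal (fun _ => vertexEl K G w))
    (hinv : ∀ x, φP (φQ x) = x ∧ φQ (φP x) = x) :
    ∃ θ : LPA K G →ₗ[K] LPA K G,
      Function.Injective ⇑θ ∧
      (∀ d : ℤ, ∀ x ∈ lpaComponent K G d, θ x ∈ lpaComponent K G d) ∧
      θ 1 = 1 ∧
      (∀ m : ℕ, ∀ a ∈ lpaComponent K G (m : ℤ), ∀ b,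
        θ (a * b) = θ a * (⇑φP)^[m] (θ b)) ∧
      (∀ m : ℕ, ∀ a ∈ lpaComponent K G (-(m : ℤ)), ∀ b,
        θ (a * b) = θ a * (⇑φQ)^[m] (θ b)) ∧
      (∀ u : G.V, θ (vertexEl K G u) = vertexEl K G u) ∧
      (∀ e : G.E, θ (edgeEl K G e) = edgeEl K G e) ∧
      (∀ f : G.E, f ∉ Set.range es → θ (ghostEl K G f) = ghostEl K G f) ∧
      (∀ i, θ (ghostEl K G (es i)) = ∑ k, Q' i k * ghostEl K G (es k)) := by
  let σ : LPA K G ≃ₐ[K] LPA K G := AlgEquiv.ofAlgHom φP φQ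
    (AlgHom.ext fun x => (hinv x).1) (AlgHom.ext fun x => (hinv x).2)
  have hpos : ∀ (m : ℕ) x, (σ ^ (m : ℤ)) x = φP^[m] x := by
    intro m x
    rw [zpow_natCast]
    induction m generalizing x with
    | zero => rfl
    | succ m ih => rw [pow_succ, Function.iterate_succ_apply, ← ih]; rfl
  have hneg : ∀ (m : ℕ) x, (σ ^ (-(m : ℤ))) x = φQ^[m] x := by
    intro m x
    rw [zpow_neg, zpow_natCast, ← inv_pow]
    induction m generalizing x with
    | zero => rfl
    | succ m ih => rw [pow_succ, Function.iterate_succ_apply, ← ih]; rfl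
  obtain ⟨θ, hinj, hgr, h1, hmul, hv, he, hg⟩ := exists_hom_zhangTwist (σ := σ) hφP.1
    (fun d x hx => hφP.map_mem_lpaComponent hP0 hx) (fun d x hx => hφQ.map_mem_lpaComponent hQ0 hx)
  refine ⟨θ, hinj, hgr, h1, ?_, ?_, hv, he, ?_, ?_⟩
  · intro m a ha b
    rw [hmul m a ha, hpos]
  · intro m a ha b
    rw [hmul _ a ha, hneg]
  · exact fun f hf => (hg f).trans (hφQ.2.2.1 f hf)
  · exact fun i => (hg (es i)).trans (hφQ.2.2.2.2 i)
end
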